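/- arXiv:0710.0946 — 8 statements merged into one kernel-verified Lean document; each statement's English description precedes it below -/
import Mathlib

section
/- Let F be ℝ or ℂ, let Q be a finite quiver with vertex set {1,…,t}, let n⃗ = (n_1,…,n_t) be a dimension vector, and let A ∈ R(n⃗,F). Let 𝒜(λ⃗) = A + ℬ(λ⃗) be a deformation of A such that k of the entries of ℬ(λ⃗) are the independent parameters λ_1,…,λ_k themselves (each parameter occupying exactly one entry) and all other entries of ℬ(λ⃗) are zero. Then 𝒜(λ⃗) is a miniversal deformation of A if and only if R(n⃗,F) = 𝒫_𝒜 ⊕ T_A (an internal direct sum of subspaces), where 𝒫_𝒜 is the k-dimensional subspace {ℬ(a⃗) : a⃗ ∈ F^k} and T_A = {[C,A] : C ∈ F^{n_1×n_1}×⋯×F^{n_t×n_t}}. -/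
open Matrix Filter

namespace ArnoldQuiver

variable (F : Type) [RCLike F]
variable {t : ℕ} {Arrow : Type} [Fintype Arrow] [DecidableEq Arrow]
variable (src tgt : Arrow → Fin t) (n : Fin t → ℕ)

/-- The space `R(n⃗, F)` of matrix representations of dimension `n⃗` of the quiver with
vertices `Fin t`, arrows `Arrow`, source map `src` and target map `tgt`. -/
abbrev Rep := ∀ α : Arrow, Matrix (Fin (n (tgt α))) (Fin (n (src α))) F

/-- A tuple `C = (C_1, …, C_t)` of square matrices attached to the vertices. -/
abbrev VertexMats := ∀ i : Fin t, Matrix (Fin (n i)) (Fin (n i)) F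

/-- `[C, A]_α = C_{e(α)} A_α − A_α C_{b(α)}`. -/
def bracket (C : VertexMats F n) (A : Rep F src tgt n) : Rep F src tgt n :=
  fun α => C (tgt α) * A α - A α * C (src α)

/-- A position of a matrix entry in a representation: an arrow together with a row and
column index. -/
abbrev EntryPos := Σ α : Arrow, Fin (n (tgt α)) × Fin (n (src α))

/-- The representation whose unique nonzero entry is a `1` at position `pp`. -/
def single (pp : EntryPos src tgt n) : Rep F src tgt n := fun α i j =>
  if (⟨α, (i, j)⟩ : EntryPos src tgt n) = pp then 1 else 0

/-- A deformation of `A` with `k` parameters: a family of representations whose entries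
are convergent power series (analytic germs at `0`) in the parameters, equal to `A` at
`0`. -/
def IsDeformation {k : ℕ} (A : Rep F src tgt n)
    (𝒜 : (Fin k → F) → Rep F src tgt n) : Prop :=
  𝒜 0 = A ∧ ∀ (α : Arrow) i j, AnalyticAt F (fun lam => 𝒜 lam α i j) (0 : Fin k → F)

/-- Equivalence of two deformations of `A`: an analytic family `I` of vertex matrices
with `I 0 = identity` conjugating one into the other near `0`. -/
def DeformEquiv {k : ℕ} (𝒜 ℬ : (Fin k → F) → Rep F src tgt n) : Prop :=
  ∃ I : (Fin k → F) → VertexMats F n,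
    (∀ (i : Fin t) (r c : Fin (n i)), AnalyticAt F (fun lam => I lam i r c) (0 : Fin k → F)) ∧
    (∀ i : Fin t, I 0 i = 1) ∧
    ∀ᶠ lam in nhds (0 : Fin k → F), ∀ α : Arrow,
      ℬ lam α = I lam (tgt α) * 𝒜 lam α * (I lam (src α))⁻¹

/-- Versality: every deformation of `A` is equivalent to one induced from `𝒜` by an
analytic change of parameters vanishing at `0`. -/
def IsVersal {k : ℕ} (A : Rep F src tgt n)
    (𝒜 : (Fin k → F) → Rep F src tgt n) : Prop :=
  IsDeformation F src tgt n A 𝒜 ∧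
  ∀ (l : ℕ) (ℬ : (Fin l → F) → Rep F src tgt n),
    IsDeformation F src tgt n A ℬ →
    ∃ φ : (Fin l → F) → Fin k → F,
      (∀ s : Fin k, AnalyticAt F (fun μ => φ μ s) (0 : Fin l → F)) ∧
      φ 0 = 0 ∧
      DeformEquiv F src tgt n ℬ (fun μ => 𝒜 (φ μ))

/-- Miniversality: versal, and no versal deformation of `A` has fewer parameters. -/
def IsMiniversal {k : ℕ} (A : Rep F src tgt n)
    (𝒜 : (Fin k → F) → Rep F src tgt n) : Prop :=
  IsVersal F src tgt n A 𝒜 ∧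
  ∀ (l : ℕ) (𝒞 : (Fin l → F) → Rep F src tgt n),
    IsVersal F src tgt n A 𝒞 → k ≤ l

section LocalEquations

variable {𝕜 : Type*} [RCLike 𝕜]
  {E : Type*} [NormedAddCommGroup E] [NormedSpace 𝕜 E] [FiniteDimensional 𝕜 E]
  {V : Type*} [NormedAddCommGroup V] [NormedSpace 𝕜 V]
  {R : Type*} [NormedAddCommGroup R] [NormedSpace 𝕜 R]

theorem _root_.LinearMap.analyticAt_of_finiteDimensional (f : E →ₗ[𝕜] R) (x : E) :
    AnalyticAt 𝕜 f x :=
  (LinearMap.toContinuousLinearMap f).analyticAt x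

theorem fderiv_const_add_linearMap (A : R) (B : E →ₗ[𝕜] R) (x a : E) :
    fderiv 𝕜 (fun y => A + B y) x a = B a := by
  have h : HasFDerivAt (fun y => A + B y) (LinearMap.toContinuousLinearMap B) x :=
    (LinearMap.toContinuousLinearMap B).hasFDerivAt.const_add A
  rw [h.fderiv]
  rfl

variable [FiniteDimensional 𝕜 V] [FiniteDimensional 𝕜 R]

omit [FiniteDimensional 𝕜 E] in
open scoped ContDiff in
/-- Let `P` and `L` be bilinear right and left actions of `V` on `R` with unit `e`. If `(s, c)` is a
right inverse of the linearization `(x, v) ↦ B x + P A v - L v A` of the intertwining equation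
`P (A + B x) (e + v) = L (e + v) X`, then this equation has a solution
`(x, v) = (s (g X), c (g X))` depending analytically on `X` near `A`. -/
theorem exists_analyticAt_intertwining_solution
    (P : R →ₗ[𝕜] V →ₗ[𝕜] R) (L : V →ₗ[𝕜] R →ₗ[𝕜] R) (e : V)
    (hP : ∀ M, P M e = M) (hL : ∀ M, L e M = M) (A : R) (B : E →ₗ[𝕜] R)
    (s : R →ₗ[𝕜] E) (c : R →ₗ[𝕜] V)
    (hsc : ∀ y, B (s y) + P A (c y) - L (c y) A = y) :
    ∃ g : R → R, AnalyticAt 𝕜 g A ∧ g A = 0 ∧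
      ∀ᶠ X in nhds A, P (A + B (s (g X))) (e + c (g X)) = L (e + c (g X)) X := by
  have := FiniteDimensional.complete 𝕜 R
  let PP := P.toContinuousBilinearMap
  let LL := L.toContinuousBilinearMap
  let Bs := LinearMap.toContinuousLinearMap (B ∘ₗ s)
  let cc := LinearMap.toContinuousLinearMap c
  let f : R × R → R := fun p => P (A + B (s p.2)) (e + c p.2) - L (e + c p.2) p.1
  have hu : HasFDerivAt (fun p : R × R => A + B (s p.2))
      (Bs ∘L ContinuousLinearMap.snd 𝕜 R R) (A, 0) :=
    (Bs ∘L ContinuousLinearMap.snd 𝕜 R R).hasFDerivAt.const_add A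
  have hv : HasFDerivAt (fun p : R × R => e + c p.2)
      (cc ∘L ContinuousLinearMap.snd 𝕜 R R) (A, 0) :=
    (cc ∘L ContinuousLinearMap.snd 𝕜 R R).hasFDerivAt.const_add e
  have hf := (PP.hasFDerivAt_of_bilinear hu hv).sub
    (LL.hasFDerivAt_of_bilinear hv (hasFDerivAt_fst (𝕜 := 𝕜) (p := ((A, 0) : R × R))))
  have cdf : ContDiffAt 𝕜 ω f (A, 0) := by
    have h1 : ContDiff 𝕜 ω fun p : R × R => A + B (s p.2) :=
      contDiff_const.add (Bs.contDiff.comp contDiff_snd)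
    have h2 : ContDiff 𝕜 ω fun p : R × R => e + c p.2 :=
      contDiff_const.add (cc.contDiff.comp contDiff_snd)
    exact ((PP.isBoundedBilinearMap.contDiff.comp (h1.prodMk h2)).sub
      (LL.isBoundedBilinearMap.contDiff.comp (h2.prodMk contDiff_fst))).contDiffAt
  have hinv : fderiv 𝕜 f (A, 0) ∘L ContinuousLinearMap.inr 𝕜 R R
      = ContinuousLinearMap.id 𝕜 R := by
    have hfd : fderiv 𝕜 f (A, 0) = _ := hf.fderiv
    rw [hfd]
    ext y
    simpa [hP, PP, LL, Bs, cc, add_comm] using hsc y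
  have if₂ : (fderiv 𝕜 f (A, 0) ∘L ContinuousLinearMap.inr 𝕜 R R).IsInvertible :=
    ⟨ContinuousLinearEquiv.refl 𝕜 R, by rw [hinv]; rfl⟩
  have hω : (ω : WithTop ℕ∞) ≠ 0 := by simp
  refine ⟨cdf.implicitFunction hω if₂, ?_, cdf.implicitFunction_apply_self hω if₂, ?_⟩
  · exact (cdf.contDiffAt_implicitFunction hω if₂).analyticAt
  · filter_upwards [cdf.eventually_apply_implicitFunction hω if₂] with X hX
    have h0 : f (A, 0) = 0 := by simp [f, hP, hL]
    rw [h0] at hX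
    exact sub_eq_zero.mp hX

/-- Differentiating an intertwining equation `m · J = J · (A + μ X)` at `μ = 0`. -/
theorem deriv_intertwining
    (P : R →ₗ[𝕜] V →ₗ[𝕜] R) (L : V →ₗ[𝕜] R →ₗ[𝕜] R) (e : V)
    (hP : ∀ M, P M e = M) (hL : ∀ M, L e M = M) (A X : R)
    {m : 𝕜 → R} {J : 𝕜 → V} {m' : R} {J' : V}
    (hm : HasDerivAt m m' 0) (hJ : HasDerivAt J J' 0) (hm0 : m 0 = A) (hJ0 : J 0 = e)
    (h : ∀ᶠ μ in nhds (0 : 𝕜), P (m μ) (J μ) = L (J μ) (A + μ • X)) :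
    X = m' + (P A J' - L J' A) := by
  have hX : HasDerivAt (fun μ : 𝕜 => A + μ • X) X 0 := by
    simpa using ((hasDerivAt_id (0 : 𝕜)).smul_const X).const_add A
  have h1 := P.toContinuousBilinearMap.hasDerivAt_of_bilinear (fun _ => hm) (fun _ => hJ)
  have h2 := L.toContinuousBilinearMap.hasDerivAt_of_bilinear (fun _ => hJ) (fun _ => hX)
  have h3 := h1.unique (h2.congr_of_eventuallyEq h)
  simp only [LinearMap.toContinuousBilinearMap_apply, hm0, hJ0, hP, hL, zero_smul, add_zero] at h3
  rw [add_sub_assoc', add_comm m', h3, add_sub_cancel_right]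

end LocalEquations

section VertexwiseMultiplication

omit [Fintype Arrow] [DecidableEq Arrow]

/-- Vertexwise multiplication on the right, `(M · C)_α = M_α C_{b(α)}`. -/
noncomputable def mulRight : Rep F src tgt n →ₗ[F] VertexMats F n →ₗ[F] Rep F src tgt n :=
  IsBilinearMap.toLinearMap (R := F)
    (f := fun (M : Rep F src tgt n) (C : VertexMats F n) α => M α * C (src α))
    { add_left := fun _ _ _ => by funext α; simp [Matrix.add_mul]
      smul_left := fun _ _ _ => by funext α; simp
      add_right := fun _ _ _ => by funext α; simp [Matrix.mul_add]
      smul_right := fun _ _ _ => by funext α; simp }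

/-- Vertexwise multiplication on the left, `(C · M)_α = C_{e(α)} M_α`. -/
noncomputable def mulLeft : VertexMats F n →ₗ[F] Rep F src tgt n →ₗ[F] Rep F src tgt n :=
  IsBilinearMap.toLinearMap (R := F)
    (f := fun (C : VertexMats F n) (M : Rep F src tgt n) α => C (tgt α) * M α)
    { add_left := fun _ _ _ => by funext α; simp [Matrix.add_mul]
      smul_left := fun _ _ _ => by funext α; simp
      add_right := fun _ _ _ => by funext α; simp [Matrix.mul_add]
      smul_right := fun _ _ _ => by funext α; simp }

theorem mulRight_apply (M : Rep F src tgt n) (C : VertexMats F n) (α : Arrow) :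
    mulRight F src tgt n M C α = M α * C (src α) := rfl

theorem mulLeft_apply (C : VertexMats F n) (M : Rep F src tgt n) (α : Arrow) :
    mulLeft F src tgt n C M α = C (tgt α) * M α := rfl

theorem mulRight_one (M : Rep F src tgt n) : mulRight F src tgt n M 1 = M := by
  funext α; simp [mulRight_apply]

theorem mulLeft_one (M : Rep F src tgt n) : mulLeft F src tgt n 1 M = M := by
  funext α; simp [mulLeft_apply]

theorem bracket_eq (C : VertexMats F n) (A : Rep F src tgt n) :
    bracket F src tgt n C A = mulLeft F src tgt n C A - mulRight F src tgt n A C := rfl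

/-- The tangent map `C ↦ [C, A]`. -/
noncomputable def bracketMap (A : Rep F src tgt n) : VertexMats F n →ₗ[F] Rep F src tgt n :=
  (mulLeft F src tgt n).flip A - mulRight F src tgt n A

theorem bracketMap_apply (A : Rep F src tgt n) (C : VertexMats F n) :
    bracketMap F src tgt n A C = bracket F src tgt n C A := rfl

end VertexwiseMultiplication

section Representations

open scoped Matrix.Norms.Elementwise

omit [DecidableEq Arrow]

theorem analyticAt_rep_iff {E : Type*} [NormedAddCommGroup E] [NormedSpace F E]
    {f : E → Rep F src tgt n} {x : E} :
    AnalyticAt F f x ↔ ∀ α i j, AnalyticAt F (fun y => f y α i j) x := by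
  refine ⟨fun h α i j => ?_, fun h => ?_⟩
  · have h1 := analyticAt_pi_iff.mp h α
    have h2 := analyticAt_pi_iff.mp (show AnalyticAt F (fun y i => f y α i) x from h1) i
    exact analyticAt_pi_iff.mp h2 j
  · refine AnalyticAt.pi fun α => ?_
    exact AnalyticAt.pi fun i => AnalyticAt.pi fun j => h α i j

theorem analyticAt_vertexMats_iff {E : Type*} [NormedAddCommGroup E] [NormedSpace F E]
    {f : E → VertexMats F n} {x : E} :
    AnalyticAt F f x ↔ ∀ i r c, AnalyticAt F (fun y => f y i r c) x := by
  refine ⟨fun h α i j => ?_, fun h => ?_⟩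
  · have h1 := analyticAt_pi_iff.mp h α
    have h2 := analyticAt_pi_iff.mp (show AnalyticAt F (fun y i => f y α i) x from h1) i
    exact analyticAt_pi_iff.mp h2 j
  · refine AnalyticAt.pi fun α => ?_
    exact AnalyticAt.pi fun i => AnalyticAt.pi fun j => h α i j

/-- A continuous family of vertex matrices equal to the identity at a point is invertible
nearby. -/
theorem eventually_isUnit_det {E : Type*} [TopologicalSpace E]
    {I : E → VertexMats F n} {x : E} (hI : ContinuousAt I x) (h1 : I x = 1) :
    ∀ᶠ y in nhds x, ∀ i, IsUnit (I y i).det := by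
  refine eventually_all.mpr fun i => ?_
  have hc : ContinuousAt (fun y => (I y i).det) x :=
    continuous_id.matrix_det.continuousAt.comp ((continuous_apply i).continuousAt.comp hI)
  have h0 : (I x i).det ≠ 0 := by simp [h1]
  exact (hc.eventually_ne h0).mono fun y hy => isUnit_iff_ne_zero.mpr hy

/-- An affine family through `A` which is transversal to the orbit of `A` is versal. -/
theorem isVersal_of_spanning (A : Rep F src tgt n) {k : ℕ}
    (B : (Fin k → F) →ₗ[F] Rep F src tgt n)
    (h : ∀ X, ∃ (a : Fin k → F) (C : VertexMats F n), X = B a + bracket F src tgt n C A) :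
    IsVersal F src tgt n A (fun lam => A + B lam) := by
  refine ⟨⟨by simp, ?_⟩, ?_⟩
  · refine (analyticAt_rep_iff F src tgt n).mp ?_
    exact analyticAt_const.add (B.analyticAt_of_finiteDimensional 0)
  intro l ℬ hℬ
  have hsurj : Function.Surjective (B.coprod (bracketMap F src tgt n A)) := fun X => by
    obtain ⟨a, C, hX⟩ := h X
    exact ⟨(a, C), by simp [hX, bracketMap_apply]⟩
  obtain ⟨r, hr⟩ := LinearMap.exists_rightInverse_of_surjective _ (LinearMap.range_eq_top.mpr hsurj)
  let s : Rep F src tgt n →ₗ[F] (Fin k → F) := LinearMap.fst F _ _ ∘ₗ r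
  let c : Rep F src tgt n →ₗ[F] VertexMats F n := -(LinearMap.snd F _ _ ∘ₗ r)
  have hs : ∀ y, s y = (r y).1 := fun _ => rfl
  have hc : ∀ y, c y = -(r y).2 := fun _ => rfl
  obtain ⟨g, hg, hgA, hgX⟩ := exists_analyticAt_intertwining_solution
    (mulRight F src tgt n) (mulLeft F src tgt n) 1 (mulRight_one F src tgt n)
    (mulLeft_one F src tgt n) A B s c (fun y => by
      have h1 := LinearMap.congr_fun hr y
      simp only [LinearMap.comp_apply, LinearMap.coprod_apply, bracketMap_apply, bracket_eq,
        LinearMap.id_apply] at h1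
      rw [hs, hc]
      simp only [map_neg, LinearMap.neg_apply]
      nth_rewrite 4 [← h1]
      abel)
  have hℬa : AnalyticAt F ℬ 0 := (analyticAt_rep_iff F src tgt n).mpr hℬ.2
  have hgℬ : AnalyticAt F (fun μ => g (ℬ μ)) 0 := by
    rw [← hℬ.1] at hg
    exact hg.comp hℬa
  have hIa : AnalyticAt F (fun μ => (1 + c (g (ℬ μ)) : VertexMats F n)) 0 :=
    analyticAt_const.add ((c.analyticAt_of_finiteDimensional _).comp hgℬ)
  have hI0 : (1 + c (g (ℬ 0)) : VertexMats F n) = 1 := by rw [hℬ.1, hgA]; simp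
  refine ⟨fun μ => s (g (ℬ μ)), ?_, by simp [hℬ.1, hgA], fun μ => 1 + c (g (ℬ μ)), ?_, ?_, ?_⟩
  · exact analyticAt_pi_iff.mp ((s.analyticAt_of_finiteDimensional _).comp hgℬ)
  · exact (analyticAt_vertexMats_iff F n).mp hIa
  · exact fun i => congrFun hI0 i
  · have hlim := hℬa.continuousAt.tendsto
    rw [hℬ.1] at hlim
    filter_upwards [hlim.eventually hgX, eventually_isUnit_det F n hIa.continuousAt hI0] with μ h1 h2 α
    have h3 := congrFun h1 α
    rw [mulRight_apply, mulLeft_apply] at h3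
    rw [← h3, Matrix.mul_assoc, Matrix.mul_nonsing_inv _ (h2 _), Matrix.mul_one]

/-- The image of the derivative of a versal deformation is transversal to the orbit of `A`. -/
theorem IsVersal.exists_eq_fderiv_add_bracket {A : Rep F src tgt n} {k : ℕ}
    {𝒜 : (Fin k → F) → Rep F src tgt n} (h : IsVersal F src tgt n A 𝒜) (X : Rep F src tgt n) :
    ∃ (a : Fin k → F) (C : VertexMats F n),
      X = fderiv F 𝒜 0 a + bracket F src tgt n C A := by
  have hline : AnalyticAt F (fun μ : Fin 1 → F => A + μ 0 • X) 0 := by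
    exact analyticAt_const.add (LinearMap.analyticAt_of_finiteDimensional
      ((LinearMap.proj (R := F) (φ := fun _ : Fin 1 => F) 0).smulRight X) 0)
  obtain ⟨φ, hφ, hφ0, I, hI, hI0, hE⟩ := h.2 1 (fun μ => A + μ 0 • X)
    ⟨by simp, (analyticAt_rep_iff F src tgt n).mp hline⟩
  have hφa : AnalyticAt F φ 0 := analyticAt_pi_iff.mpr hφ
  have hIa : AnalyticAt F I 0 := (analyticAt_vertexMats_iff F n).mpr hI
  have h𝒜 : AnalyticAt F 𝒜 0 := (analyticAt_rep_iff F src tgt n).mpr h.1.2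
  have hdiag : HasDerivAt (fun x : F => (fun _ : Fin 1 => x)) (fun _ => 1) 0 :=
    hasDerivAt_pi.mpr fun _ => hasDerivAt_id _
  have hφd : HasDerivAt (fun x : F => φ fun _ => x) (fderiv F φ 0 fun _ => 1) 0 :=
    HasFDerivAt.comp_hasDerivAt (0 : F) (l := φ) (f := fun x : F => (fun _ : Fin 1 => x))
      hφa.differentiableAt.hasFDerivAt hdiag
  have hId : HasDerivAt (fun x : F => I fun _ => x) (fderiv F I 0 fun _ => 1) 0 :=
    HasFDerivAt.comp_hasDerivAt (0 : F) (l := I) (f := fun x : F => (fun _ : Fin 1 => x))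
      hIa.differentiableAt.hasFDerivAt hdiag
  have hφ0' : (φ fun _ => (0 : F)) = 0 := hφ0
  have hmd : HasDerivAt (fun x : F => 𝒜 (φ fun _ => x))
      (fderiv F 𝒜 0 (fderiv F φ 0 fun _ => 1)) 0 :=
    HasFDerivAt.comp_hasDerivAt (0 : F) (l := 𝒜) (f := fun x : F => φ fun _ => x)
      (by rw [hφ0']; exact h𝒜.differentiableAt.hasFDerivAt) hφd
  have hI0' : I 0 = 1 := funext hI0
  have hev : ∀ᶠ x in nhds (0 : F),
      mulRight F src tgt n (𝒜 (φ fun _ => x)) (I fun _ => x)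
        = mulLeft F src tgt n (I fun _ => x) (A + x • X) := by
    have hdc : Filter.Tendsto (fun x : F => (fun _ : Fin 1 => x)) (nhds 0) (nhds 0) :=
      hdiag.continuousAt
    filter_upwards [hdc.eventually (hE.and (eventually_isUnit_det F n hIa.continuousAt hI0'))]
      with x hx
    funext α
    rw [mulRight_apply, mulLeft_apply, hx.1 α, Matrix.mul_assoc,
      Matrix.nonsing_inv_mul _ (hx.2 _), Matrix.mul_one]
  have key := deriv_intertwining (mulRight F src tgt n) (mulLeft F src tgt n) 1
    (mulRight_one F src tgt n) (mulLeft_one F src tgt n) A X hmd hId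
    (by rw [hφ0', h.1.1]) hI0' hev
  refine ⟨fderiv F φ 0 fun _ => 1, -(fderiv F I 0 fun _ => 1), ?_⟩
  rw [bracket_eq]
  nth_rewrite 1 [key]
  rw [map_neg, map_neg, LinearMap.neg_apply, neg_sub_neg]

/-- A versal affine family through `A` is transversal to the orbit of `A`. -/
theorem spanning_of_isVersal (A : Rep F src tgt n) {k : ℕ}
    (B : (Fin k → F) →ₗ[F] Rep F src tgt n)
    (h : IsVersal F src tgt n A (fun lam => A + B lam)) (X : Rep F src tgt n) :
    ∃ (a : Fin k → F) (C : VertexMats F n), X = B a + bracket F src tgt n C A := by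
  obtain ⟨a, C, hX⟩ := h.exists_eq_fderiv_add_bracket F src tgt n X
  exact ⟨a, C, hX.trans (congrArg (· + _) (fderiv_const_add_linearMap A B 0 a))⟩

/-- A versal deformation has at least as many parameters as the codimension of the tangent space
to the orbit. -/
theorem IsVersal.finrank_quotient_le {A : Rep F src tgt n} {k : ℕ}
    {𝒜 : (Fin k → F) → Rep F src tgt n} (h : IsVersal F src tgt n A 𝒜) :
    Module.finrank F (Rep F src tgt n ⧸ (bracketMap F src tgt n A).range) ≤ k := by
  let T := (bracketMap F src tgt n A).range
  have hsurj : Function.Surjective (T.mkQ ∘ₗ (fderiv F 𝒜 0).toLinearMap) := fun y => by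
    obtain ⟨X, rfl⟩ := T.mkQ_surjective y
    obtain ⟨a, C, hX⟩ := h.exists_eq_fderiv_add_bracket F src tgt n X
    refine ⟨a, (Submodule.Quotient.eq T).mpr ⟨-C, ?_⟩⟩
    rw [map_neg, bracketMap_apply]
    exact neg_eq_of_add_eq_zero_left (by rw [← hX.symm, sub_add_eq_add_sub]; simp)
  simpa using LinearMap.finrank_le_finrank_of_surjective hsurj

/-- There is a versal deformation with as many parameters as the codimension of the tangent space
to the orbit. -/
theorem exists_isVersal_finrank_quotient (A : Rep F src tgt n) :
    ∃ 𝒞 : (Fin (Module.finrank F (Rep F src tgt n ⧸ (bracketMap F src tgt n A).range)) → F) →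
      Rep F src tgt n, IsVersal F src tgt n A 𝒞 := by
  let T := (bracketMap F src tgt n A).range
  obtain ⟨r, hr⟩ := LinearMap.exists_rightInverse_of_surjective T.mkQ T.range_mkQ
  let b := (Module.finBasis F (Rep F src tgt n ⧸ T)).equivFun
  refine ⟨_, isVersal_of_spanning F src tgt n A (r ∘ₗ b.symm.toLinearMap) fun X => ?_⟩
  have h1 : T.mkQ (r (T.mkQ X)) = T.mkQ X := LinearMap.congr_fun hr _
  obtain ⟨C, hC⟩ := (Submodule.Quotient.eq T).mp h1.symm
  refine ⟨b (T.mkQ X), C, ?_⟩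
  rw [← bracketMap_apply, hC]
  simp

end Representations

omit [Fintype Arrow] in
theorem sum_smul_single_injective {k : ℕ}
    (pos : Fin k → EntryPos src tgt n) (hpos : Function.Injective pos) (a : Fin k → F)
    (h : ∑ s1 : Fin k, a s1 • single F src tgt n (pos s1) = 0) : a = 0 := by
  funext s0
  have h1 := congrFun (congrFun (congrFun h (pos s0).1) (pos s0).2.1) (pos s0).2.2
  rw [Finset.sum_apply, Matrix.sum_apply] at h1
  simpa [single, hpos.eq_iff, eq_comm] using h1

/-- Theorem 2.1 of the paper: for a deformation `𝒜(λ) = A + ℬ(λ)` in which `k` entries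
are the independent parameters `λ_1, …, λ_k` (at the pairwise distinct positions
`pos 1, …, pos k`) and all other entries are zero, `𝒜` is a miniversal deformation of
`A` if and only if `R(n⃗,F) = 𝒫_𝒜 ⊕ T_A`; the internal direct sum is expressed by
existence and uniqueness of decompositions `X = ℬ(a) + [C, A]`. -/
theorem simplest_miniversal_criterion (A : Rep F src tgt n) {k : ℕ}
    (pos : Fin k → EntryPos src tgt n) (hpos : Function.Injective pos) :
    IsMiniversal F src tgt n A
        (fun lam => A + ∑ s1 : Fin k, lam s1 • single F src tgt n (pos s1)) ↔
      ((∀ X : Rep F src tgt n, ∃ (a : Fin k → F) (C : VertexMats F n),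
          X = (∑ s1 : Fin k, a s1 • single F src tgt n (pos s1))
                + bracket F src tgt n C A) ∧
       (∀ (a : Fin k → F) (C : VertexMats F n),
          (∑ s1 : Fin k, a s1 • single F src tgt n (pos s1))
              + bracket F src tgt n C A = 0 →
            (∑ s1 : Fin k, a s1 • single F src tgt n (pos s1)) = 0 ∧
              bracket F src tgt n C A = 0)) := by
  let T := (bracketMap F src tgt n A).range
  let B : (Fin k → F) →ₗ[F] Rep F src tgt n :=
    Fintype.linearCombination F fun s1 => single F src tgt n (pos s1)
  have hB : ∀ a, B a = ∑ s1 : Fin k, a s1 • single F src tgt n (pos s1) := fun _ => rfl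
  simp only [← hB]
  constructor
  · rintro ⟨hv, hmin⟩
    obtain ⟨𝒞, h𝒞⟩ := exists_isVersal_finrank_quotient F src tgt n A
    have hspan := spanning_of_isVersal F src tgt n A B hv
    refine ⟨hspan, fun a C h => ?_⟩
    have hsurj : Function.Surjective (T.mkQ ∘ₗ B) := fun y => by
      obtain ⟨X, rfl⟩ := T.mkQ_surjective y
      obtain ⟨a, C, hX⟩ := hspan X
      exact ⟨a, (Submodule.Quotient.eq T).mpr ⟨-C, by rw [map_neg, bracketMap_apply, hX]; abel⟩⟩
    have hfin : Module.finrank F (Fin k → F) = Module.finrank F (Rep F src tgt n ⧸ T) :=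
      le_antisymm (by simpa using hmin _ 𝒞 h𝒞) (LinearMap.finrank_le_finrank_of_surjective hsurj)
    have hinj := (LinearMap.injective_iff_surjective_of_finrank_eq_finrank hfin).mpr hsurj
    have ha : a = 0 := hinj (by
      rw [map_zero]
      refine (Submodule.Quotient.mk_eq_zero T).mpr ⟨-C, ?_⟩
      rw [map_neg, bracketMap_apply]
      exact neg_eq_of_add_eq_zero_left h)
    rw [ha, map_zero] at h ⊢
    exact ⟨rfl, by simpa using h⟩
  · rintro ⟨hspan, hdirect⟩
    refine ⟨isVersal_of_spanning F src tgt n A B hspan, fun l 𝒞 h𝒞 => ?_⟩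
    refine le_trans ?_ (h𝒞.finrank_quotient_le F src tgt n)
    have hinj : Function.Injective (T.mkQ ∘ₗ B) := by
      refine (injective_iff_map_eq_zero _).mpr fun a ha => ?_
      obtain ⟨C, hC⟩ := (Submodule.Quotient.mk_eq_zero T).mp ha
      refine sum_smul_single_injective F src tgt n pos hpos a (hdirect a (-C) ?_).1
      rw [← bracketMap_apply, map_neg, hC, add_neg_cancel]
    simpa using LinearMap.finrank_le_finrank_of_injective hinj

end ArnoldQuiver
end

section
/- Let F be ℝ or ℂ, let Q be a finite quiver with vertex set {1,…,t}, let n⃗ = (n_1,…,n_t) be a dimension vector, and let A ∈ R(n⃗,F). Then there exist finitely many representations E_{i_1},…,E_{i_k} ∈ R(n⃗,F), each of which has exactly one matrix entry equal to 1 and all other entries equal to 0, such that R(n⃗,F) is the internal direct sum of span{E_{i_1},…,E_{i_k}} and T_A = {[C,A] : C ∈ F^{n_1×n_1}×⋯×F^{n_t×n_t}}. -/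
open Matrix

namespace ArnoldQuiverCor

variable (F : Type) [RCLike F]
variable {t : ℕ} {Arrow : Type} [Fintype Arrow] [DecidableEq Arrow]
variable (src tgt : Arrow → Fin t) (n : Fin t → ℕ)

/-- The space `R(n⃗, F)` of matrix representations of dimension `n⃗` of the quiver with
vertices `Fin t`, arrows `Arrow`, source map `src` and target map `tgt`. -/
abbrev Rep := ∀ α : Arrow, Matrix (Fin (n (tgt α))) (Fin (n (src α))) F

/-- A tuple `C = (C_1, …, C_t)` of square matrices attached to the vertices. -/
abbrev VertexMats := ∀ i : Fin t, Matrix (Fin (n i)) (Fin (n i)) F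

/-- `[C, A]_α = C_{e(α)} A_α − A_α C_{b(α)}`. -/
def bracket (C : VertexMats F n) (A : Rep F src tgt n) : Rep F src tgt n :=
  fun α => C (tgt α) * A α - A α * C (src α)

/-- A position of a matrix entry in a representation. -/
abbrev EntryPos := Σ α : Arrow, Fin (n (tgt α)) × Fin (n (src α))

/-- The representation whose unique nonzero entry is a `1` at position `pp`. -/
def single (pp : EntryPos src tgt n) : Rep F src tgt n := fun α i j =>
  if (⟨α, (i, j)⟩ : EntryPos src tgt n) = pp then 1 else 0

/-- A finite spanning family contains a subfamily whose span is complementary to a given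
subspace, and which is linearly independent modulo that subspace. -/
theorem exists_complementary_subfamily {K V ι : Type*} [Field K] [AddCommGroup V] [Module K V]
    [Finite ι] (W : Submodule K V) (e : ι → V) (he : Submodule.span K (Set.range e) = ⊤) :
    ∃ (k : ℕ) (pos : Fin k → ι), Function.Injective pos ∧
      (∀ x : V, ∃ a : Fin k → K, ∃ w ∈ W, x = (∑ s, a s • e (pos s)) + w) ∧
      (∀ a : Fin k → K, ∀ w ∈ W, (∑ s, a s • e (pos s)) + w = 0 → a = 0) := by
  obtain ⟨b, -, -, hspan, hli⟩ := exists_linearIndepOn_extension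
    (linearIndepOn_empty K (W.mkQ ∘ e)) (Set.empty_subset Set.univ)
  obtain ⟨k, ⟨f⟩⟩ := Finite.exists_equiv_fin b
  have htop : Submodule.span K (Set.range fun s => W.mkQ (e (f.symm s))) = ⊤ := by
    have hrange : (Set.range fun s => W.mkQ (e (f.symm s))) = (W.mkQ ∘ e) '' b := by
      rw [Set.image_eq_range]
      exact f.symm.surjective.range_comp fun i : b => W.mkQ (e i)
    rw [hrange, eq_top_iff, ← W.range_mkQ, LinearMap.range_eq_map, ← he, Submodule.map_span,
      ← Set.range_comp, ← Set.image_univ]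
    exact Submodule.span_le.2 hspan
  refine ⟨k, fun s => f.symm s, Subtype.val_injective.comp f.symm.injective, fun x => ?_,
    fun a w hw h => ?_⟩
  · have hx : W.mkQ x ∈ Submodule.span K (Set.range fun s => W.mkQ (e (f.symm s))) := by
      rw [htop]; exact Submodule.mem_top
    obtain ⟨a, ha⟩ := (Submodule.mem_span_range_iff_exists_fun K).1 hx
    refine ⟨a, x - ∑ s, a s • e (f.symm s), ?_, by abel⟩
    rw [← Submodule.ker_mkQ W, LinearMap.mem_ker, map_sub, sub_eq_zero, ← ha]
    simp only [map_sum, map_smul]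
  · have hli' : LinearIndependent K fun s => W.mkQ (e (f.symm s)) :=
      LinearIndependent.comp hli f.symm f.symm.injective
    refine funext (Fintype.linearIndependent_iff.1 hli' a ?_)
    have hw' : W.mkQ w = 0 := by simpa using hw
    have hsum := congrArg W.mkQ h
    simpa only [map_add, hw', add_zero, map_sum, map_smul, map_zero] using hsum

/-- The linear map `C ↦ [C, A]`. -/
def bracketLinearMap (A : Rep F src tgt n) : VertexMats F n →ₗ[F] Rep F src tgt n where
  toFun C := bracket F src tgt n C A
  map_add' C D := by
    funext α
    simp only [bracket, Pi.add_apply, Matrix.add_mul, Matrix.mul_add]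
    abel
  map_smul' c C := by
    funext α
    simp [bracket, smul_sub]

theorem span_range_single :
    Submodule.span F (Set.range (single F src tgt n)) = ⊤ := by
  refine eq_top_iff.2 fun X _ => (Submodule.mem_span_range_iff_exists_fun F).2
    ⟨fun pp => X pp.1 pp.2.1 pp.2.2, ?_⟩
  funext α
  ext i j
  simp only [Finset.sum_apply, Matrix.sum_apply, Pi.smul_apply, Matrix.smul_apply, single,
    smul_eq_mul, mul_ite, mul_one, mul_zero, Finset.sum_ite_eq, Finset.mem_univ, if_true]

/-- Corollary 2.1 of the paper: there exist finitely many pairwise distinct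
representations `E_{i_1}, …, E_{i_k}`, each with exactly one entry equal to `1` and all
other entries `0`, such that `R(n⃗,F)` is the internal direct sum of their span and the
subspace `T_A = {[C,A]}`: every `X` decomposes, uniquely, as a linear combination of the
`E`'s plus a `[C,A]`. -/
theorem exists_simplest_miniversal (A : Rep F src tgt n) :
    ∃ (k : ℕ) (pos : Fin k → EntryPos src tgt n), Function.Injective pos ∧
      (∀ X : Rep F src tgt n, ∃ (a : Fin k → F) (C : VertexMats F n),
        X = (∑ s : Fin k, a s • single F src tgt n (pos s)) + bracket F src tgt n C A) ∧
      (∀ (a : Fin k → F) (C : VertexMats F n),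
        (∑ s : Fin k, a s • single F src tgt n (pos s)) + bracket F src tgt n C A = 0 →
          (∑ s : Fin k, a s • single F src tgt n (pos s)) = 0 ∧
            bracket F src tgt n C A = 0) := by
  obtain ⟨k, pos, hpos, hex, huniq⟩ := exists_complementary_subfamily
    (LinearMap.range (bracketLinearMap F src tgt n A)) (single F src tgt n)
    (span_range_single F src tgt n)
  refine ⟨k, pos, hpos, fun X => ?_, fun a C h => ?_⟩
  · obtain ⟨a, _, ⟨C, rfl⟩, hX⟩ := hex X
    exact ⟨a, C, hX⟩
  · have hsum : ∑ s, a s • single F src tgt n (pos s) = 0 := by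
      simp [huniq a _ ⟨C, rfl⟩ h]
    exact ⟨hsum, by simpa only [hsum, zero_add] using h⟩

end ArnoldQuiverCor
end

section
/- Let F be ℝ or ℂ, let Q be a finite quiver with vertex set {1,…,t}, let n⃗ be a dimension vector, and let A, B ∈ R(n⃗,F). Then ⟨B, [C,A]⟩ = 0 for all C = (C_1,…,C_t) ∈ F^{n_1×n_1}×⋯×F^{n_t×n_t} if and only if for every vertex i one has Σ_{α : e(α)=i} B_α A_α^* = Σ_{α : b(α)=i} A_α^* B_α, where the sums range over the arrows ending at i and starting at i respectively. In other words, the orthogonal complement of the tangent space T_A = {[C,A] : C} in R(n⃗,F) is the solution set of this system of matrix equations. -/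
open Matrix

/-- The sum over the arrows `α` with `v α = i` of the square matrices `M α`, each transported
along `v α = i`. -/
def vertexSum {F : Type*} [RCLike F] {V Arrow : Type*} [DecidableEq V] [Fintype Arrow]
    (v : Arrow → V) (n : V → ℕ) (M : ∀ α, Matrix (Fin (n (v α))) (Fin (n (v α))) F) (i : V) :
    Matrix (Fin (n i)) (Fin (n i)) F :=
  fun x y => ∑ α, if h : v α = i then
    M α (Fin.cast (congrArg n h).symm x) (Fin.cast (congrArg n h).symm y) else 0

theorem sum_trace_vertexSum_mul_conjTranspose {F : Type*} [RCLike F] {V Arrow : Type*}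
    [Fintype V] [DecidableEq V] [Fintype Arrow] (v : Arrow → V) (n : V → ℕ)
    (M : ∀ α, Matrix (Fin (n (v α))) (Fin (n (v α))) F)
    (C : ∀ i, Matrix (Fin (n i)) (Fin (n i)) F) :
    ∑ i, trace (vertexSum v n M i * (C i)ᴴ) = ∑ α, trace (M α * (C (v α))ᴴ) := by
  have key : ∀ i, trace (vertexSum v n M i * (C i)ᴴ) =
      ∑ α, if v α = i then trace (M α * (C (v α))ᴴ) else 0 := by
    intro i
    have expand : vertexSum v n M i = ∑ α, if h : v α = i then
        (M α).submatrix (Fin.cast (congrArg n h).symm) (Fin.cast (congrArg n h).symm) else 0 := by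
      ext x y
      rw [Matrix.sum_apply]
      refine Finset.sum_congr rfl fun α _ => ?_
      split_ifs <;> rfl
    rw [expand, Finset.sum_mul, trace_sum]
    refine Finset.sum_congr rfl fun α _ => ?_
    split_ifs with h
    · subst h
      rfl
    · simp
  simp_rw [key]
  rw [Finset.sum_comm]
  simp

open scoped ComplexOrder in
theorem forall_sum_trace_mul_conjTranspose_eq_zero_iff {F : Type*} [RCLike F] {V : Type*}
    [Fintype V] (n : V → ℕ) (D : ∀ i, Matrix (Fin (n i)) (Fin (n i)) F) :
    (∀ C : ∀ i, Matrix (Fin (n i)) (Fin (n i)) F, ∑ i, trace (D i * (C i)ᴴ) = 0) ↔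
      ∀ i, D i = 0 := by
  refine ⟨fun h i => ?_, fun h C => by simp [h]⟩
  have := (Finset.sum_eq_zero_iff_of_nonneg fun i _ =>
    (posSemidef_self_mul_conjTranspose (D i)).trace_nonneg).1 (h D) i (Finset.mem_univ i)
  exact trace_mul_conjTranspose_self_eq_zero_iff.1 this

/-- Orthogonality to the tangent space, for quiver representations.  The quiver has
vertices `Fin t` and arrows `Arrow` with source `src` and target `tgt`; a matrix
representation assigns to each arrow `α` a matrix of size `n (tgt α) × n (src α)`.
`⟨B, [C,A]⟩ = 0` for all `C` iff for every vertex `i`,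
`Σ_{tgt α = i} B_α A_α^* = Σ_{src α = i} A_α^* B_α` (stated entrywise, transporting
along `tgt α = i` resp. `src α = i`). -/
theorem orthogonal_complement_tangent_space
    (F : Type*) [RCLike F] {t : ℕ} {Arrow : Type} [Fintype Arrow]
    (src tgt : Arrow → Fin t) (n : Fin t → ℕ)
    (A B : ∀ α : Arrow, Matrix (Fin (n (tgt α))) (Fin (n (src α))) F) :
    (∀ C : ∀ i : Fin t, Matrix (Fin (n i)) (Fin (n i)) F,
        ∑ α : Arrow,
          Matrix.trace (B α * (C (tgt α) * A α - A α * C (src α))ᴴ) = 0) ↔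
    (∀ (i : Fin t) (x y : Fin (n i)),
        (∑ α : Arrow, if h : tgt α = i then
            (B α * (A α)ᴴ) (Fin.cast (congrArg n h).symm x) (Fin.cast (congrArg n h).symm y)
          else 0) =
        (∑ α : Arrow, if h : src α = i then
            ((A α)ᴴ * B α) (Fin.cast (congrArg n h).symm x) (Fin.cast (congrArg n h).symm y)
          else 0)) := by
  have pairing : ∀ C : ∀ i : Fin t, Matrix (Fin (n i)) (Fin (n i)) F,
      ∑ α, trace (B α * (C (tgt α) * A α - A α * C (src α))ᴴ) =
        ∑ i, trace ((vertexSum tgt n (fun α => B α * (A α)ᴴ) i -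
          vertexSum src n (fun α => (A α)ᴴ * B α) i) * (C i)ᴴ) := by
    intro C
    simp_rw [Matrix.sub_mul, trace_sub, Finset.sum_sub_distrib,
      sum_trace_vertexSum_mul_conjTranspose]
    rw [← Finset.sum_sub_distrib]
    refine Finset.sum_congr rfl fun α _ => ?_
    rw [conjTranspose_sub, conjTranspose_mul, conjTranspose_mul, Matrix.mul_sub, trace_sub,
      ← Matrix.mul_assoc, ← Matrix.mul_assoc, trace_mul_cycle (B α) (C (src α))ᴴ]
  simp_rw [pairing]
  rw [forall_sum_trace_mul_conjTranspose_eq_zero_iff]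
  simp_rw [sub_eq_zero, ← Matrix.ext_iff]
  rfl
end

section
/- Let F be ℝ or ℂ, let p, q ≥ 1, and let λ, μ ∈ F. (1) If λ ≠ μ, then for every M ∈ F^{p×q} there exists S ∈ F^{p×q} such that M + S J_q(μ) − J_p(λ) S = 0. (2) If λ = μ, then for every M ∈ F^{p×q} there exist S ∈ F^{p×q} and a matrix H ∈ F^{p×q} of form (5.1) such that M + S J_q(μ) − J_p(λ) S = H; moreover H is uniquely determined by M, i.e., if also M + S' J_q(μ) − J_p(λ) S' = H' with H' of form (5.1), then H' = H. -/
open Matrix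

/-- The `r × r` upper-triangular Jordan block `J_r(lam)` with eigenvalue `lam` on the
diagonal and `1` on the superdiagonal. -/
def jordanBlock (F : Type*) [Zero F] [One F] (r : ℕ) (lam : F) :
    Matrix (Fin r) (Fin r) F :=
  Matrix.of fun i j =>
    if (i : ℕ) = (j : ℕ) then lam else if (j : ℕ) = (i : ℕ) + 1 then 1 else 0

/-- A `p × q` matrix `H` is of form (5.1) if: in case `p ≤ q` all entries outside its
first column are zero, and in case `p > q` all entries outside its last row are zero. -/
def IsForm51 {F : Type*} [Zero F] {p q : ℕ} (H : Matrix (Fin p) (Fin q) F) : Prop :=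
  if p ≤ q then ∀ (i : Fin p) (j : Fin q), (j : ℕ) ≠ 0 → H i j = 0
  else ∀ (i : Fin p) (j : Fin q), (i : ℕ) ≠ p - 1 → H i j = 0

/-- The entries of a matrix as a function on `ℕ × ℕ`, extended by zero. -/
def Matrix.zeroExtend {F : Type*} [Zero F] {p q : ℕ} (A : Matrix (Fin p) (Fin q) F)
    (i j : ℕ) : F :=
  if h : i < p ∧ j < q then A ⟨i, h.1⟩ ⟨j, h.2⟩ else 0

namespace Matrix

variable {F : Type*} {p q : ℕ}

lemma zeroExtend_of_lt [Zero F] (A : Matrix (Fin p) (Fin q) F) {i j : ℕ} (hi : i < p)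
    (hj : j < q) : A.zeroExtend i j = A ⟨i, hi⟩ ⟨j, hj⟩ :=
  dif_pos ⟨hi, hj⟩

@[simp]
lemma zeroExtend_val [Zero F] (A : Matrix (Fin p) (Fin q) F) (i : Fin p) (j : Fin q) :
    A.zeroExtend i j = A i j :=
  A.zeroExtend_of_lt i.2 j.2

lemma zeroExtend_of_le_row [Zero F] (A : Matrix (Fin p) (Fin q) F) {i : ℕ} (j : ℕ)
    (hi : p ≤ i) : A.zeroExtend i j = 0 :=
  dif_neg fun h => absurd h.1 (not_lt.mpr hi)

lemma zeroExtend_of_le_col [Zero F] (A : Matrix (Fin p) (Fin q) F) (i : ℕ) {j : ℕ}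
    (hj : q ≤ j) : A.zeroExtend i j = 0 :=
  dif_neg fun h => absurd h.2 (not_lt.mpr hj)

lemma jordanBlock_mul_apply [NonAssocSemiring F] (lam : F) (S : Matrix (Fin p) (Fin q) F)
    (i : Fin p) (j : Fin q) :
    (jordanBlock F p lam * S) i j = lam * S i j + S.zeroExtend (i + 1) j := by
  have h : ∀ k : Fin p, jordanBlock F p lam i k * S k j =
      (if k = i then lam * S i j else 0) +
        (if (k : ℕ) = i + 1 then S.zeroExtend (i + 1) j else 0) := by
    intro k
    rcases eq_or_ne k i with rfl | hki
    · simp [jordanBlock]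
    · have hne : (i : ℕ) ≠ k := fun e => hki (Fin.ext e.symm)
      by_cases hk : (k : ℕ) = i + 1
      · rw [← hk, zeroExtend_val]
        simp [jordanBlock, hki, hk]
      · simp [jordanBlock, hki, hne, hk]
  rw [mul_apply, Finset.sum_congr rfl fun k _ => h k, Finset.sum_add_distrib]
  congr 1
  · simp
  · by_cases hi : (i : ℕ) + 1 < p
    · rw [Finset.sum_eq_single ⟨i + 1, hi⟩]
      · simp
      · exact fun k _ hk => if_neg fun e => hk (Fin.ext e)
      · simp
    · simp [S.zeroExtend_of_le_row j (not_lt.mp hi)]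

lemma mul_jordanBlock_apply [NonAssocSemiring F] (mu : F) (S : Matrix (Fin p) (Fin q) F)
    (i : Fin p) (j : Fin q) :
    (S * jordanBlock F q mu) i j =
      S i j * mu + if (j : ℕ) = 0 then 0 else S.zeroExtend i (j - 1) := by
  have h : ∀ k : Fin q, S i k * jordanBlock F q mu k j =
      (if k = j then S i j * mu else 0) +
        (if (j : ℕ) = k + 1 then S i k else 0) := by
    intro k
    rcases eq_or_ne k j with rfl | hkj
    · simp [jordanBlock]
    · have hne : (k : ℕ) ≠ j := fun e => hkj (Fin.ext e)
      simp [jordanBlock, hkj, hne]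
  rw [mul_apply, Finset.sum_congr rfl fun k _ => h k, Finset.sum_add_distrib]
  congr 1
  · simp
  · split_ifs with hj
    · simp [hj]
    · have hj' : (j : ℕ) - 1 < q := by omega
      rw [Finset.sum_eq_single ⟨j - 1, hj'⟩, zeroExtend_of_lt S i.2 hj']
      · exact if_pos (by simp only; omega)
      · exact fun k _ hk => if_neg fun e => hk (Fin.ext (by simp only; omega))
      · simp

lemma eq_zero_of_mul_jordanBlock_eq [Field F] {lam mu : F} (hne : lam ≠ mu)
    {S : Matrix (Fin p) (Fin q) F}
    (hS : S * jordanBlock F q mu - jordanBlock F p lam * S = 0) : S = 0 := by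
  have key : ∀ n i j : ℕ, p - i + j = n → S.zeroExtend i j = 0 := by
    intro n
    induction n using Nat.strong_induction_on with
    | _ n ih =>
      intro i j hn
      rcases le_or_gt p i with hi | hi
      · exact S.zeroExtend_of_le_row j hi
      rcases le_or_gt q j with hj | hj
      · exact S.zeroExtend_of_le_col i hj
      have h := congrFun₂ hS ⟨i, hi⟩ ⟨j, hj⟩
      rw [sub_apply, mul_jordanBlock_apply, jordanBlock_mul_apply, zero_apply,
        ih (p - (i + 1) + j) (by omega) (i + 1) j rfl] at h
      have h' : (if j = 0 then 0 else S.zeroExtend i (j - 1)) = 0 := by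
        split_ifs with hj0
        · rfl
        · exact ih (p - i + (j - 1)) (by omega) i (j - 1) rfl
      simp only [h'] at h
      rw [S.zeroExtend_of_lt hi hj]
      refine (mul_eq_zero.mp ?_).resolve_left (sub_ne_zero.mpr hne)
      linear_combination -h
  ext i j
  simpa using key _ i j rfl

lemma exists_add_mul_jordanBlock_eq_zero [Field F] {lam mu : F} (hne : lam ≠ mu)
    (M : Matrix (Fin p) (Fin q) F) :
    ∃ S : Matrix (Fin p) (Fin q) F,
      M + S * jordanBlock F q mu - jordanBlock F p lam * S = 0 := by
  let T : Matrix (Fin p) (Fin q) F →ₗ[F] Matrix (Fin p) (Fin q) F :=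
    { toFun := fun S => S * jordanBlock F q mu - jordanBlock F p lam * S
      map_add' := fun A B => by rw [Matrix.add_mul, Matrix.mul_add]; abel
      map_smul' := fun c A => by simp [smul_sub] }
  have hT : Function.Injective T :=
    (injective_iff_map_eq_zero T).mpr fun S hS => eq_zero_of_mul_jordanBlock_eq hne hS
  obtain ⟨S, hS⟩ := LinearMap.injective_iff_surjective.mp hT (-M)
  have hS' : S * jordanBlock F q mu - jordanBlock F p lam * S = -M := hS
  exact ⟨S, by rw [add_sub_assoc, hS', add_neg_cancel]⟩

lemma add_mul_jordanBlock_sub_apply [CommRing F] (lam : F) (M S : Matrix (Fin p) (Fin q) F)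
    (i : Fin p) (j : Fin q) :
    (M + S * jordanBlock F q lam - jordanBlock F p lam * S) i j =
      M i j + (if (j : ℕ) = 0 then 0 else S.zeroExtend i (j - 1)) -
        S.zeroExtend (i + 1) j := by
  rw [sub_apply, add_apply, mul_jordanBlock_apply, jordanBlock_mul_apply]
  ring

lemma exists_eq_zero_of_col_ne_zero [CommRing F] (lam : F) (M : Matrix (Fin p) (Fin q) F) :
    ∃ S : Matrix (Fin p) (Fin q) F, ∀ (i : Fin p) (j : Fin q), (j : ℕ) ≠ 0 →
      (M + S * jordanBlock F q lam - jordanBlock F p lam * S) i j = 0 := by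
  let s : ℕ → ℕ → F := fun i j => -∑ k ∈ Finset.range p, M.zeroExtend (i + k) (j + 1 + k)
  have hrow : ∀ i j, p ≤ i → s i j = 0 := fun i j hi =>
    neg_eq_zero.mpr <| Finset.sum_eq_zero fun k _ => M.zeroExtend_of_le_row _ (by omega)
  have hstep : ∀ i j, s i j = s (i + 1) (j + 1) - M.zeroExtend i (j + 1) := by
    intro i j
    have h1 := Finset.sum_range_succ (fun k => M.zeroExtend (i + k) (j + 1 + k)) p
    rw [Finset.sum_range_succ', M.zeroExtend_of_le_row (i := i + p) _ (by omega)] at h1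
    simp only [s, add_zero, ← add_assoc, add_right_comm _ _ 1] at h1 ⊢
    rw [← h1]
    ring
  refine ⟨of fun i j => s i j, fun i j hj => ?_⟩
  have hext : ∀ a b, b < q → (of fun (i : Fin p) (j : Fin q) => s i j).zeroExtend a b = s a b := by
    intro a b hb
    rcases le_or_gt p a with ha | ha
    · rw [zeroExtend_of_le_row _ _ ha, hrow a b ha]
    · rw [zeroExtend_of_lt _ ha hb, of_apply]
  rw [add_mul_jordanBlock_sub_apply, if_neg hj, hext _ _ (by omega), hext _ _ j.2, hstep,
    Nat.sub_add_cancel (Nat.one_le_iff_ne_zero.mpr hj), zeroExtend_val]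
  ring

/-- The partial sums of `m` along its diagonals, strictly above a given row. -/
def diagonalSum [AddMonoid F] (m : ℕ → ℕ → F) : ℕ → ℕ → F
  | 0, _ => 0
  | i + 1, 0 => m i 0
  | i + 1, j + 1 => diagonalSum m i j + m i (j + 1)

lemma exists_eq_zero_of_row_ne_last [CommRing F] (lam : F) (M : Matrix (Fin p) (Fin q) F) :
    ∃ S : Matrix (Fin p) (Fin q) F, ∀ (i : Fin p) (j : Fin q), (i : ℕ) ≠ p - 1 →
      (M + S * jordanBlock F q lam - jordanBlock F p lam * S) i j = 0 := by
  refine ⟨of fun i j => diagonalSum M.zeroExtend i j, fun i j hi => ?_⟩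
  rw [add_mul_jordanBlock_sub_apply, zeroExtend_of_lt _ (by omega : (i : ℕ) + 1 < p) j.2,
    of_apply, ← M.zeroExtend_val]
  obtain ⟨j, hj⟩ := j
  cases j with
  | zero => simp [diagonalSum]
  | succ j =>
    have hext : (of fun (i : Fin p) (j : Fin q) => diagonalSum M.zeroExtend i j).zeroExtend i j =
        diagonalSum M.zeroExtend i j :=
      zeroExtend_of_lt _ i.2 (by omega)
    simp only [Nat.succ_ne_zero, if_false, Nat.add_sub_cancel, hext, diagonalSum]
    ring

lemma eq_zero_of_isForm51 [CommRing F] {lam : F} {S H : Matrix (Fin p) (Fin q) F}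
    (hH : IsForm51 H)
    (h : S * jordanBlock F q lam - jordanBlock F p lam * S = H) : H = 0 := by
  have hentry : ∀ (i : Fin p) (j : Fin q),
      H i j = (if (j : ℕ) = 0 then 0 else S.zeroExtend i (j - 1)) -
        S.zeroExtend (i + 1) j := by
    intro i j
    rw [← h]
    simpa using add_mul_jordanBlock_sub_apply lam 0 S i j
  unfold IsForm51 at hH
  split_ifs at hH with hpq
  · have key : ∀ n i j : ℕ, p - i = n → j < i → S.zeroExtend i j = 0 := by
      intro n
      induction n with
      | zero => exact fun i j hn _ => S.zeroExtend_of_le_row j (by omega)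
      | succ n ih =>
        intro i j hn hij
        have hj : j + 1 < q := by omega
        have e := hentry ⟨i, by omega⟩ ⟨j + 1, hj⟩
        rw [hH _ _ (Nat.succ_ne_zero j), if_neg (Nat.succ_ne_zero j)] at e
        simp only [Nat.add_sub_cancel] at e
        rw [ih (i + 1) (j + 1) (by omega) (by omega), sub_zero] at e
        exact e.symm
    ext i j
    by_cases hj : (j : ℕ) = 0
    · rw [hentry, if_pos hj, key _ (i + 1) j rfl (by omega), sub_zero, zero_apply]
    · exact hH i j hj
  · have key : ∀ j i : ℕ, i < p → j < i → j < q → S.zeroExtend i j = 0 := by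
      intro j
      induction j with
      | zero =>
        intro i hip hi hq
        obtain ⟨i, rfl⟩ := Nat.exists_eq_add_one_of_ne_zero hi.ne'
        have e := hentry ⟨i, by omega⟩ ⟨0, hq⟩
        rw [hH _ _ (by simp only; omega), if_pos rfl, zero_sub] at e
        exact neg_eq_zero.mp e.symm
      | succ j ih =>
        intro i hip hi hq
        obtain ⟨i, rfl⟩ := Nat.exists_eq_add_one_of_ne_zero (by omega : i ≠ 0)
        have e := hentry ⟨i, by omega⟩ ⟨j + 1, hq⟩
        rw [hH _ _ (by simp only; omega), if_neg (Nat.succ_ne_zero j)] at e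
        simp only [Nat.add_sub_cancel] at e
        rw [ih i (by omega) (by omega) (by omega), zero_sub] at e
        exact neg_eq_zero.mp e.symm
    ext i j
    by_cases hi : (i : ℕ) = p - 1
    · rw [hentry, S.zeroExtend_of_le_row (i := i + 1) _ (by omega), sub_zero, zero_apply]
      split_ifs with hj
      · rfl
      · exact key _ _ i.2 (by omega) (by omega)
    · exact hH i j hi

end Matrix

lemma IsForm51.sub {F : Type*} [AddGroup F] {p q : ℕ} {H H' : Matrix (Fin p) (Fin q) F}
    (hH : IsForm51 H) (hH' : IsForm51 H') : IsForm51 (H - H') := by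
  unfold IsForm51 at *
  split_ifs at * with hpq
  all_goals
    intro i j hij
    rw [Matrix.sub_apply, hH i j hij, hH' i j hij, sub_zero]

/-- Lemma 5.1 of the paper, for `F = ℝ` or `F = ℂ` (case of genuine Jordan blocks):
(1) if `λ ≠ μ` then every `M` can be reduced to `0`;
(2) if `λ = μ` then every `M` can be reduced to a matrix `H` of form (5.1),
uniquely determined by `M`. -/
theorem sylvester_jordan_form51 (F : Type*) [RCLike F] (p q : ℕ)
    (hp : 1 ≤ p) (hq : 1 ≤ q) (lam mu : F) :
    (lam ≠ mu → ∀ M : Matrix (Fin p) (Fin q) F, ∃ S : Matrix (Fin p) (Fin q) F,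
        M + S * jordanBlock F q mu - jordanBlock F p lam * S = 0) ∧
    (lam = mu → ∀ M : Matrix (Fin p) (Fin q) F,
      (∃ S H : Matrix (Fin p) (Fin q) F, IsForm51 H ∧
          M + S * jordanBlock F q mu - jordanBlock F p lam * S = H) ∧
      (∀ S H S' H' : Matrix (Fin p) (Fin q) F, IsForm51 H → IsForm51 H' →
          M + S * jordanBlock F q mu - jordanBlock F p lam * S = H →
          M + S' * jordanBlock F q mu - jordanBlock F p lam * S' = H' → H = H')) := by
  refine ⟨fun hne M => Matrix.exists_add_mul_jordanBlock_eq_zero hne M, ?_⟩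
  rintro rfl M
  refine ⟨?_, ?_⟩
  · by_cases hpq : p ≤ q
    · obtain ⟨S, hS⟩ := Matrix.exists_eq_zero_of_col_ne_zero lam M
      exact ⟨S, _, by rwa [IsForm51, if_pos hpq], rfl⟩
    · obtain ⟨S, hS⟩ := Matrix.exists_eq_zero_of_row_ne_last lam M
      exact ⟨S, _, by rwa [IsForm51, if_neg hpq], rfl⟩
  · intro S H S' H' hH hH' h h'
    refine sub_eq_zero.mp
      (Matrix.eq_zero_of_isForm51 (lam := lam) (S := S - S') (hH.sub hH') ?_)
    rw [← h, ← h', Matrix.sub_mul, Matrix.mul_sub]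
    abel
end

section
/- Let λ_1,…,λ_s be distinct complex numbers and, for each i, let s_{i1} ≥ s_{i2} ≥ … ≥ s_{i t_i} ≥ 1 be integers. Let A ∈ ℂ^{m×m} be the block-diagonal matrix with diagonal blocks J_{s_{ij}}(λ_i), listed grouped by i. Let 𝒫 ⊆ ℂ^{m×m} be the subspace of all matrices supported on the following set of positions: for each i and each ordered pair (j,k) with 1 ≤ j,k ≤ t_i, inside the s_{ij}×s_{ik} sub-block lying in the rows of the diagonal block J_{s_{ij}}(λ_i) and the columns of the diagonal block J_{s_{ik}}(λ_i), take the positions of the first column of that sub-block if s_{ij} ≤ s_{ik}, and the positions of its last row if s_{ij} > s_{ik}; no positions are taken in sub-blocks whose row-block and column-block correspond to different eigenvalues λ_i ≠ λ_{i'}. Then ℂ^{m×m} is the internal direct sum of 𝒫 and the subspace {XA − AX : X ∈ ℂ^{m×m}}. -/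
open Matrix

namespace ArnoldComplex

/-- Entry `(a, b)` (0-indexed) of a Jordan block with eigenvalue `lam`. -/
def jordanEntry (lam : ℂ) (a b : ℕ) : ℂ :=
  if a = b then lam else if b = a + 1 then 1 else 0

variable (s : ℕ) (lam : Fin s → ℂ) (t : Fin s → ℕ) (sz : ∀ i : Fin s, Fin (t i) → ℕ)

/-- Index set of the Jordan matrix `A = ⊕_i ⊕_j J_{sz i j}(lam i)`:
eigenvalue index `i`, Jordan block index `j`, position inside the block. -/
abbrev Idx := Σ i : Fin s, Σ j : Fin (t i), Fin (sz i j)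

/-- The Jordan canonical matrix `⊕_i diag(J_{s_{i1}}(λ_i), J_{s_{i2}}(λ_i), …)`. -/
def JordanMat : Matrix (Idx s t sz) (Idx s t sz) ℂ :=
  Matrix.of fun x y =>
    if x.1 = y.1 ∧ (x.2.1 : ℕ) = (y.2.1 : ℕ) then jordanEntry (lam x.1) x.2.2 y.2.2 else 0

/-- The support of Arnold's simplest miniversal deformation: inside the sub-block of the
ordered pair `(j, k)` of Jordan blocks with the same eigenvalue, the first column if
`sz j ≤ sz k`, and the last row if `sz j > sz k`; nothing for different eigenvalues. -/
def Supp (x y : Idx s t sz) : Prop :=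
  x.1 = y.1 ∧
    ((sz x.1 x.2.1 ≤ sz y.1 y.2.1 ∧ (y.2.2 : ℕ) = 0) ∨
     (sz y.1 y.2.1 < sz x.1 x.2.1 ∧ (x.2.2 : ℕ) = sz x.1 x.2.1 - 1))

/-- The entries of `Y * J(μ) - J(λ) * Y` with `c = μ - λ`, where `Y` has `p` rows. -/
def blockComm (p : ℕ) (c : ℂ) (Y : ℕ → ℕ → ℂ) (a b : ℕ) : ℂ :=
  c * Y a b + (if b = 0 then 0 else Y a (b - 1)) - (if a + 1 < p then Y (a + 1) b else 0)

/-- Solution of the Sylvester recursion for distinct eigenvalues, rows counted from the bottom. -/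
noncomputable def sylvesterSol (c : ℂ) (N : ℕ → ℕ → ℂ) : ℕ → ℕ → ℂ
  | 0, 0 => N 0 0 / c
  | 0, b + 1 => (N 0 (b + 1) - sylvesterSol c N 0 b) / c
  | r + 1, 0 => (N (r + 1) 0 + sylvesterSol c N r 0) / c
  | r + 1, b + 1 =>
    (N (r + 1) (b + 1) - sylvesterSol c N (r + 1) b + sylvesterSol c N r (b + 1)) / c

/-- Solution of the recursion along diagonals, starting from a zero top row. -/
def diagonalSol (M : ℕ → ℕ → ℂ) : ℕ → ℕ → ℂ
  | 0, _ => 0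
  | a + 1, 0 => -M a 0
  | a + 1, b + 1 => diagonalSol M a b - M a (b + 1)

lemma exists_blockComm_eq_of_ne_zero (p : ℕ) {c : ℂ} (hc : c ≠ 0) (M : ℕ → ℕ → ℂ) :
    ∃ Y, ∀ a < p, ∀ b, blockComm p c Y a b = M a b := by
  refine ⟨fun a b => sylvesterSol c (fun r b => M (p - 1 - r) b) (p - 1 - a) b, ?_⟩
  intro a ha b
  obtain ⟨r, hr⟩ : ∃ r, r = p - 1 - a := ⟨_, rfl⟩
  have har : a = p - 1 - r := by omega
  simp only [blockComm, ← hr]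
  rcases r with _ | r
  · have h : ¬ a + 1 < p := by omega
    rcases b with _ | b
    · simp only [h, sylvesterSol, ← har, if_true, if_false]
      field_simp
      ring
    · simp only [h, sylvesterSol, ← har, Nat.add_sub_cancel, Nat.succ_ne_zero, if_false]
      field_simp
      ring
  · have h : a + 1 < p := by omega
    have h' : p - 1 - (a + 1) = r := by omega
    rcases b with _ | b
    · simp only [h, h', sylvesterSol, ← har, if_true]
      field_simp
      ring
    · simp only [h, h', sylvesterSol, ← har, if_true, Nat.add_sub_cancel, Nat.succ_ne_zero,
        if_false]
      field_simp
      ring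

lemma exists_blockComm_zero_eq_off_first_column (p : ℕ) (M : ℕ → ℕ → ℂ) :
    ∃ Y, ∀ a < p, ∀ b, b ≠ 0 → blockComm p 0 Y a b = M a b := by
  refine ⟨fun a b => ∑ k ∈ Finset.range (p - a), M (a + k) (b + 1 + k), ?_⟩
  intro a ha b hb
  obtain ⟨b, rfl⟩ := Nat.exists_eq_succ_of_ne_zero hb
  obtain ⟨d, rfl⟩ : ∃ d, p = a + 1 + d := ⟨p - (a + 1), by omega⟩
  have h1 : a + 1 + d - a = d + 1 := by omega
  have h2 : a + 1 + d - (a + 1) = d := by omega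
  have h3 : (if a + 1 < a + 1 + d then
      ∑ k ∈ Finset.range d, M (a + 1 + k) (b + 1 + 1 + k) else 0) =
      ∑ k ∈ Finset.range d, M (a + (k + 1)) (b + 1 + (k + 1)) := by
    rcases d with _ | d
    · simp
    · rw [if_pos (by omega)]
      refine Finset.sum_congr rfl fun k _ => ?_
      congr 1 <;> omega
  simp only [blockComm, Nat.succ_eq_add_one, h1, h2, h3, Nat.add_sub_cancel]
  rw [zero_mul, zero_add, if_neg (Nat.succ_ne_zero b), Finset.sum_range_succ', add_sub_cancel_left,
    add_zero, add_zero]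

lemma exists_blockComm_zero_eq_off_last_row (p : ℕ) (M : ℕ → ℕ → ℂ) :
    ∃ Y, ∀ a, a + 1 < p → ∀ b, blockComm p 0 Y a b = M a b := by
  refine ⟨diagonalSol M, ?_⟩
  intro a ha b
  rcases b with _ | b <;> simp [blockComm, ha, diagonalSol]

lemma exists_blockComm_eq_off_support (p q : ℕ) (c : ℂ) (M : ℕ → ℕ → ℂ) :
    ∃ Y, ∀ a < p, ∀ b, ¬ (c = 0 ∧ (p ≤ q ∧ b = 0 ∨ q < p ∧ a = p - 1)) →
      blockComm p c Y a b = M a b := by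
  by_cases hc : c = 0
  · subst hc
    rcases le_or_gt p q with h | h
    · obtain ⟨Y, hY⟩ := exists_blockComm_zero_eq_off_first_column p M
      exact ⟨Y, fun a ha b hb => hY a ha b (by tauto)⟩
    · obtain ⟨Y, hY⟩ := exists_blockComm_zero_eq_off_last_row p M
      refine ⟨Y, fun a ha b hb => hY a ?_ b⟩
      have : a ≠ p - 1 := by tauto
      omega
  · obtain ⟨Y, hY⟩ := exists_blockComm_eq_of_ne_zero p hc M
    exact ⟨Y, fun a ha b _ => hY a ha b⟩

lemma sum_diagonal_blockComm_zero (p : ℕ) (Y : ℕ → ℕ → ℂ) (a n : ℕ) (hn : a + n ≤ p) :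
    ∑ k ∈ Finset.range n, blockComm p 0 Y (a + k) k =
      -(if n = 0 then 0 else if a + n < p then Y (a + n) (n - 1) else 0) := by
  induction n with
  | zero => simp
  | succ n ih =>
    rw [Finset.sum_range_succ, ih (by omega)]
    have h : a + n < p := by omega
    rcases n with _ | n 
    · simp [blockComm]
    · simp [blockComm, h, add_assoc]
      ring

lemma eq_zero_of_add_blockComm_zero {p q : ℕ} {P Y : ℕ → ℕ → ℂ}
    (hP : ∀ a < p, ∀ b < q, ¬ (p ≤ q ∧ b = 0 ∨ q < p ∧ a = p - 1) → P a b = 0)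
    (h : ∀ a < p, ∀ b < q, P a b + blockComm p 0 Y a b = 0) :
    ∀ a < p, ∀ b < q, P a b = 0 := by
  have key : ∀ a n, a + n = p → n ≤ q → ∑ k ∈ Finset.range n, P (a + k) k = 0 := by
    intro a n han hnq
    have h1 := sum_diagonal_blockComm_zero p Y a n han.le
    have h2 : ∑ k ∈ Finset.range n, (P (a + k) k + blockComm p 0 Y (a + k) k) = 0 := by
      refine Finset.sum_eq_zero fun k hk => ?_
      rw [Finset.mem_range] at hk
      exact h _ (by omega) _ (by omega)
    rw [Finset.sum_add_distrib, h1] at h2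
    simpa [han] using h2
  intro a ha b hb
  by_cases hs : p ≤ q ∧ b = 0 ∨ q < p ∧ a = p - 1
  · rcases hs with ⟨hpq, rfl⟩ | ⟨hqp, rfl⟩
    · have := key a (p - a) (by omega) (by omega)
      rw [Finset.sum_eq_single 0] at this
      · simpa using this
      · intro k hk hk0
        rw [Finset.mem_range] at hk
        exact hP _ (by omega) _ (by omega) (by omega)
      · intro h0
        rw [Finset.mem_range] at h0
        omega
    · have := key (p - 1 - b) (b + 1) (by omega) (by omega)
      rw [Finset.sum_eq_single b] at this
      · rwa [show p - 1 - b + b = p - 1 by omega] at this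
      · intro k hk hkb
        rw [Finset.mem_range] at hk
        exact hP _ (by omega) _ (by omega) (by omega)
      · intro h0
        simp at h0
  · exact hP a ha b hb hs

lemma sum_mul_jordanEntry (q : ℕ) (mu : ℂ) (g : ℕ → ℂ) {b : ℕ} (hb : b < q) :
    ∑ c : Fin q, g c * jordanEntry mu c b = mu * g b + if b = 0 then 0 else g (b - 1) := by
  rw [Fin.sum_univ_eq_sum_range (fun c => g c * jordanEntry mu c b)]
  have h : ∀ c ∈ Finset.range q, g c * jordanEntry mu c b =
      (if c = b then mu * g b else 0) +
        if c = b - 1 then (if b = 0 then 0 else g (b - 1)) else 0 := by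
    intro c _
    unfold jordanEntry
    grind
  rw [Finset.sum_congr rfl h, Finset.sum_add_distrib, Finset.sum_ite_eq', Finset.sum_ite_eq',
    if_pos (Finset.mem_range.2 hb), if_pos (Finset.mem_range.2 (by omega))]

lemma sum_jordanEntry_mul (p : ℕ) (mu : ℂ) (g : ℕ → ℂ) {a : ℕ} (ha : a < p) :
    ∑ c : Fin p, jordanEntry mu a c * g c = mu * g a + if a + 1 < p then g (a + 1) else 0 := by
  rw [Fin.sum_univ_eq_sum_range (fun c => jordanEntry mu a c * g c)]
  have h : ∀ c ∈ Finset.range p, jordanEntry mu a c * g c =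
      (if c = a then mu * g a else 0) + if c = a + 1 then g (a + 1) else 0 := by
    intro c _
    unfold jordanEntry
    grind
  rw [Finset.sum_congr rfl h, Finset.sum_add_distrib, Finset.sum_ite_eq', Finset.sum_ite_eq',
    if_pos (Finset.mem_range.2 ha)]
  simp only [Finset.mem_range]

/-- The sub-block of `X` in given block row and block column, extended by zero. -/
def subBlock (X : Matrix (Idx s t sz) (Idx s t sz) ℂ) (i : Fin s) (j : Fin (t i)) (i' : Fin s)
    (k : Fin (t i')) (a b : ℕ) : ℂ :=
  if h : a < sz i j ∧ b < sz i' k then X ⟨i, j, ⟨a, h.1⟩⟩ ⟨i', k, ⟨b, h.2⟩⟩ else 0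

lemma subBlock_coe (X : Matrix (Idx s t sz) (Idx s t sz) ℂ) (i : Fin s) (j : Fin (t i))
    (i' : Fin s) (k : Fin (t i')) (a : Fin (sz i j)) (b : Fin (sz i' k)) :
    subBlock s t sz X i j i' k a b = X ⟨i, j, a⟩ ⟨i', k, b⟩ := by
  simp [subBlock]

lemma commutator_apply (X : Matrix (Idx s t sz) (Idx s t sz) ℂ)
    (Y : ∀ i : Fin s, Fin (t i) → ∀ i' : Fin s, Fin (t i') → ℕ → ℕ → ℂ)
    (hXY : ∀ i j i' k (a : Fin (sz i j)) (b : Fin (sz i' k)),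
      X ⟨i, j, a⟩ ⟨i', k, b⟩ = Y i j i' k a b)
    (i : Fin s) (j : Fin (t i)) (i' : Fin s) (k : Fin (t i')) (a : Fin (sz i j))
    (b : Fin (sz i' k)) :
    (X * JordanMat s lam t sz - JordanMat s lam t sz * X) ⟨i, j, a⟩ ⟨i', k, b⟩ =
      blockComm (sz i j) (lam i' - lam i) (Y i j i' k) a b := by
  have h1 : (X * JordanMat s lam t sz) ⟨i, j, a⟩ ⟨i', k, b⟩ =
      ∑ c : Fin (sz i' k), Y i j i' k a c * jordanEntry (lam i') c b := by
    rw [Matrix.mul_apply, Fintype.sum_sigma, Fintype.sum_eq_single i', Fintype.sum_sigma,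
      Fintype.sum_eq_single k]
    · simp [JordanMat, hXY]
    · intro l hl
      simp [JordanMat, Fin.val_inj, hl]
    · intro l hl
      simp [JordanMat, hl]
  have h2 : (JordanMat s lam t sz * X) ⟨i, j, a⟩ ⟨i', k, b⟩ =
      ∑ c : Fin (sz i j), jordanEntry (lam i) a c * Y i j i' k c b := by
    rw [Matrix.mul_apply, Fintype.sum_sigma, Fintype.sum_eq_single i, Fintype.sum_sigma,
      Fintype.sum_eq_single j]
    · simp [JordanMat, hXY]
    · intro l hl
      simp [JordanMat, Fin.val_inj, hl.symm]
    · intro l hl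
      simp [JordanMat, hl.symm]
  rw [Matrix.sub_apply, h1, h2, sum_mul_jordanEntry _ _ (Y i j i' k a) b.2,
    sum_jordanEntry_mul _ _ (fun c => Y i j i' k c b) a.2, blockComm]
  ring

/-- Arnold's theorem (Theorem 5.1 of the paper for `F = ℂ`): `ℂ^{m×m}` is the internal
direct sum of the subspace `𝒫` of matrices supported on `Supp` and the subspace
`{XA − AX}`, i.e. every matrix decomposes, uniquely, as a sum of the two. -/
theorem simplest_miniversal_jordan_complex
    (hinj : Function.Injective lam)
    (hsz : ∀ (i : Fin s) (j : Fin (t i)), 1 ≤ sz i j)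
    (hmono : ∀ (i : Fin s) (j k : Fin (t i)), j ≤ k → sz i k ≤ sz i j) :
    (∀ M : Matrix (Idx s t sz) (Idx s t sz) ℂ,
      ∃ P X : Matrix (Idx s t sz) (Idx s t sz) ℂ,
        (∀ x y, ¬ Supp s t sz x y → P x y = 0) ∧
        M = P + (X * JordanMat s lam t sz - JordanMat s lam t sz * X)) ∧
    (∀ P X : Matrix (Idx s t sz) (Idx s t sz) ℂ,
      (∀ x y, ¬ Supp s t sz x y → P x y = 0) →
      P + (X * JordanMat s lam t sz - JordanMat s lam t sz * X) = 0 →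
      P = 0 ∧ X * JordanMat s lam t sz - JordanMat s lam t sz * X = 0) := by
  constructor
  · intro M
    choose Y hY using fun (i : Fin s) (j : Fin (t i)) (i' : Fin s) (k : Fin (t i')) =>
      exists_blockComm_eq_off_support (sz i j) (sz i' k) (lam i' - lam i)
        (subBlock s t sz M i j i' k)
    let X : Matrix (Idx s t sz) (Idx s t sz) ℂ :=
      Matrix.of fun x y => Y x.1 x.2.1 y.1 y.2.1 x.2.2 y.2.2
    refine ⟨M - (X * JordanMat s lam t sz - JordanMat s lam t sz * X), X, ?_, by abel⟩
    rintro ⟨i, j, a⟩ ⟨i', k, b⟩ hxy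
    rw [Matrix.sub_apply, commutator_apply s lam t sz X Y (fun _ _ _ _ _ _ => rfl),
      hY i j i' k a a.2 b, subBlock_coe, sub_self]
    rintro ⟨hlam, hpos⟩
    exact hxy ⟨(hinj (sub_eq_zero.1 hlam)).symm, hpos⟩
  · intro P X hP h
    have hP0 : P = 0 := by
      refine Matrix.ext ?_
      rintro ⟨i, j, a⟩ ⟨i', k, b⟩
      by_cases hi : i = i'
      · subst hi
        rw [← subBlock_coe s t sz P i j i k, Matrix.zero_apply]
        refine eq_zero_of_add_blockComm_zero (p := sz i j) (q := sz i k)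
          (Y := subBlock s t sz X i j i k) ?_ ?_ a a.2 b b.2
        · intro a ha b hb hab
          rw [subBlock_coe s t sz P i j i k ⟨a, ha⟩ ⟨b, hb⟩]
          exact hP _ _ fun hs => hab hs.2
        · intro a ha b hb
          have hab := congrFun (congrFun h ⟨i, j, ⟨a, ha⟩⟩) ⟨i, k, ⟨b, hb⟩⟩
          rw [Matrix.add_apply, commutator_apply s lam t sz X (subBlock s t sz X)
            (fun _ _ _ _ _ _ => (subBlock_coe ..).symm), sub_self] at hab
          rw [subBlock_coe s t sz P i j i k ⟨a, ha⟩ ⟨b, hb⟩]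
          exact hab
      · exact hP _ _ fun hs => hi hs.1
    refine ⟨hP0, ?_⟩
    rwa [hP0, zero_add] at h

end ArnoldComplex
end

section
/- Let λ_1,…,λ_s be distinct complex numbers with Im λ_i ≥ 0 and, for each i, let s_{i1} ≥ s_{i2} ≥ … ≥ s_{i t_i} ≥ 1 be integers, each s_{ij} even whenever Im λ_i > 0. Let A ∈ ℝ^{m×m} be the block-diagonal matrix with diagonal blocks J^ℝ_{s_{ij}}(λ_i), listed grouped by i. Let 𝒫 ⊆ ℝ^{m×m} be the subspace of all matrices supported on the following set of positions: for each i and each ordered pair (j,k) with 1 ≤ j,k ≤ t_i, inside the s_{ij}×s_{ik} sub-block lying in the rows of the diagonal block J^ℝ_{s_{ij}}(λ_i) and the columns of the diagonal block J^ℝ_{s_{ik}}(λ_i), take the positions of the first column of that sub-block if s_{ij} ≤ s_{ik}, and the positions of its last row if s_{ij} > s_{ik}; no positions are taken in sub-blocks whose row-block and column-block correspond to different λ_i. Then ℝ^{m×m} is the internal direct sum of 𝒫 and the subspace {XA − AX : X ∈ ℝ^{m×m}}. -/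
open Matrix

namespace ArnoldReal

/-- Entry `(a, b)` (0-indexed) of the real Jordan block `J^ℝ_r(lam)`: for real `lam`
the usual Jordan block; for `lam = x + y i` with `y ≠ 0` the block-tridiagonal matrix
with `2×2` diagonal blocks `T_{xy} = [[x, y], [−y, x]]` and `I_2` blocks on the block
superdiagonal. -/
noncomputable def realJordanEntry (lam : ℂ) (a b : ℕ) : ℝ :=
  if lam.im = 0 then
    (if a = b then lam.re else if b = a + 1 then 1 else 0)
  else if a / 2 = b / 2 then
    (if a % 2 = b % 2 then lam.re else if a % 2 = 0 then lam.im else -lam.im)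
  else if b / 2 = a / 2 + 1 ∧ a % 2 = b % 2 then 1 else 0

variable (s : ℕ) (lam : Fin s → ℂ) (t : Fin s → ℕ) (sz : ∀ i : Fin s, Fin (t i) → ℕ)

/-- Index set of the real Jordan matrix `A = ⊕_i ⊕_j J^ℝ_{sz i j}(lam i)`. -/
abbrev Idx := Σ i : Fin s, Σ j : Fin (t i), Fin (sz i j)

/-- The real canonical matrix `⊕_i diag(J^ℝ_{s_{i1}}(λ_i), J^ℝ_{s_{i2}}(λ_i), …)`. -/
noncomputable def RealJordanMat : Matrix (Idx s t sz) (Idx s t sz) ℝ :=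
  Matrix.of fun x y =>
    if x.1 = y.1 ∧ (x.2.1 : ℕ) = (y.2.1 : ℕ) then realJordanEntry (lam x.1) x.2.2 y.2.2 else 0

/-- The support: inside the sub-block of an ordered pair `(j, k)` of real Jordan blocks
with the same `λ_i`, the first column if `sz j ≤ sz k`, the last row if `sz j > sz k`. -/
def Supp (x y : Idx s t sz) : Prop :=
  x.1 = y.1 ∧
    ((sz x.1 x.2.1 ≤ sz y.1 y.2.1 ∧ (y.2.2 : ℕ) = 0) ∨
     (sz y.1 y.2.1 < sz x.1 x.2.1 ∧ (x.2.2 : ℕ) = sz x.1 x.2.1 - 1))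

theorem realJordanEntry_of_im_eq_zero {lam : ℂ} (h : lam.im = 0) (a b : ℕ) :
    realJordanEntry lam a b =
      (if a = b then lam.re else 0) + (if b = a + 1 then 1 else 0) := by
  unfold realJordanEntry
  grind

theorem realJordanEntry_even_even {lam : ℂ} (h : lam.im ≠ 0) (a b : ℕ) :
    realJordanEntry lam (2 * a) (2 * b) =
      (if a = b then lam.re else 0) + (if b = a + 1 then 1 else 0) := by
  unfold realJordanEntry
  grind

theorem realJordanEntry_odd_odd {lam : ℂ} (h : lam.im ≠ 0) (a b : ℕ) :
    realJordanEntry lam (2 * a + 1) (2 * b + 1) =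
      (if a = b then lam.re else 0) + (if b = a + 1 then 1 else 0) := by
  unfold realJordanEntry
  grind

theorem realJordanEntry_even_odd {lam : ℂ} (h : lam.im ≠ 0) (a b : ℕ) :
    realJordanEntry lam (2 * a) (2 * b + 1) = if a = b then lam.im else 0 := by
  unfold realJordanEntry
  grind

theorem realJordanEntry_odd_even {lam : ℂ} (h : lam.im ≠ 0) (a b : ℕ) :
    realJordanEntry lam (2 * a + 1) (2 * b) = if a = b then -lam.im else 0 := by
  unfold realJordanEntry
  grind

theorem sum_range_two_mul (n : ℕ) (f : ℕ → ℝ) :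
    ∑ c ∈ Finset.range (2 * n), f c = ∑ k ∈ Finset.range n, (f (2 * k) + f (2 * k + 1)) := by
  induction n with
  | zero => simp
  | succ n ih =>
    rw [Finset.sum_range_succ, ← ih, mul_add, mul_one, Finset.sum_range_succ,
      Finset.sum_range_succ, add_assoc]

theorem sum_range_ite_eq_add_one (n a : ℕ) (f : ℕ → ℝ) (ha : a < n) :
    ∑ c ∈ Finset.range n, (if a = c + 1 then f c else 0) = if 1 ≤ a then f (a - 1) else 0 := by
  cases a with
  | zero => simp
  | succ a => simp [Finset.sum_ite_eq, Nat.lt_of_succ_lt ha]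

/-- The row `b` of a real Jordan block with real eigenvalue, applied to a vector. -/
theorem sum_realJordanEntry_row {lam : ℂ} (h : lam.im = 0) {n b : ℕ} (hb : b < n) (f : ℕ → ℝ) :
    ∑ c ∈ Finset.range n, realJordanEntry lam b c * f c =
      lam.re * f b + if b + 1 < n then f (b + 1) else 0 := by
  simp [realJordanEntry_of_im_eq_zero h, add_mul, Finset.sum_add_distrib, ite_mul, hb]

theorem sum_realJordanEntry_col {lam : ℂ} (h : lam.im = 0) {n a : ℕ} (ha : a < n) (f : ℕ → ℝ) :
    ∑ c ∈ Finset.range n, realJordanEntry lam c a * f c =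
      lam.re * f a + if 1 ≤ a then f (a - 1) else 0 := by
  simp [realJordanEntry_of_im_eq_zero h, add_mul, Finset.sum_add_distrib, ite_mul, ha,
    sum_range_ite_eq_add_one _ _ _ ha]

theorem sum_realJordanEntry_row_even {lam : ℂ} (h : lam.im ≠ 0) {n b : ℕ} (hb : b < n)
    (f : ℕ → ℝ) :
    ∑ c ∈ Finset.range (2 * n), realJordanEntry lam (2 * b) c * f c =
      lam.re * f (2 * b) + lam.im * f (2 * b + 1) +
        if b + 1 < n then f (2 * (b + 1)) else 0 := by
  simp [sum_range_two_mul, realJordanEntry_even_even h, realJordanEntry_even_odd h, add_mul,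
    Finset.sum_add_distrib, ite_mul, hb]
  ring

theorem sum_realJordanEntry_row_odd {lam : ℂ} (h : lam.im ≠ 0) {n b : ℕ} (hb : b < n)
    (f : ℕ → ℝ) :
    ∑ c ∈ Finset.range (2 * n), realJordanEntry lam (2 * b + 1) c * f c =
      lam.re * f (2 * b + 1) - lam.im * f (2 * b) +
        if b + 1 < n then f (2 * (b + 1) + 1) else 0 := by
  simp [sum_range_two_mul, realJordanEntry_odd_even h, realJordanEntry_odd_odd h, add_mul,
    Finset.sum_add_distrib, ite_mul, hb]
  ring

theorem sum_realJordanEntry_col_even {lam : ℂ} (h : lam.im ≠ 0) {n a : ℕ} (ha : a < n)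
    (f : ℕ → ℝ) :
    ∑ c ∈ Finset.range (2 * n), realJordanEntry lam c (2 * a) * f c =
      lam.re * f (2 * a) - lam.im * f (2 * a + 1) +
        if 1 ≤ a then f (2 * (a - 1)) else 0 := by
  simp [sum_range_two_mul, realJordanEntry_even_even h, realJordanEntry_odd_even h, add_mul,
    Finset.sum_add_distrib, ite_mul, ha, sum_range_ite_eq_add_one _ _ (fun k => f (2 * k)) ha]
  ring

theorem sum_realJordanEntry_col_odd {lam : ℂ} (h : lam.im ≠ 0) {n a : ℕ} (ha : a < n)
    (f : ℕ → ℝ) :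
    ∑ c ∈ Finset.range (2 * n), realJordanEntry lam c (2 * a + 1) * f c =
      lam.re * f (2 * a + 1) + lam.im * f (2 * a) +
        if 1 ≤ a then f (2 * (a - 1) + 1) else 0 := by
  simp [sum_range_two_mul, realJordanEntry_odd_odd h, realJordanEntry_even_odd h, add_mul,
    Finset.sum_add_distrib, ite_mul, ha,
    sum_range_ite_eq_add_one _ _ (fun k => f (2 * k + 1)) ha]
  ring

/-- `w` intertwines the transposes of the complex Jordan blocks `J_q(μ)` and `J_p(lam)`. -/
def ComplexIntertwines (p q : ℕ) (lam mu : ℂ) (w : ℕ → ℕ → ℂ) : Prop :=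
  ∀ a < p, ∀ b < q,
    mu * w a b + (if b + 1 < q then w a (b + 1) else 0) =
      lam * w a b + (if 1 ≤ a then w (a - 1) b else 0)

namespace ComplexIntertwines

variable {p q : ℕ} {lam mu : ℂ} {w : ℕ → ℕ → ℂ}

theorem eq_zero_of_ne (hw : ComplexIntertwines p q lam mu w) (hne : lam ≠ mu) :
    ∀ a < p, ∀ b < q, w a b = 0 := by
  have key : ∀ n a b, a < p → b < q → a + (q - b) = n → w a b = 0 := by
    intro n
    induction n using Nat.strong_induction_on with
    | _ n ih =>
      intro a b ha hb hn
      have h := hw a ha b hb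
      have h1 : (if b + 1 < q then w a (b + 1) else 0) = 0 := by
        split_ifs with hc
        · exact ih (a + (q - (b + 1))) (by omega) a (b + 1) ha hc rfl
        · rfl
      have h2 : (if 1 ≤ a then w (a - 1) b else 0) = 0 := by
        split_ifs with hc
        · exact ih (a - 1 + (q - b)) (by omega) (a - 1) b (by omega) hb rfl
        · rfl
      rw [h1, h2, add_zero, add_zero] at h
      exact (mul_eq_mul_right_iff.1 h).resolve_left (Ne.symm hne)
  exact fun a ha b hb => key _ a b ha hb rfl

theorem shift (hw : ComplexIntertwines p q lam lam w) {a b : ℕ} (ha : a < p) (hb : b < q) :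
    (if b + 1 < q then w a (b + 1) else 0) = if 1 ≤ a then w (a - 1) b else 0 :=
  add_left_cancel (hw a ha b hb)

theorem eq_zero_of_first_col (hw : ComplexIntertwines p q lam lam w)
    (h0 : ∀ a < p, w a 0 = 0) : ∀ a < p, ∀ b < q, w a b = 0 := by
  intro a ha b
  induction b generalizing a with
  | zero => exact fun _ => h0 a ha
  | succ b ih =>
    intro hb
    have h := hw.shift ha (Nat.lt_of_succ_lt hb)
    rw [if_pos hb] at h
    rw [h]
    split_ifs
    · exact ih (a - 1) (by omega) (by omega)
    · rfl

theorem eq_zero_of_last_row (hw : ComplexIntertwines p q lam lam w)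
    (h0 : ∀ b < q, w (p - 1) b = 0) : ∀ a < p, ∀ b < q, w a b = 0 := by
  have key : ∀ n a b, a < p → b < q → p - 1 - a = n → w a b = 0 := by
    intro n
    induction n with
    | zero =>
      intro a b ha hb hn
      rw [show a = p - 1 by omega]
      exact h0 b hb
    | succ n ih =>
      intro a b ha hb hn
      have h := hw.shift (a := a + 1) (by omega) hb
      rw [if_pos (Nat.le_add_left 1 a), Nat.add_sub_cancel] at h
      rw [← h]
      split_ifs with hc
      · exact ih (a + 1) (b + 1) (by omega) hc (by omega)
      · rfl
  exact fun a ha b hb => key _ a b ha hb rfl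

theorem exists_first_col (hpq : p ≤ q) (c : ℕ → ℂ) :
    ∃ w, ComplexIntertwines p q lam lam w ∧ ∀ a < p, w a 0 = c a := by
  refine ⟨fun a b => if b ≤ a then c (a - b) else 0, fun a ha b hb => ?_, fun a _ => by simp⟩
  congr 1
  grind

theorem exists_last_row (hpq : q ≤ p) (c : ℕ → ℂ) :
    ∃ w, ComplexIntertwines p q lam lam w ∧ ∀ b < q, w (p - 1) b = c b := by
  refine ⟨fun a b => if b + (p - 1 - a) < q then c (b + (p - 1 - a)) else 0,
    fun a ha b hb => ?_, fun b hb => by simp [hb]⟩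
  congr 1
  grind

end ComplexIntertwines

/-- `y` intertwines the transposes of the real Jordan blocks `J^ℝ_q(mu)` and `J^ℝ_p(lam)`. -/
def RealIntertwines (p q : ℕ) (lam mu : ℂ) (y : ℕ → ℕ → ℝ) : Prop :=
  ∀ a < p, ∀ b < q,
    ∑ c ∈ Finset.range q, realJordanEntry mu b c * y a c =
      ∑ c ∈ Finset.range p, realJordanEntry lam c a * y c b

theorem realIntertwines_iff_of_im_eq_zero {p q : ℕ} {lam mu : ℂ} {y : ℕ → ℕ → ℝ}
    (hlam : lam.im = 0) (hmu : mu.im = 0) :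
    RealIntertwines p q lam mu y ↔ ComplexIntertwines p q lam mu fun a b => (y a b : ℂ) := by
  refine forall₂_congr fun a ha => forall₂_congr fun b hb => ?_
  rw [sum_realJordanEntry_row hmu hb, sum_realJordanEntry_col hlam ha fun c => y c b,
    Complex.ext_iff]
  split_ifs <;> simp [hlam, hmu]

namespace RealIntertwines

variable {p q m n : ℕ} {lam mu : ℂ} {y : ℕ → ℕ → ℝ}

theorem complexify_right (h : RealIntertwines p (2 * n) lam mu y)
    (hlam : lam.im = 0) (hmu : mu.im ≠ 0) :
    ComplexIntertwines p n lam mu fun a b => ⟨y a (2 * b), -y a (2 * b + 1)⟩ := by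
  intro a ha b hb
  have h0 := h a ha (2 * b) (by omega)
  have h1 := h a ha (2 * b + 1) (by omega)
  rw [sum_realJordanEntry_row_even hmu hb, sum_realJordanEntry_col hlam ha fun c => y c _] at h0
  rw [sum_realJordanEntry_row_odd hmu hb, sum_realJordanEntry_col hlam ha fun c => y c _] at h1
  rw [Complex.ext_iff]
  split_ifs at h0 h1 ⊢ <;> simp [hlam] <;> constructor <;> linarith

theorem complexify_left (h : RealIntertwines (2 * m) q lam mu y)
    (hlam : lam.im ≠ 0) (hmu : mu.im = 0) :
    ComplexIntertwines m q lam mu fun a b => ⟨y (2 * a) b, y (2 * a + 1) b⟩ := by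
  intro a ha b hb
  have h0 := h (2 * a) (by omega) b hb
  have h1 := h (2 * a + 1) (by omega) b hb
  rw [sum_realJordanEntry_row hmu hb, sum_realJordanEntry_col_even hlam ha fun c => y c _] at h0
  rw [sum_realJordanEntry_row hmu hb, sum_realJordanEntry_col_odd hlam ha fun c => y c _] at h1
  rw [Complex.ext_iff]
  split_ifs at h0 h1 ⊢ <;> simp [hmu] <;> constructor <;> linarith

end RealIntertwines

theorem realIntertwines_two_mul_iff {m n : ℕ} {lam mu : ℂ} {y : ℕ → ℕ → ℝ}
    (hlam : lam.im ≠ 0) (hmu : mu.im ≠ 0) :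
    RealIntertwines (2 * m) (2 * n) lam mu y ↔
      ComplexIntertwines m n lam mu (fun a b =>
        ⟨y (2 * a) (2 * b) + y (2 * a + 1) (2 * b + 1),
          y (2 * a + 1) (2 * b) - y (2 * a) (2 * b + 1)⟩) ∧
      ComplexIntertwines m n lam (starRingEnd ℂ mu) (fun a b =>
        ⟨y (2 * a) (2 * b) - y (2 * a + 1) (2 * b + 1),
          y (2 * a + 1) (2 * b) + y (2 * a) (2 * b + 1)⟩) := by
  have key : RealIntertwines (2 * m) (2 * n) lam mu y ↔ ∀ a < m, ∀ b < n,
      (∀ i < 2, ∀ j < 2,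
        ∑ c ∈ Finset.range (2 * n), realJordanEntry mu (2 * b + j) c * y (2 * a + i) c =
          ∑ c ∈ Finset.range (2 * m), realJordanEntry lam c (2 * a + i) * y c (2 * b + j)) := by
    refine ⟨fun h a ha b hb i hi j hj => h _ (by omega) _ (by omega), fun h a ha b hb => ?_⟩
    have := h (a / 2) (by omega) (b / 2) (by omega) (a % 2) (Nat.mod_lt _ two_pos) (b % 2)
      (Nat.mod_lt _ two_pos)
    rwa [Nat.div_add_mod, Nat.div_add_mod] at this
  rw [key]
  unfold ComplexIntertwines
  simp only [← forall_and]
  refine forall₂_congr fun a ha => forall₂_congr fun b hb => ?_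
  simp only [Nat.forall_lt_succ_right, Nat.not_lt_zero, false_imp_iff, implies_true, true_and,
    add_zero]
  rw [sum_realJordanEntry_row_even hmu hb, sum_realJordanEntry_row_even hmu hb,
    sum_realJordanEntry_row_odd hmu hb, sum_realJordanEntry_row_odd hmu hb,
    sum_realJordanEntry_col_even hlam ha fun c => y c _,
    sum_realJordanEntry_col_even hlam ha fun c => y c _,
    sum_realJordanEntry_col_odd hlam ha fun c => y c _,
    sum_realJordanEntry_col_odd hlam ha fun c => y c _,
    Complex.ext_iff, Complex.ext_iff]
  constructor
  · rintro ⟨⟨h0, h1⟩, h2, h3⟩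
    split_ifs at h0 h1 h2 h3 ⊢ <;> simp <;> refine ⟨⟨?_, ?_⟩, ?_, ?_⟩ <;> linarith
  · rintro ⟨⟨h0, h1⟩, h2, h3⟩
    split_ifs at h0 h1 h2 h3 ⊢ <;> simp at h0 h1 h2 h3 <;> refine ⟨⟨?_, ?_⟩, ?_, ?_⟩ <;> linarith

theorem ComplexIntertwines.re {p q : ℕ} {lam mu : ℂ} {w : ℕ → ℕ → ℂ}
    (hw : ComplexIntertwines p q lam mu w) (hlam : lam.im = 0) (hmu : mu.im = 0) :
    RealIntertwines p q lam mu fun a b => (w a b).re := by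
  intro a ha b hb
  have h := congrArg Complex.re (hw a ha b hb)
  rw [sum_realJordanEntry_row hmu hb, sum_realJordanEntry_col hlam ha fun c => (w c b).re]
  split_ifs at h ⊢ <;> simpa [hlam, hmu] using h

theorem ComplexIntertwines.exists_realIntertwines {m n : ℕ} {lam : ℂ} {w : ℕ → ℕ → ℂ}
    (hw : ComplexIntertwines m n lam lam w) (hlam : lam.im ≠ 0) :
    ∃ y, RealIntertwines (2 * m) (2 * n) lam lam y ∧ ∀ a b,
      y (2 * a) (2 * b) = (w a b).re ∧ y (2 * a + 1) (2 * b) = (w a b).im ∧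
        y (2 * a + 1) (2 * b + 1) = (w a b).re := by
  let y : ℕ → ℕ → ℝ := fun a b =>
    if a % 2 = b % 2 then (w (a / 2) (b / 2)).re
    else if a % 2 = 1 then (w (a / 2) (b / 2)).im else -(w (a / 2) (b / 2)).im
  have hdiv : ∀ a, (2 * a + 1) / 2 = a := fun a => by omega
  have hmod : ∀ a, (2 * a + 1) % 2 = 1 := fun a => by omega
  have y00 : ∀ a b, y (2 * a) (2 * b) = (w a b).re := fun a b => by simp [y]
  have y01 : ∀ a b, y (2 * a) (2 * b + 1) = -(w a b).im := fun a b => by simp [y, hdiv, hmod]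
  have y10 : ∀ a b, y (2 * a + 1) (2 * b) = (w a b).im := fun a b => by simp [y, hdiv, hmod]
  have y11 : ∀ a b, y (2 * a + 1) (2 * b + 1) = (w a b).re := fun a b => by simp [y, hdiv, hmod]
  refine ⟨y, (realIntertwines_two_mul_iff hlam hlam).2 ⟨fun a ha b hb => ?_, fun a _ b _ => ?_⟩,
    fun a b => ⟨y00 a b, y10 a b, y11 a b⟩⟩
  · have h := hw a ha b hb
    simp only [y00, y01, y10, y11]
    rw [Complex.ext_iff] at h ⊢
    obtain ⟨h0, h1⟩ := h
    split_ifs at h0 h1 ⊢ <;> simp at h0 h1 ⊢ <;> constructor <;> linarith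
  · simp only [y00, y01, y10, y11]
    rw [Complex.ext_iff]
    split_ifs <;> simp

namespace RealIntertwines

variable {p q : ℕ} {lam mu : ℂ} {y : ℕ → ℕ → ℝ}

theorem eq_zero_of_ne (h : RealIntertwines p q lam mu y) (hne : lam ≠ mu)
    (hlam : 0 ≤ lam.im) (hmu : 0 ≤ mu.im) (hp : 0 < lam.im → Even p) (hq : 0 < mu.im → Even q) :
    ∀ a < p, ∀ b < q, y a b = 0 := by
  rcases hlam.eq_or_lt with hl | hl <;> rcases hmu.eq_or_lt with hm | hm
  · have hw := ((realIntertwines_iff_of_im_eq_zero hl.symm hm.symm).1 h).eq_zero_of_ne hne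
    exact fun a ha b hb => Complex.ofReal_eq_zero.1 (hw a ha b hb)
  · obtain ⟨n, rfl⟩ := (hq hm).exists_two_nsmul
    rw [smul_eq_mul] at *
    have hw := (h.complexify_right hl.symm hm.ne').eq_zero_of_ne hne
    intro a ha b hb
    have := Complex.ext_iff.1 (hw a ha (b / 2) (by omega))
    obtain ⟨k, rfl | rfl⟩ := b.even_or_odd'
    · simpa using this.1
    · simpa [show (2 * k + 1) / 2 = k by omega] using this.2
  · obtain ⟨n, rfl⟩ := (hp hl).exists_two_nsmul
    rw [smul_eq_mul] at *
    have hw := (h.complexify_left hl.ne' hm.symm).eq_zero_of_ne hne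
    intro a ha b hb
    have := Complex.ext_iff.1 (hw (a / 2) (by omega) b hb)
    obtain ⟨k, rfl | rfl⟩ := a.even_or_odd'
    · simpa using this.1
    · simpa [show (2 * k + 1) / 2 = k by omega] using this.2
  · obtain ⟨m, rfl⟩ := (hp hl).exists_two_nsmul
    obtain ⟨n, rfl⟩ := (hq hm).exists_two_nsmul
    rw [smul_eq_mul, smul_eq_mul] at *
    obtain ⟨h1, h2⟩ := (realIntertwines_two_mul_iff hl.ne' hm.ne').1 h
    have hne' : lam ≠ starRingEnd ℂ mu := fun he => by
      have := congrArg Complex.im he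
      rw [Complex.conj_im] at this
      linarith
    have hw1 := h1.eq_zero_of_ne hne
    have hw2 := h2.eq_zero_of_ne hne'
    intro a ha b hb
    obtain ⟨e1, e2⟩ := Complex.ext_iff.1 (hw1 (a / 2) (by omega) (b / 2) (by omega))
    obtain ⟨e3, e4⟩ := Complex.ext_iff.1 (hw2 (a / 2) (by omega) (b / 2) (by omega))
    obtain ⟨k, rfl | rfl⟩ := a.even_or_odd' <;> obtain ⟨l, rfl | rfl⟩ := b.even_or_odd' <;>
      simp [show ∀ k, (2 * k + 1) / 2 = k by omega] at e1 e2 e3 e4 <;> linarith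

theorem entries_of_two_mul {m n : ℕ} (h : RealIntertwines (2 * m) (2 * n) lam lam y)
    (hlam : 0 < lam.im) {a b : ℕ} (ha : a < m) (hb : b < n) :
    y (2 * a) (2 * b) = y (2 * a + 1) (2 * b + 1) ∧
      y (2 * a) (2 * b + 1) = -y (2 * a + 1) (2 * b) := by
  have hne : lam ≠ starRingEnd ℂ lam := fun he => by
    have := congrArg Complex.im he
    rw [Complex.conj_im] at this
    linarith
  obtain ⟨e1, e2⟩ := Complex.ext_iff.1
    (((realIntertwines_two_mul_iff hlam.ne' hlam.ne').1 h).2.eq_zero_of_ne hne a ha b hb)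
  simp only [Complex.zero_re, Complex.zero_im] at e1 e2
  constructor <;> linarith

theorem eq_zero_of_complex {m n : ℕ} (h : RealIntertwines (2 * m) (2 * n) lam lam y)
    (hlam : 0 < lam.im)
    (hw : ∀ a < m, ∀ b < n, (⟨y (2 * a) (2 * b) + y (2 * a + 1) (2 * b + 1),
      y (2 * a + 1) (2 * b) - y (2 * a) (2 * b + 1)⟩ : ℂ) = 0) :
    ∀ a < 2 * m, ∀ b < 2 * n, y a b = 0 := by
  intro a ha b hb
  obtain ⟨e1, e2⟩ := Complex.ext_iff.1 (hw (a / 2) (by omega) (b / 2) (by omega))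
  obtain ⟨e3, e4⟩ := h.entries_of_two_mul hlam (a := a / 2) (b := b / 2) (by omega) (by omega)
  obtain ⟨k, rfl | rfl⟩ := a.even_or_odd' <;> obtain ⟨l, rfl | rfl⟩ := b.even_or_odd' <;>
    simp [show ∀ k, (2 * k + 1) / 2 = k by omega] at e1 e2 e3 e4 <;> linarith

theorem eq_zero_of_first_col (h : RealIntertwines p q lam lam y)
    (hlam : 0 ≤ lam.im) (hp : 0 < lam.im → Even p) (hq : 0 < lam.im → Even q)
    (h0 : ∀ a < p, y a 0 = 0) : ∀ a < p, ∀ b < q, y a b = 0 := by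
  rcases hlam.eq_or_lt with hl | hl
  · have hw := ((realIntertwines_iff_of_im_eq_zero hl.symm hl.symm).1 h).eq_zero_of_first_col
      fun a ha => by simp [h0 a ha]
    exact fun a ha b hb => Complex.ofReal_eq_zero.1 (hw a ha b hb)
  · obtain ⟨m, rfl⟩ := (hp hl).exists_two_nsmul
    obtain ⟨n, rfl⟩ := (hq hl).exists_two_nsmul
    rw [smul_eq_mul, smul_eq_mul] at *
    rcases n.eq_zero_or_pos with rfl | hn
    · simp
    refine h.eq_zero_of_complex hl
      (((realIntertwines_two_mul_iff hl.ne' hl.ne').1 h).1.eq_zero_of_first_col fun a ha => ?_)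
    obtain ⟨e1, e2⟩ := h.entries_of_two_mul hl ha hn
    have e3 := h0 (2 * a) (by omega)
    have e4 := h0 (2 * a + 1) (by omega)
    rw [mul_zero] at *
    rw [e2, ← e1, e3, e4, add_zero, neg_zero, sub_zero]
    rfl

theorem eq_zero_of_last_row (h : RealIntertwines p q lam lam y)
    (hlam : 0 ≤ lam.im) (hp : 0 < lam.im → Even p) (hq : 0 < lam.im → Even q)
    (h0 : ∀ b < q, y (p - 1) b = 0) : ∀ a < p, ∀ b < q, y a b = 0 := by
  rcases hlam.eq_or_lt with hl | hl
  · have hw := ((realIntertwines_iff_of_im_eq_zero hl.symm hl.symm).1 h).eq_zero_of_last_row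
      fun b hb => by simp [h0 b hb]
    exact fun a ha b hb => Complex.ofReal_eq_zero.1 (hw a ha b hb)
  · obtain ⟨m, rfl⟩ := (hp hl).exists_two_nsmul
    obtain ⟨n, rfl⟩ := (hq hl).exists_two_nsmul
    rw [smul_eq_mul, smul_eq_mul] at *
    rcases m.eq_zero_or_pos with rfl | hm
    · simp
    refine h.eq_zero_of_complex hl
      (((realIntertwines_two_mul_iff hl.ne' hl.ne').1 h).1.eq_zero_of_last_row fun b hb => ?_)
    obtain ⟨e1, e2⟩ := h.entries_of_two_mul hl (Nat.sub_lt hm one_pos) hb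
    have e3 := h0 (2 * b) (by omega)
    have e4 := h0 (2 * b + 1) (by omega)
    rw [show 2 * m - 1 = 2 * (m - 1) + 1 by omega] at e3 e4
    rw [e2, e1, e3, e4, add_zero, neg_zero, sub_zero]
    rfl

end RealIntertwines

theorem exists_realIntertwines_first_col {p q : ℕ} {lam : ℂ} (hlam : 0 ≤ lam.im)
    (hp : 0 < lam.im → Even p) (hq : 0 < lam.im → Even q) (hpq : p ≤ q) (z : ℕ → ℝ) :
    ∃ y, RealIntertwines p q lam lam y ∧ ∀ a < p, y a 0 = z a := by
  rcases hlam.eq_or_lt with hl | hl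
  · obtain ⟨w, hw, hc⟩ := ComplexIntertwines.exists_first_col (lam := lam) hpq fun a => (z a : ℂ)
    exact ⟨_, hw.re hl.symm hl.symm, fun a ha => by simp [hc a ha]⟩
  · obtain ⟨m, rfl⟩ := (hp hl).exists_two_nsmul
    obtain ⟨n, rfl⟩ := (hq hl).exists_two_nsmul
    rw [smul_eq_mul, smul_eq_mul] at *
    obtain ⟨w, hw, hc⟩ := ComplexIntertwines.exists_first_col (lam := lam) (p := m) (q := n)
      (by omega) fun a => ⟨z (2 * a), z (2 * a + 1)⟩
    obtain ⟨y, hy, he⟩ := hw.exists_realIntertwines hl.ne'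
    refine ⟨y, hy, fun a ha => ?_⟩
    obtain ⟨e1, e2, -⟩ := he (a / 2) 0
    rw [hc (a / 2) (by omega), mul_zero] at e1 e2
    obtain ⟨k, rfl | rfl⟩ := a.even_or_odd'
    · simpa using e1
    · simpa [show (2 * k + 1) / 2 = k by omega] using e2

theorem exists_realIntertwines_last_row {p q : ℕ} {lam : ℂ} (hlam : 0 ≤ lam.im)
    (hp : 0 < lam.im → Even p) (hq : 0 < lam.im → Even q) (hpq : q < p) (z : ℕ → ℝ) :
    ∃ y, RealIntertwines p q lam lam y ∧ ∀ b < q, y (p - 1) b = z b := by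
  rcases hlam.eq_or_lt with hl | hl
  · obtain ⟨w, hw, hc⟩ :=
      ComplexIntertwines.exists_last_row (lam := lam) hpq.le fun b => (z b : ℂ)
    exact ⟨_, hw.re hl.symm hl.symm, fun b hb => by simp [hc b hb]⟩
  · obtain ⟨m, rfl⟩ := (hp hl).exists_two_nsmul
    obtain ⟨n, rfl⟩ := (hq hl).exists_two_nsmul
    rw [smul_eq_mul, smul_eq_mul] at *
    obtain ⟨w, hw, hc⟩ := ComplexIntertwines.exists_last_row (lam := lam) (p := m) (q := n)
      (by omega) fun b => ⟨z (2 * b + 1), z (2 * b)⟩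
    obtain ⟨y, hy, he⟩ := hw.exists_realIntertwines hl.ne'
    refine ⟨y, hy, fun b hb => ?_⟩
    obtain ⟨-, e1, e2⟩ := he (m - 1) (b / 2)
    rw [hc (b / 2) (by omega)] at e1 e2
    rw [show 2 * m - 1 = 2 * (m - 1) + 1 by omega]
    obtain ⟨k, rfl | rfl⟩ := b.even_or_odd'
    · simpa using e1
    · simpa [show (2 * k + 1) / 2 = k by omega] using e2

section JordanMat

variable {s : ℕ} {lam : Fin s → ℂ} {t : Fin s → ℕ} {sz : ∀ i : Fin s, Fin (t i) → ℕ}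

theorem realJordanMat_same (i : Fin s) (j : Fin (t i)) (a b : Fin (sz i j)) :
    RealJordanMat s lam t sz ⟨i, j, a⟩ ⟨i, j, b⟩ = realJordanEntry (lam i) a b := by
  simp [RealJordanMat]

theorem realJordanMat_of_ne {x y : Idx s t sz}
    (h : (⟨x.1, x.2.1⟩ : Σ i, Fin (t i)) ≠ ⟨y.1, y.2.1⟩) : RealJordanMat s lam t sz x y = 0 := by
  obtain ⟨i, j, a⟩ := x
  obtain ⟨i', j', b⟩ := y
  refine if_neg fun ⟨h1, h2⟩ => h ?_
  obtain rfl : i = i' := h1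
  obtain rfl : j = j' := Fin.ext h2
  rfl

theorem sum_eq_sum_block {i : Fin s} {j : Fin (t i)} (f : Idx s t sz → ℝ)
    (hf : ∀ y, (⟨i, j⟩ : Σ i, Fin (t i)) ≠ ⟨y.1, y.2.1⟩ → f y = 0) :
    ∑ y, f y = ∑ c : Fin (sz i j), f ⟨i, j, c⟩ := by
  rw [Fintype.sum_sigma, Fintype.sum_eq_single i, Fintype.sum_sigma, Fintype.sum_eq_single j]
  · exact fun j' hj => Finset.sum_eq_zero fun c _ => hf _ (by simpa using hj.symm)
  · exact fun i' hi => Finset.sum_eq_zero fun c _ => hf _ fun he => hi (congrArg Sigma.fst he).symm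

/-- The block of a matrix with given block row and block column, extended by zero to `ℕ × ℕ`. -/
def block (Y : Matrix (Idx s t sz) (Idx s t sz) ℝ) (i : Fin s) (j : Fin (t i)) (i' : Fin s)
    (k : Fin (t i')) (a b : ℕ) : ℝ :=
  if h : a < sz i j ∧ b < sz i' k then Y ⟨i, j, a, h.1⟩ ⟨i', k, b, h.2⟩ else 0

theorem block_apply (Y : Matrix (Idx s t sz) (Idx s t sz) ℝ) {i : Fin s} {j : Fin (t i)}
    {i' : Fin s} {k : Fin (t i')} (a : Fin (sz i j)) (b : Fin (sz i' k)) :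
    block Y i j i' k a b = Y ⟨i, j, a⟩ ⟨i', k, b⟩ := by
  simp [block]

theorem mul_transpose_apply (Y : Matrix (Idx s t sz) (Idx s t sz) ℝ) {i : Fin s} {j : Fin (t i)}
    {i' : Fin s} {k : Fin (t i')} (a : Fin (sz i j)) (b : Fin (sz i' k)) :
    (Y * (RealJordanMat s lam t sz)ᵀ) ⟨i, j, a⟩ ⟨i', k, b⟩ =
      ∑ c ∈ Finset.range (sz i' k), realJordanEntry (lam i') b c * block Y i j i' k a c := by
  rw [Matrix.mul_apply, sum_eq_sum_block (i := i') (j := k), Finset.sum_range]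
  · simp [block_apply, realJordanMat_same, mul_comm]
  · intro y hy
    rw [Matrix.transpose_apply, realJordanMat_of_ne hy, mul_zero]

theorem transpose_mul_apply (Y : Matrix (Idx s t sz) (Idx s t sz) ℝ) {i : Fin s} {j : Fin (t i)}
    {i' : Fin s} {k : Fin (t i')} (a : Fin (sz i j)) (b : Fin (sz i' k)) :
    ((RealJordanMat s lam t sz)ᵀ * Y) ⟨i, j, a⟩ ⟨i', k, b⟩ =
      ∑ c ∈ Finset.range (sz i j), realJordanEntry (lam i) c a * block Y i j i' k c b := by
  rw [Matrix.mul_apply, sum_eq_sum_block (i := i) (j := j), Finset.sum_range]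
  · simp [block_apply, realJordanMat_same]
  · intro y hy
    rw [Matrix.transpose_apply, realJordanMat_of_ne hy.symm, zero_mul]

theorem commute_transpose_iff (Y : Matrix (Idx s t sz) (Idx s t sz) ℝ) :
    Commute Y (RealJordanMat s lam t sz)ᵀ ↔
      ∀ i j i' k, RealIntertwines (sz i j) (sz i' k) (lam i) (lam i') (block Y i j i' k) := by
  refine ⟨fun h i j i' k a ha b hb => ?_, fun h => Matrix.ext ?_⟩
  · have := congrFun₂ h.eq ⟨i, j, a, ha⟩ ⟨i', k, b, hb⟩
    rwa [mul_transpose_apply, transpose_mul_apply] at this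
  · rintro ⟨i, j, a⟩ ⟨i', k, b⟩
    rw [mul_transpose_apply, transpose_mul_apply]
    exact h i j i' k a a.2 b b.2

theorem eq_zero_of_commute_transpose (hinj : Function.Injective lam)
    (him : ∀ i : Fin s, 0 ≤ (lam i).im)
    (heven : ∀ (i : Fin s) (j : Fin (t i)), 0 < (lam i).im → Even (sz i j))
    {Y : Matrix (Idx s t sz) (Idx s t sz) ℝ} (hY : Commute Y (RealJordanMat s lam t sz)ᵀ)
    (h0 : ∀ x y, Supp s t sz x y → Y x y = 0) : Y = 0 := by
  rw [commute_transpose_iff] at hY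
  ext ⟨i, j, a⟩ ⟨i', k, b⟩
  rw [← block_apply Y a b]
  rcases eq_or_ne i i' with rfl | hne
  · rcases le_or_gt (sz i j) (sz i k) with hle | hlt
    · refine (hY i j i k).eq_zero_of_first_col (him i) (heven i j) (heven i k) (fun a ha => ?_)
        a a.2 b b.2
      unfold block
      split_ifs
      · exact h0 _ _ ⟨rfl, Or.inl ⟨hle, rfl⟩⟩
      · rfl
    · refine (hY i j i k).eq_zero_of_last_row (him i) (heven i j) (heven i k) (fun b hb => ?_)
        a a.2 b b.2
      unfold block
      split_ifs
      · exact h0 _ _ ⟨rfl, Or.inr ⟨hlt, rfl⟩⟩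
      · rfl
  · exact (hY i j i' k).eq_zero_of_ne (hinj.ne hne) (him i) (him i') (heven i j) (heven i' k)
      a a.2 b b.2

theorem exists_realIntertwines_of_supp (him : ∀ i : Fin s, 0 ≤ (lam i).im)
    (heven : ∀ (i : Fin s) (j : Fin (t i)), 0 < (lam i).im → Even (sz i j))
    (P : Matrix (Idx s t sz) (Idx s t sz) ℝ) (i : Fin s) (j : Fin (t i)) (i' : Fin s)
    (k : Fin (t i')) :
    ∃ y, RealIntertwines (sz i j) (sz i' k) (lam i) (lam i') y ∧
      ∀ a b, Supp s t sz ⟨i, j, a⟩ ⟨i', k, b⟩ → y a b = P ⟨i, j, a⟩ ⟨i', k, b⟩ := by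
  rcases eq_or_ne i i' with rfl | hne
  · rcases le_or_gt (sz i j) (sz i k) with hle | hlt
    · obtain ⟨y, hy, hz⟩ := exists_realIntertwines_first_col (him i) (heven i j) (heven i k) hle
        fun a => block P i j i k a 0
      refine ⟨y, hy, fun a b hab => ?_⟩
      obtain ⟨-, ⟨-, hb⟩ | ⟨hlt, -⟩⟩ := hab
      · rw [← block_apply P, show (b : ℕ) = 0 from hb, hz a a.2]
      · exact absurd hle hlt.not_ge
    · obtain ⟨y, hy, hz⟩ := exists_realIntertwines_last_row (him i) (heven i j) (heven i k) hlt
        fun b => block P i j i k (sz i j - 1) b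
      refine ⟨y, hy, fun a b hab => ?_⟩
      obtain ⟨-, ⟨hle, -⟩ | ⟨-, ha⟩⟩ := hab
      · exact absurd hle hlt.not_ge
      · rw [← block_apply P, show (a : ℕ) = sz i j - 1 from ha, hz b b.2]
  · exact ⟨0, fun a _ b _ => by simp, fun a b hab => absurd hab.1 hne⟩

theorem exists_commute_transpose_of_supp (him : ∀ i : Fin s, 0 ≤ (lam i).im)
    (heven : ∀ (i : Fin s) (j : Fin (t i)), 0 < (lam i).im → Even (sz i j))
    (P : Matrix (Idx s t sz) (Idx s t sz) ℝ) :
    ∃ Y, Commute Y (RealJordanMat s lam t sz)ᵀ ∧ ∀ x y, Supp s t sz x y → Y x y = P x y := by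
  choose y hy hP using exists_realIntertwines_of_supp him heven P
  refine ⟨Matrix.of fun u v => y u.1 u.2.1 v.1 v.2.1 u.2.2 v.2.2,
    (commute_transpose_iff _).2 fun i j i' k a ha b hb => ?_, fun u v huv => hP _ _ _ _ _ _ huv⟩
  refine Eq.trans (Finset.sum_congr rfl fun c hc => ?_)
    ((hy i j i' k a ha b hb).trans (Finset.sum_congr rfl fun c hc => ?_))
  · simp [block, ha, Finset.mem_range.1 hc]
  · simp [block, hb, Finset.mem_range.1 hc]

end JordanMat

theorem trace_mul_transpose_eq_sum {ι : Type*} [Fintype ι] (M Y : Matrix ι ι ℝ) :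
    (M * Yᵀ).trace = ∑ x, ∑ y, M x y * Y x y := by
  simp [Matrix.trace, Matrix.mul_apply]

/-- Commutators with `A` are orthogonal to the centralizer of `Aᵀ`. -/
theorem trace_commutator_mul_transpose {ι : Type*} [Fintype ι] (A X Y : Matrix ι ι ℝ) :
    ((X * A - A * X) * Yᵀ).trace = (X * (Y * Aᵀ - Aᵀ * Y)ᵀ).trace := by
  rw [Matrix.transpose_sub, Matrix.transpose_mul, Matrix.transpose_mul, Matrix.transpose_transpose,
    Matrix.sub_mul, Matrix.mul_sub, Matrix.trace_sub, Matrix.trace_sub, Matrix.mul_assoc A X,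
    Matrix.trace_mul_comm A, Matrix.mul_assoc, Matrix.mul_assoc]

/-- If only the zero matrix commutes with `Aᵀ` and vanishes on `S`, then every matrix is a
commutator with `A` plus a matrix supported on `S`. -/
theorem exists_add_commutator {ι : Type*} [Fintype ι] (A : Matrix ι ι ℝ) (S : ι → ι → Prop)
    (h : ∀ Y : Matrix ι ι ℝ, Commute Y Aᵀ → (∀ x y, S x y → Y x y = 0) → Y = 0)
    (M : Matrix ι ι ℝ) :
    ∃ P X : Matrix ι ι ℝ, (∀ x y, ¬ S x y → P x y = 0) ∧ M = P + (X * A - A * X) := by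
  classical
  let L : Matrix ι ι ℝ →ₗ[ℝ] Matrix ι ι ℝ := LinearMap.mulRight ℝ A - LinearMap.mulLeft ℝ A
  let W : Submodule ℝ (Matrix ι ι ℝ) :=
    { carrier := {P | ∀ x y, ¬ S x y → P x y = 0}
      add_mem' := fun hP hQ x y hxy => by simp [hP x y hxy, hQ x y hxy]
      zero_mem' := fun _ _ _ => rfl
      smul_mem' := fun c P hP x y hxy => by simp [hP x y hxy] }
  have htop : W ⊔ LinearMap.range L = ⊤ := by
    by_contra hne
    obtain ⟨f, hf, hle⟩ := Submodule.exists_le_ker_of_lt_top _ (lt_top_iff_ne_top.2 hne)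
    let Y : Matrix ι ι ℝ := Matrix.of fun x y => f (Matrix.single x y 1)
    have hfY : ∀ M, f M = (M * Yᵀ).trace := fun M => by
      conv_lhs => rw [Matrix.matrix_eq_sum_single M]
      simp only [map_sum, trace_mul_transpose_eq_sum]
      refine Finset.sum_congr rfl fun x _ => Finset.sum_congr rfl fun y _ => ?_
      rw [← mul_one (M x y), ← smul_eq_mul, ← Matrix.smul_single, map_smul]
      simp [Y]
    have hY : Y = 0 := by
      refine h Y ?_ fun x y hxy => hle (Submodule.mem_sup_left fun u v huv => ?_)
      · refine sub_eq_zero.1 (Matrix.ext fun x y => ?_)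
        have h0 : f (L (Matrix.single x y 1)) = 0 :=
          hle (Submodule.mem_sup_right (LinearMap.mem_range_self L _))
        rw [hfY] at h0
        simp only [L, LinearMap.sub_apply, LinearMap.mulRight_apply, LinearMap.mulLeft_apply] at h0
        rw [trace_commutator_mul_transpose, trace_mul_transpose_eq_sum] at h0
        simpa [Matrix.single_apply, ite_and] using h0
      · refine Matrix.single_apply_of_ne _ _ _ _ _ ?_
        rintro ⟨rfl, rfl⟩
        exact huv hxy
    exact hf (LinearMap.ext fun M => by simp [hfY, hY])
  obtain ⟨P, hP, _, ⟨X, rfl⟩, hM⟩ := Submodule.mem_sup.1 (htop ▸ Submodule.mem_top : M ∈ _)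
  exact ⟨P, X, hP, hM.symm⟩

/-- If every matrix agrees on `S` with a matrix that commutes with `Aᵀ`, then a commutator with `A`
supported on `S` vanishes. -/
theorem eq_zero_of_add_commutator_eq_zero {ι : Type*} [Fintype ι] (A : Matrix ι ι ℝ)
    (S : ι → ι → Prop)
    (h : ∀ P : Matrix ι ι ℝ, ∃ Y, Commute Y Aᵀ ∧ ∀ x y, S x y → Y x y = P x y)
    {P X : Matrix ι ι ℝ} (hP : ∀ x y, ¬ S x y → P x y = 0) (hX : P + (X * A - A * X) = 0) :
    P = 0 := by
  obtain ⟨Y, hY, hYP⟩ := h P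
  have h1 : (P * Yᵀ).trace = 0 := by
    rw [eq_neg_of_add_eq_zero_left hX, Matrix.neg_mul, Matrix.trace_neg,
      trace_commutator_mul_transpose, hY.eq]
    simp
  have h3 : ∑ x, ∑ y, P x y * P x y = 0 := by
    rw [← h1, trace_mul_transpose_eq_sum]
    refine Finset.sum_congr rfl fun x _ => Finset.sum_congr rfl fun y _ => ?_
    by_cases hxy : S x y
    · rw [hYP x y hxy]
    · rw [hP x y hxy, zero_mul, zero_mul]
  rw [← trace_mul_transpose_eq_sum, ← Matrix.conjTranspose_eq_transpose_of_trivial] at h3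
  exact Matrix.trace_mul_conjTranspose_self_eq_zero_iff.1 h3

/-- Theorem 5.1 of the paper for `F = ℝ`: `ℝ^{m×m}` is the internal direct sum of the
subspace `𝒫` of matrices supported on `Supp` and the subspace `{XA − AX}`. -/
theorem simplest_miniversal_jordan_real
    (hinj : Function.Injective lam)
    (him : ∀ i : Fin s, 0 ≤ (lam i).im)
    (heven : ∀ (i : Fin s) (j : Fin (t i)), 0 < (lam i).im → Even (sz i j))
    (hsz : ∀ (i : Fin s) (j : Fin (t i)), 1 ≤ sz i j)
    (hmono : ∀ (i : Fin s) (j k : Fin (t i)), j ≤ k → sz i k ≤ sz i j) :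
    (∀ M : Matrix (Idx s t sz) (Idx s t sz) ℝ,
      ∃ P X : Matrix (Idx s t sz) (Idx s t sz) ℝ,
        (∀ x y, ¬ Supp s t sz x y → P x y = 0) ∧
        M = P + (X * RealJordanMat s lam t sz - RealJordanMat s lam t sz * X)) ∧
    (∀ P X : Matrix (Idx s t sz) (Idx s t sz) ℝ,
      (∀ x y, ¬ Supp s t sz x y → P x y = 0) →
      P + (X * RealJordanMat s lam t sz - RealJordanMat s lam t sz * X) = 0 →
      P = 0 ∧ X * RealJordanMat s lam t sz - RealJordanMat s lam t sz * X = 0) := by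
  refine ⟨exists_add_commutator _ _ fun Y hY => eq_zero_of_commute_transpose hinj him heven hY,
    fun P X hP hX => ?_⟩
  have h := eq_zero_of_add_commutator_eq_zero _ _ (exists_commute_transpose_of_supp him heven) hP hX
  exact ⟨h, by rwa [h, zero_add] at hX⟩

end ArnoldReal
end

section
/- Let x, y be real numbers with y ≠ 0 and let A ∈ ℝ^{4×4} be the matrix with rows (x, y, 1, 0), (−y, x, 0, 1), (0, 0, x, y), (0, 0, −y, x). Then ℝ^{4×4} is the internal direct sum of the 4-dimensional subspace of matrices that are zero outside their first column and the subspace {XA − AX : X ∈ ℝ^{4×4}}. -/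
open Matrix

/-- A commutator with `A` is trace-orthogonal to everything that commutes with `A`. -/
theorem Matrix.trace_commutator_mul_eq_zero {n R : Type*} [Fintype n] [CommRing R]
    {A B : Matrix n n R} (h : A * B = B * A) (X : Matrix n n R) :
    ((X * A - A * X) * B).trace = 0 := by
  rw [Matrix.sub_mul, Matrix.trace_sub, Matrix.mul_assoc X, h, ← Matrix.mul_assoc,
    Matrix.trace_mul_comm, ← Matrix.mul_assoc, Matrix.trace_mul_comm (A * X), sub_self]

/-- If `P` is supported in column `j`, then `trace (P * B)` only involves row `j` of `B`. -/
theorem Matrix.trace_mul_of_support_col {n R : Type*} [Fintype n] [CommRing R]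
    {P : Matrix n n R} {j : n} (hP : ∀ i k, k ≠ j → P i k = 0) (B : Matrix n n R) :
    (P * B).trace = ∑ i, P i j * B j i := by
  refine Finset.sum_congr rfl fun i _ => ?_
  rw [Matrix.diag_apply, Matrix.mul_apply]
  exact Finset.sum_eq_single j (fun k _ hk => by rw [hP i k hk, zero_mul]) (by simp)

/-- The paper's explicit example: for the real canonical matrix `A` with two real Jordan
`2×2` blocks of eigenvalues `x ± iy` (`y ≠ 0`), the space `ℝ^{4×4}` is the internal
direct sum of the 4-dimensional subspace of matrices that vanish outside their first
column and the subspace `{XA − AX}`; equivalently, every `M` decomposes uniquely as a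
sum of a first-column-supported matrix and a commutator `XA − AX`. -/
theorem example_two_complex_jordan_blocks (x y : ℝ) (hy : y ≠ 0) :
    (∀ M : Matrix (Fin 4) (Fin 4) ℝ,
      ∃ P X : Matrix (Fin 4) (Fin 4) ℝ,
        (∀ i j : Fin 4, (j : ℕ) ≠ 0 → P i j = 0) ∧
        M = P + (X * !![x, y, 1, 0; -y, x, 0, 1; 0, 0, x, y; 0, 0, -y, x]
                  - !![x, y, 1, 0; -y, x, 0, 1; 0, 0, x, y; 0, 0, -y, x] * X)) ∧
    (∀ P X : Matrix (Fin 4) (Fin 4) ℝ,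
      (∀ i j : Fin 4, (j : ℕ) ≠ 0 → P i j = 0) →
      P + (X * !![x, y, 1, 0; -y, x, 0, 1; 0, 0, x, y; 0, 0, -y, x]
            - !![x, y, 1, 0; -y, x, 0, 1; 0, 0, x, y; 0, 0, -y, x] * X) = 0 →
      P = 0 ∧ (X * !![x, y, 1, 0; -y, x, 0, 1; 0, 0, x, y; 0, 0, -y, x]
                - !![x, y, 1, 0; -y, x, 0, 1; 0, 0, x, y; 0, 0, -y, x] * X) = 0) := by
  refine ⟨fun M => ?_, fun P X hP h => ?_⟩
  · let w : Fin 4 → ℝ := ![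
      y * M 0 2 - M 0 1 + (y * M 1 3 + M 2 3),
      y * M 1 2 - M 1 1 + (-y * M 0 3 + M 3 3),
      y * M 2 2 - M 2 1 + y * M 3 3,
      y * M 3 2 - M 3 1 - y * M 2 3]
    let c : Fin 4 → ℝ := ![
      (-w 1 / y + w 2 / y ^ 2) / 2, (w 0 / y + w 3 / y ^ 2) / 2, -w 3 / y / 2, w 2 / y / 2]
    have c0 : y * c 1 + c 2 = w 0 / 2 := by simp only [c, Matrix.cons_val]; field_simp; ring
    have c1 : -y * c 0 + c 3 = w 1 / 2 := by simp only [c, Matrix.cons_val]; field_simp; ring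
    have c2 : y * c 3 = w 2 / 2 := by simp only [c, Matrix.cons_val]; field_simp
    have c3 : -y * c 2 = w 3 / 2 := by simp only [c, Matrix.cons_val]; field_simp
    have w0 : w 0 = y * M 0 2 - M 0 1 + (y * M 1 3 + M 2 3) := rfl
    have w1 : w 1 = y * M 1 2 - M 1 1 + (-y * M 0 3 + M 3 3) := rfl
    have w2 : w 2 = y * M 2 2 - M 2 1 + y * M 3 3 := rfl
    have w3 : w 3 = y * M 3 2 - M 3 1 - y * M 2 3 := rfl
    clear_value c w
    obtain ⟨X, X0, X1, X2, X3⟩ : ∃ X : Matrix (Fin 4) (Fin 4) ℝ,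
        (∀ i, X i 0 = (M i 1 + w i / 2) / y) ∧ (∀ i, X i 1 = c i) ∧
        (∀ i, X i 2 = (M i 3 - c i) / y) ∧ ∀ i, X i 3 = 0 :=
      ⟨Matrix.of fun i => ![(M i 1 + w i / 2) / y, c i, (M i 3 - c i) / y, 0],
        fun _ => rfl, fun _ => rfl, fun _ => rfl, fun _ => rfl⟩
    refine ⟨_, X, fun i j hj => ?_, (sub_add_cancel M _).symm⟩
    rw [Matrix.sub_apply, Matrix.sub_apply, Matrix.mul_apply, Matrix.mul_apply,
      Fin.sum_univ_four, Fin.sum_univ_four]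
    fin_cases j
    · exact absurd rfl hj
    all_goals
      fin_cases i <;> simp [X0, X1, X2, X3] <;> field_simp <;> linarith
  · set A : Matrix (Fin 4) (Fin 4) ℝ :=
      !![x, y, 1, 0; -y, x, 0, 1; 0, 0, x, y; 0, 0, -y, x] with hA
    have key (B : Matrix (Fin 4) (Fin 4) ℝ) (hB : A * B = B * A) :
        ∑ i, P i 0 * B 0 i = 0 := by
      rw [← Matrix.trace_mul_of_support_col (fun i k hk => hP i k (Fin.val_ne_of_ne hk)),
        eq_neg_of_add_eq_zero_left h, Matrix.neg_mul, Matrix.trace_neg,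
        Matrix.trace_commutator_mul_eq_zero hB, neg_zero]
    have h0 := key 1 (by simp)
    have h1 := key A rfl
    have h2 := key (A * A) (Matrix.mul_assoc _ _ _).symm
    have h3 := key (A * A * A) (by simp only [Matrix.mul_assoc])
    simp [hA, Matrix.mul_apply, Fin.sum_univ_four, Matrix.one_apply] at h0 h1 h2 h3
    simp only [h0, zero_mul, zero_add] at h1 h2 h3
    have p3 : P 3 0 = 0 := by
      refine (mul_eq_zero.mp ?_).resolve_left (mul_ne_zero two_ne_zero hy)
      linear_combination h2 - 2 * x * h1
    rw [p3] at h2 h3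
    have p2 : P 2 0 = 0 := by
      refine (mul_eq_zero.mp ?_).resolve_left (mul_ne_zero two_ne_zero (pow_ne_zero 2 hy))
      linear_combination (3 * x ^ 2 - y ^ 2) * h1 - h3
    have p1 : P 1 0 = 0 := by
      refine (mul_eq_zero.mp ?_).resolve_left hy
      linear_combination h1 - p2
    have hP0 : P = 0 := by
      ext i j
      by_cases hj : (j : ℕ) = 0
      · obtain rfl : j = 0 := Fin.ext hj
        fin_cases i
        exacts [h0, p1, p2, p3]
      · exact hP i j hj
    exact ⟨hP0, by simpa [hP0] using h⟩
end

section
/- Let l, r ≥ 0, let 1 ≤ p_1 ≤ … ≤ p_l and q_1 ≥ … ≥ q_r ≥ 1 be integers; let C ∈ ℂ^{c×c} be a Jordan canonical matrix, C = block-diag over distinct eigenvalues λ_1,…,λ_s of diag(J_{s_{i1}}(λ_i), J_{s_{i2}}(λ_i),…) with s_{i1} ≥ s_{i2} ≥ …; and let D = diag(J_{d_1},…,J_{d_u}) with d_1 ≥ … ≥ d_u ≥ 1 be a nilpotent Jordan matrix of size d. Let A ∈ ℂ^{m×n} be block-diagonal with diagonal blocks F_{p_1},…,F_{p_l}, I_c,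 D, F_{q_1}^T,…,F_{q_r}^T (so m = Σp_i + c + d + Σ(q_j−1) and n = Σ(p_i−1) + c + d + Σq_j), and let B ∈ ℂ^{m×n} be block-diagonal with diagonal blocks K_{p_1},…,K_{p_l}, C, I_d, K_{q_1}^T,…,K_{q_r}^T in the same row and column partition. Let 𝒫 ⊆ ℂ^{m×n} × ℂ^{m×n} consist of the pairs (P,Q) such that: P is supported only on (i) for each i ≤ l, the last row of the p_i×d block in the rows of F_{p_i} and the columns of D; (ii) for each i ≤ l and j ≤ r, the last column of the p_i×q_j block in the rows of F_{p_i} and the columns of F_{q_j}^T; (iii) for each j ≤ r, the last column of the d×q_j block in the rows of D and the columns of F_{q_j}^T; (iv) inside the d×d block in the rows and columns of D, for each ordered pair (k,k') of Jordan blocks J_{d_k}, J_{d_{k'}} of D, the first column of the corresponding d_k×d_{k'} sub-block if d_k ≤ d_{k'} and its last row if d_k > d_{k'}; and Q is supported only on (i) for each pair i < j ≤ l, the first max(p_j−1−p_i, 0) entries of the first row of the p_i×(p_j−1) block in the rows of K_{p_i} and the columns of K_{p_j}; (ii) for each i ≤ l, the first row of the p_i×c block in the rows of K_{p_i} and the columns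 of C; (iii) for each i ≤ l and j ≤ r, the first row of the p_i×q_j block in the rows of K_{p_i} and the columns of K_{q_j}^T; (iv) inside the c×c block of C, for each ordered pair of Jordan blocks of C with the same eigenvalue and sizes p (row block) and q (column block), the first column of the corresponding p×q sub-block if p ≤ q and its last row if p > q (no positions for pairs with different eigenvalues); (v) for each j ≤ r, the first column of the c×q_j block in the rows of C and the columns of K_{q_j}^T; (vi) for each pair i < j ≤ r, the first max(q_i−1−q_j, 0) entries of the first column of the (q_i−1)×q_j block in the rows of K_{q_i}^T and the columns of K_{q_j}^T. Then ℂ^{m×n} × ℂ^{m×n} is the internal direct sum of 𝒫 and the subspace {(SA − AR, SB − BR) : S ∈ ℂ^{m×m}, R ∈ ℂ^{n×n}}. -/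
open Matrix

namespace KroneckerComplex

/-- Entry `(a, b)` (0-indexed) of a Jordan block with eigenvalue `lam`. -/
def jordanEntry (lam : ℂ) (a b : ℕ) : ℂ :=
  if a = b then lam else if b = a + 1 then 1 else 0

variable (l r : ℕ) (p : Fin l → ℕ) (q : Fin r → ℕ)
variable (s : ℕ) (lamC : Fin s → ℂ) (tC : Fin s → ℕ) (szC : ∀ i : Fin s, Fin (tC i) → ℕ)
variable (u : ℕ) (dsz : Fin u → ℕ)

/-- Index set of the Jordan canonical matrix `C`. -/
abbrev CI := Σ i : Fin s, Σ j : Fin (tC i), Fin (szC i j)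

/-- Index set of the nilpotent Jordan matrix `D`. -/
abbrev DI := Σ k : Fin u, Fin (dsz k)

/-- Row indices: rows of the blocks `F_{p_1}, …, F_{p_l}, I_c, D, F_{q_1}^T, …, F_{q_r}^T`. -/
abbrev Row := (Σ i : Fin l, Fin (p i)) ⊕
  (CI s tC szC ⊕ (DI u dsz ⊕ (Σ j : Fin r, Fin (q j - 1))))

/-- Column indices: columns of the same blocks. -/
abbrev Col := (Σ i : Fin l, Fin (p i - 1)) ⊕
  (CI s tC szC ⊕ (DI u dsz ⊕ (Σ j : Fin r, Fin (q j))))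

/-- The first matrix `A` of the Kronecker pair: block-diagonal with blocks
`F_{p_i}`, `I_c`, `D`, `F_{q_j}^T`. -/
def A : Matrix (Row l r p q s tC szC u dsz) (Col l r p q s tC szC u dsz) ℂ :=
  Matrix.of fun x y =>
    match x, y with
    | Sum.inl ⟨i, a⟩, Sum.inl ⟨i', b⟩ =>
        if i = i' ∧ (a : ℕ) = (b : ℕ) then 1 else 0
    | Sum.inr (Sum.inl c), Sum.inr (Sum.inl c') => if c = c' then 1 else 0
    | Sum.inr (Sum.inr (Sum.inl ⟨k, a⟩)), Sum.inr (Sum.inr (Sum.inl ⟨k', b⟩)) =>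
        if k = k' ∧ (b : ℕ) = (a : ℕ) + 1 then 1 else 0
    | Sum.inr (Sum.inr (Sum.inr ⟨j, a⟩)), Sum.inr (Sum.inr (Sum.inr ⟨j', b⟩)) =>
        if j = j' ∧ (a : ℕ) = (b : ℕ) then 1 else 0
    | _, _ => 0

/-- The second matrix `B` of the Kronecker pair: block-diagonal with blocks
`K_{p_i}`, `C`, `I_d`, `K_{q_j}^T`. -/
def B : Matrix (Row l r p q s tC szC u dsz) (Col l r p q s tC szC u dsz) ℂ :=
  Matrix.of fun x y =>
    match x, y with
    | Sum.inl ⟨i, a⟩, Sum.inl ⟨i', b⟩ =>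
        if i = i' ∧ (a : ℕ) = (b : ℕ) + 1 then 1 else 0
    | Sum.inr (Sum.inl c), Sum.inr (Sum.inl c') =>
        if c.1 = c'.1 ∧ (c.2.1 : ℕ) = (c'.2.1 : ℕ) then
          jordanEntry (lamC c.1) c.2.2 c'.2.2 else 0
    | Sum.inr (Sum.inr (Sum.inl d1)), Sum.inr (Sum.inr (Sum.inl d2)) =>
        if d1 = d2 then 1 else 0
    | Sum.inr (Sum.inr (Sum.inr ⟨j, a⟩)), Sum.inr (Sum.inr (Sum.inr ⟨j', b⟩)) =>
        if j = j' ∧ (b : ℕ) = (a : ℕ) + 1 then 1 else 0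
    | _, _ => 0

/-- Support of the first component `P` of the miniversal deformation. -/
def PSupp : Row l r p q s tC szC u dsz → Col l r p q s tC szC u dsz → Prop
  | Sum.inl ⟨i, a⟩, Sum.inr (Sum.inr (Sum.inl _)) => (a : ℕ) = p i - 1
  | Sum.inl _, Sum.inr (Sum.inr (Sum.inr ⟨j, b⟩)) => (b : ℕ) = q j - 1
  | Sum.inr (Sum.inr (Sum.inl _)), Sum.inr (Sum.inr (Sum.inr ⟨j, b⟩)) => (b : ℕ) = q j - 1
  | Sum.inr (Sum.inr (Sum.inl ⟨k, a⟩)), Sum.inr (Sum.inr (Sum.inl ⟨k', b⟩)) =>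
      (dsz k ≤ dsz k' ∧ (b : ℕ) = 0) ∨ (dsz k' < dsz k ∧ (a : ℕ) = dsz k - 1)
  | _, _ => False

/-- Support of the second component `Q` of the miniversal deformation. -/
def QSupp : Row l r p q s tC szC u dsz → Col l r p q s tC szC u dsz → Prop
  | Sum.inl ⟨i, a⟩, Sum.inl ⟨j, b⟩ =>
      i < j ∧ (a : ℕ) = 0 ∧ (b : ℕ) < p j - 1 - p i
  | Sum.inl ⟨_, a⟩, Sum.inr (Sum.inl _) => (a : ℕ) = 0
  | Sum.inl ⟨_, a⟩, Sum.inr (Sum.inr (Sum.inr _)) => (a : ℕ) = 0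
  | Sum.inr (Sum.inl c), Sum.inr (Sum.inl c') =>
      c.1 = c'.1 ∧
        ((szC c.1 c.2.1 ≤ szC c'.1 c'.2.1 ∧ (c'.2.2 : ℕ) = 0) ∨
         (szC c'.1 c'.2.1 < szC c.1 c.2.1 ∧ (c.2.2 : ℕ) = szC c.1 c.2.1 - 1))
  | Sum.inr (Sum.inl _), Sum.inr (Sum.inr (Sum.inr ⟨_, b⟩)) => (b : ℕ) = 0
  | Sum.inr (Sum.inr (Sum.inr ⟨i, a⟩)), Sum.inr (Sum.inr (Sum.inr ⟨j, b⟩)) =>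
      i < j ∧ (b : ℕ) = 0 ∧ (a : ℕ) < q i - 1 - q j
  | _, _ => False

/-- The pairs of matrices supported on `P` and `Q` form a complement of
`{(S A₂ − A₁ R, S B₂ − B₁ R)}`. -/
def IsComplement {m₁ n₁ m₂ n₂ : Type*} [Fintype n₁] [Fintype m₂]
    (A₁ B₁ : Matrix m₁ n₁ ℂ) (A₂ B₂ : Matrix m₂ n₂ ℂ) (P Q : m₁ → n₂ → Prop) : Prop :=
  (∀ M N : Matrix m₁ n₂ ℂ, ∃ (S : Matrix m₁ m₂ ℂ) (R : Matrix n₁ n₂ ℂ),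
    (∀ x y, ¬ P x y → (S * A₂ - A₁ * R) x y = M x y) ∧
    ∀ x y, ¬ Q x y → (S * B₂ - B₁ * R) x y = N x y) ∧
  ∀ (S : Matrix m₁ m₂ ℂ) (R : Matrix n₁ n₂ ℂ),
    (∀ x y, ¬ P x y → (S * A₂ - A₁ * R) x y = 0) →
    (∀ x y, ¬ Q x y → (S * B₂ - B₁ * R) x y = 0) →
    S * A₂ - A₁ * R = 0 ∧ S * B₂ - B₁ * R = 0

namespace IsComplement

section

variable {m₁ n₁ m₂ n₂ : Type*} [Fintype n₁] [Fintype m₂]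
  {A₁ B₁ : Matrix m₁ n₁ ℂ} {A₂ B₂ : Matrix m₂ n₂ ℂ} {P Q : m₁ → n₂ → Prop}

theorem swap (h : IsComplement A₁ B₁ A₂ B₂ P Q) : IsComplement B₁ A₁ B₂ A₂ Q P :=
  ⟨fun M N => let ⟨S, R, hP, hQ⟩ := h.1 N M; ⟨S, R, hQ, hP⟩,
    fun S R hQ hP => (h.2 S R hP hQ).symm⟩

theorem congr {P' Q' : m₁ → n₂ → Prop} (h : IsComplement A₁ B₁ A₂ B₂ P Q)
    (hP : ∀ x y, P x y ↔ P' x y) (hQ : ∀ x y, Q x y ↔ Q' x y) :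
    IsComplement A₁ B₁ A₂ B₂ P' Q' := by
  have hP' : P = P' := funext₂ fun x y => propext (hP x y)
  have hQ' : Q = Q' := funext₂ fun x y => propext (hQ x y)
  rwa [← hP', ← hQ']

theorem of_surjective
    (h : ∀ M N : Matrix m₁ n₂ ℂ, ∃ (S : Matrix m₁ m₂ ℂ) (R : Matrix n₁ n₂ ℂ),
      S * A₂ - A₁ * R = M ∧ S * B₂ - B₁ * R = N) :
    IsComplement A₁ B₁ A₂ B₂ (fun _ _ => False) (fun _ _ => False) := by
  refine ⟨fun M N => ?_, fun S R h₁ h₂ => ⟨?_, ?_⟩⟩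
  · obtain ⟨S, R, rfl, rfl⟩ := h M N
    exact ⟨S, R, fun _ _ _ => rfl, fun _ _ _ => rfl⟩
  · ext x y; exact h₁ x y id
  · ext x y; exact h₂ x y id

theorem of_submatrix {m₁' n₁' m₂' n₂' : Type*} [Fintype n₁'] [Fintype m₂']
    (e₁ : m₁' ≃ m₁) (f₁ : n₁' ≃ n₁) (e₂ : m₂' ≃ m₂) (f₂ : n₂' ≃ n₂)
    (h : IsComplement (A₁.submatrix e₁ f₁) (B₁.submatrix e₁ f₁) (A₂.submatrix e₂ f₂)
      (B₂.submatrix e₂ f₂) (fun x y => P (e₁ x) (f₂ y)) (fun x y => Q (e₁ x) (f₂ y))) :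
    IsComplement A₁ B₁ A₂ B₂ P Q := by
  have key : ∀ (S : Matrix m₁ m₂ ℂ) (R : Matrix n₁ n₂ ℂ) (X₁ : Matrix m₁ n₁ ℂ)
      (X₂ : Matrix m₂ n₂ ℂ), S.submatrix e₁ e₂ * X₂.submatrix e₂ f₂ -
        X₁.submatrix e₁ f₁ * R.submatrix f₁ f₂ = (S * X₂ - X₁ * R).submatrix e₁ f₂ := by
    intro S R X₁ X₂
    rw [submatrix_mul_equiv, submatrix_mul_equiv]
    rfl
  refine ⟨fun M N => ?_, fun S R hP hQ => ?_⟩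
  · obtain ⟨S, R, hP, hQ⟩ := h.1 (M.submatrix e₁ f₂) (N.submatrix e₁ f₂)
    obtain ⟨S, rfl⟩ : ∃ S' : Matrix m₁ m₂ ℂ, S = S'.submatrix e₁ e₂ :=
      ⟨S.submatrix e₁.symm e₂.symm, by simp⟩
    obtain ⟨R, rfl⟩ : ∃ R' : Matrix n₁ n₂ ℂ, R = R'.submatrix f₁ f₂ :=
      ⟨R.submatrix f₁.symm f₂.symm, by simp⟩
    simp only [key] at hP hQ
    refine ⟨S, R, fun x y hxy => ?_, fun x y hxy => ?_⟩
    · simpa using hP (e₁.symm x) (f₂.symm y) (by simpa using hxy)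
    · simpa using hQ (e₁.symm x) (f₂.symm y) (by simpa using hxy)
  · have := h.2 (S.submatrix e₁ e₂) (R.submatrix f₁ f₂)
    simp only [key] at this
    obtain ⟨h₁, h₂⟩ := this (fun x y hxy => hP _ _ hxy) (fun x y hxy => hQ _ _ hxy)
    constructor
    · ext x y; simpa using congr_fun₂ h₁ (e₁.symm x) (f₂.symm y)
    · ext x y; simpa using congr_fun₂ h₂ (e₁.symm x) (f₂.symm y)

end

theorem transpose {m₁ n₁ m₂ n₂ : Type*} [Fintype n₁] [Fintype m₂]
    {A₁ B₁ : Matrix m₁ n₁ ℂ} {A₂ B₂ : Matrix m₂ n₂ ℂ} {P Q : m₁ → n₂ → Prop}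
    (h : IsComplement A₁ B₁ A₂ B₂ P Q) :
    IsComplement A₂ᵀ B₂ᵀ A₁ᵀ B₁ᵀ (fun y x => P x y) (fun y x => Q x y) := by
  have key : ∀ (S : Matrix n₂ n₁ ℂ) (R : Matrix m₂ m₁ ℂ) (X₁ : Matrix m₁ n₁ ℂ)
      (X₂ : Matrix m₂ n₂ ℂ), S * X₁ᵀ - X₂ᵀ * R = (-Rᵀ * X₂ - X₁ * -Sᵀ)ᵀ := by
    intro S R X₁ X₂
    simp only [transpose_sub, transpose_mul, transpose_neg, transpose_transpose,
      Matrix.mul_neg, Matrix.neg_mul]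
    abel
  simp only [IsComplement, key, transpose_apply, transpose_eq_zero]
  refine ⟨fun M N => ?_, fun S R hP hQ => h.2 _ _ (fun x y => hP y x) (fun x y => hQ y x)⟩
  obtain ⟨S, R, hP, hQ⟩ := h.1 Mᵀ Nᵀ
  exact ⟨-Rᵀ, -Sᵀ, by simpa using fun x y => hP y x, by simpa using fun x y => hQ y x⟩

theorem blockDiagonal' {ι κ : Type*} {m₁ n₁ : ι → Type*} {m₂ n₂ : κ → Type*}
    [Fintype ι] [Fintype κ] [DecidableEq ι] [DecidableEq κ] [∀ i, Fintype (n₁ i)]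
    [∀ i, Fintype (m₂ i)]
    {A₁ B₁ : ∀ i, Matrix (m₁ i) (n₁ i) ℂ} {A₂ B₂ : ∀ i, Matrix (m₂ i) (n₂ i) ℂ}
    {P Q : (Σ i, m₁ i) → (Σ i, n₂ i) → Prop}
    (h : ∀ i j, IsComplement (A₁ i) (B₁ i) (A₂ j) (B₂ j) (fun x y => P ⟨i, x⟩ ⟨j, y⟩)
      (fun x y => Q ⟨i, x⟩ ⟨j, y⟩)) :
    IsComplement (Matrix.blockDiagonal' A₁) (Matrix.blockDiagonal' B₁)
      (Matrix.blockDiagonal' A₂) (Matrix.blockDiagonal' B₂) P Q := by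
  have key : ∀ (S : Matrix (Σ i, m₁ i) (Σ i, m₂ i) ℂ) (R : Matrix (Σ i, n₁ i) (Σ i, n₂ i) ℂ)
      (X₁ : ∀ i, Matrix (m₁ i) (n₁ i) ℂ) (X₂ : ∀ i, Matrix (m₂ i) (n₂ i) ℂ) i x j y,
      (S * Matrix.blockDiagonal' X₂ - Matrix.blockDiagonal' X₁ * R) ⟨i, x⟩ ⟨j, y⟩ =
        (of (fun a b => S ⟨i, a⟩ ⟨j, b⟩) * X₂ j - X₁ i * of (fun a b => R ⟨i, a⟩ ⟨j, b⟩)) x y := by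
    intro S R X₁ X₂ i x j y
    rw [Matrix.sub_apply, Matrix.sub_apply, mul_apply, mul_apply, mul_apply, mul_apply, Fintype.sum_sigma,
      Fintype.sum_sigma, Finset.sum_eq_single j, Finset.sum_eq_single i]
    · simp
    · intro k _ hk
      simp [blockDiagonal'_apply_ne X₁ _ _ hk.symm]
    · simp
    · intro k _ hk
      simp [blockDiagonal'_apply_ne X₂ _ _ hk]
    · simp
  refine ⟨fun M N => ?_, fun S R hP hQ => ?_⟩
  · choose S R hP hQ using fun i j =>
      (h i j).1 (of fun a b => M ⟨i, a⟩ ⟨j, b⟩) (of fun a b => N ⟨i, a⟩ ⟨j, b⟩)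
    refine ⟨of fun x y => S x.1 y.1 x.2 y.2, of fun x y => R x.1 y.1 x.2 y.2, ?_, ?_⟩
    · rintro ⟨i, x⟩ ⟨j, y⟩ hxy
      rw [key]
      exact hP i j x y hxy
    · rintro ⟨i, x⟩ ⟨j, y⟩ hxy
      rw [key]
      exact hQ i j x y hxy
  · have := fun i j => (h i j).2 (of fun a b => S ⟨i, a⟩ ⟨j, b⟩) (of fun a b => R ⟨i, a⟩ ⟨j, b⟩)
      (fun x y hxy => by rw [← key]; exact hP _ _ hxy)
      (fun x y hxy => by rw [← key]; exact hQ _ _ hxy)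
    constructor
    · ext ⟨i, x⟩ ⟨j, y⟩
      rw [key, (this i j).1]
      rfl
    · ext ⟨i, x⟩ ⟨j, y⟩
      rw [key, (this i j).2]
      rfl

end IsComplement

/-- The `(k + 1) × k` block with ones on the main diagonal. -/
def kronF (k : ℕ) : Matrix (Fin (k + 1)) (Fin k) ℂ :=
  of fun a b => if (a : ℕ) = b then 1 else 0

/-- The `(k + 1) × k` block with ones on the subdiagonal. -/
def kronK (k : ℕ) : Matrix (Fin (k + 1)) (Fin k) ℂ :=
  of fun a b => if (a : ℕ) = b + 1 then 1 else 0

/-- The Jordan block of size `n` with eigenvalue `lam`. -/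
def jordan (lam : ℂ) (n : ℕ) : Matrix (Fin n) (Fin n) ℂ :=
  of fun a b => jordanEntry lam a b

theorem kronF_eq (k : ℕ) : kronF k = of fun a b => if a = b.castSucc then 1 else 0 := by
  ext a b; simp [kronF, Fin.ext_iff]

theorem kronK_eq (k : ℕ) : kronK k = of fun a b => if a = b.succ then 1 else 0 := by
  ext a b; simp [kronK, Fin.ext_iff]

section entries

variable {ι : Type*} {k : ℕ}

@[simp] theorem mul_kronF_apply (S : Matrix ι (Fin (k + 1)) ℂ) (a : ι) (b : Fin k) :
    (S * kronF k) a b = S a b.castSucc := by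
  simp [mul_apply, kronF_eq]

@[simp] theorem mul_kronK_apply (S : Matrix ι (Fin (k + 1)) ℂ) (a : ι) (b : Fin k) :
    (S * kronK k) a b = S a b.succ := by
  simp [mul_apply, kronK_eq]

@[simp] theorem kronF_mul_castSucc (R : Matrix (Fin k) ι ℂ) (a : Fin k) (b : ι) :
    (kronF k * R) a.castSucc b = R a b := by
  simp [mul_apply, kronF_eq]

@[simp] theorem kronF_mul_last (R : Matrix (Fin k) ι ℂ) (b : ι) :
    (kronF k * R) (Fin.last k) b = 0 := by
  simp [mul_apply, kronF_eq, (Fin.castSucc_lt_last _).ne']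

@[simp] theorem kronK_mul_succ (R : Matrix (Fin k) ι ℂ) (a : Fin k) (b : ι) :
    (kronK k * R) a.succ b = R a b := by
  simp [mul_apply, kronK_eq]

@[simp] theorem kronK_mul_zero (R : Matrix (Fin k) ι ℂ) (b : ι) :
    (kronK k * R) 0 b = 0 := by
  simp [mul_apply, kronK_eq, (Fin.succ_ne_zero _).symm]

@[simp] theorem kronFT_mul_apply (R : Matrix (Fin (k + 1)) ι ℂ) (a : Fin k) (b : ι) :
    ((kronF k)ᵀ * R) a b = R a.castSucc b := by
  simp [mul_apply, kronF_eq]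

@[simp] theorem kronKT_mul_apply (R : Matrix (Fin (k + 1)) ι ℂ) (a : Fin k) (b : ι) :
    ((kronK k)ᵀ * R) a b = R a.succ b := by
  simp [mul_apply, kronK_eq]

@[simp] theorem mul_kronFT_castSucc (S : Matrix ι (Fin k) ℂ) (a : ι) (b : Fin k) :
    (S * (kronF k)ᵀ) a b.castSucc = S a b := by
  simp [mul_apply, kronF_eq]

@[simp] theorem mul_kronFT_last (S : Matrix ι (Fin k) ℂ) (a : ι) :
    (S * (kronF k)ᵀ) a (Fin.last k) = 0 := by
  simp [mul_apply, kronF_eq, (Fin.castSucc_lt_last _).ne']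

@[simp] theorem mul_kronKT_succ (S : Matrix ι (Fin k) ℂ) (a : ι) (b : Fin k) :
    (S * (kronK k)ᵀ) a b.succ = S a b := by
  simp [mul_apply, kronK_eq]

@[simp] theorem mul_kronKT_zero (S : Matrix ι (Fin k) ℂ) (a : ι) :
    (S * (kronK k)ᵀ) a 0 = 0 := by
  simp [mul_apply, kronK_eq, (Fin.succ_ne_zero _).symm]

@[simp] theorem mul_jordan_zero (R : Matrix ι (Fin (k + 1)) ℂ) (a : ι) :
    (R * jordan 0 (k + 1)) a 0 = 0 := by
  simp [mul_apply, jordan, jordanEntry]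

@[simp] theorem mul_jordan_succ (R : Matrix ι (Fin (k + 1)) ℂ) (a : ι) (b : Fin k) :
    (R * jordan 0 (k + 1)) a b.succ = R a b.castSucc := by
  rw [mul_apply, Finset.sum_eq_single b.castSucc]
  · simp [jordan, jordanEntry]
  · intro c _ hc
    have : (b : ℕ) ≠ c := fun h => hc (Fin.ext h.symm)
    simp [jordan, jordanEntry, this]
  · simp

@[simp] theorem jordan_mul_last (R : Matrix (Fin (k + 1)) ι ℂ) (b : ι) :
    (jordan 0 (k + 1) * R) (Fin.last k) b = 0 := by
  rw [mul_apply]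
  refine Finset.sum_eq_zero fun c _ => ?_
  have : (c : ℕ) ≠ k + 1 := c.isLt.ne
  simp [jordan, jordanEntry, this]

@[simp] theorem jordan_mul_castSucc (R : Matrix (Fin (k + 1)) ι ℂ) (a : Fin k) (b : ι) :
    (jordan 0 (k + 1) * R) a.castSucc b = R a.succ b := by
  rw [mul_apply, Finset.sum_eq_single a.succ]
  · simp [jordan, jordanEntry]
  · intro c _ hc
    have : (c : ℕ) ≠ a + 1 := fun h => hc (Fin.ext h)
    simp [jordan, jordanEntry, this]
  · simp

end entries

theorem jordan_eq_add (lam : ℂ) (n : ℕ) : jordan lam n = lam • 1 + jordan 0 n := by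
  ext a b
  by_cases h : a = b
  · simp [jordan, jordanEntry, h]
  · simp [jordan, jordanEntry, h, Fin.val_ne_of_ne h]

theorem jordan_blockTriangular (lam : ℂ) (n : ℕ) : (jordan lam n).BlockTriangular id := by
  intro a b hab
  have : (b : ℕ) < a := hab
  simp [jordan, jordanEntry, this.ne', (this.trans (Nat.lt_succ_self _)).ne]

theorem isUnit_jordan {lam : ℂ} (h : lam ≠ 0) (n : ℕ) : IsUnit (jordan lam n) := by
  rw [isUnit_iff_isUnit_det, det_of_isUpperTriangular (jordan_blockTriangular lam n)]
  simp [jordan, jordanEntry, h]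

theorem jordan_zero_pow (n : ℕ) : jordan 0 n ^ n = 0 := by
  have h := aeval_self_charpoly (jordan 0 n)
  rw [charpoly_of_isUpperTriangular _ (jordan_blockTriangular 0 n)] at h
  simpa [jordan, jordanEntry] using h

/-- If `W` is nilpotent then `R ↦ R - Z R W` is surjective. -/
theorem exists_sub_mul_mul_eq {m n : Type*} [Fintype m] [Fintype n] [DecidableEq m]
    [DecidableEq n] (Z : Matrix m m ℂ) {W : Matrix n n ℂ} (hW : IsNilpotent W)
    (Y : Matrix m n ℂ) : ∃ R : Matrix m n ℂ, R - Z * R * W = Y := by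
  obtain ⟨N, hN⟩ := hW
  refine ⟨∑ i ∈ Finset.range N, Z ^ i * Y * W ^ i, ?_⟩
  rw [Matrix.mul_sum, Matrix.sum_mul, ← Finset.sum_sub_distrib]
  have : ∀ i ∈ Finset.range N, Z ^ i * Y * W ^ i - Z * (Z ^ i * Y * W ^ i) * W =
      Z ^ i * Y * W ^ i - Z ^ (i + 1) * Y * W ^ (i + 1) := by
    intro i _
    rw [pow_succ' Z, pow_succ W]
    simp only [Matrix.mul_assoc]
  rw [Finset.sum_congr rfl this, Finset.sum_range_sub' (fun i => Z ^ i * Y * W ^ i), hN]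
  simp

theorem isComplement_one_left_nilpotent {m n : Type*} [Fintype m] [Fintype n] [DecidableEq m]
    [DecidableEq n] (Z : Matrix m m ℂ) {W : Matrix n n ℂ} (hW : IsNilpotent W) :
    IsComplement 1 Z W 1 (fun _ _ => False) (fun _ _ => False) := by
  refine .of_surjective fun M N => ?_
  obtain ⟨R, hR⟩ := exists_sub_mul_mul_eq Z hW (N * W - M)
  refine ⟨N + Z * R, R, ?_, ?_⟩
  · rw [Matrix.one_mul, Matrix.add_mul, ← sub_sub_cancel (N * W) M, ← hR]
    abel
  · simp

theorem isComplement_nilpotent_one_right {m n : Type*} [Fintype m] [Fintype n] [DecidableEq m]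
    [DecidableEq n] (Z : Matrix m m ℂ) {W : Matrix n n ℂ} (hW : IsNilpotent W) :
    IsComplement W 1 1 Z (fun _ _ => False) (fun _ _ => False) := by
  have hW' : IsNilpotent Wᵀ := by
    obtain ⟨N, hN⟩ := hW
    exact ⟨N, by rw [← transpose_pow, hN, transpose_zero]⟩
  simpa using (isComplement_one_left_nilpotent Zᵀ hW').transpose

theorem isComplement_jordan_of_ne {lam mu : ℂ} (h : lam ≠ mu) (m n : ℕ) :
    IsComplement 1 (jordan lam m) 1 (jordan mu n) (fun _ _ => False) (fun _ _ => False) := by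
  refine .of_surjective fun M N => ?_
  obtain ⟨V, hV⟩ := (isUnit_jordan (sub_ne_zero.2 h) m).exists_right_inv
  obtain ⟨R, hR⟩ := exists_sub_mul_mul_eq V ⟨n, jordan_zero_pow n⟩ (M * jordan mu n - N)
  have hVR : jordan lam m * (V * R) = R + mu • (V * R) := by
    have : jordan lam m = jordan (lam - mu) m + mu • 1 := by
      rw [jordan_eq_add, jordan_eq_add (lam - mu), sub_smul]
      abel
    rw [this, Matrix.add_mul, ← Matrix.mul_assoc, hV]
    simp
  refine ⟨M + V * R, V * R, by simp, ?_⟩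
  rw [hVR, Matrix.add_mul, ← sub_sub_cancel (M * jordan mu n) N, ← hR, jordan_eq_add mu n]
  simp only [Matrix.mul_add, Matrix.mul_smul, Matrix.mul_one]
  abel

theorem isComplement_F_one {n : Type*} [Fintype n] [DecidableEq n] (k : ℕ) (Z : Matrix n n ℂ) :
    IsComplement (kronF k) (kronK k) 1 Z (fun _ _ => False) (fun x _ => (x : ℕ) = 0) := by
  refine ⟨fun M N => ?_, fun S R hP hQ => ?_⟩
  · let R : Fin (k + 1) → n → ℂ := Fin.reverseInduction (motive := fun _ => n → ℂ) 0
      fun i v => (M i.succ + v) ᵥ* Z - N i.succ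
    have hlast : R (Fin.last k) = 0 := Fin.reverseInduction_last
    have hR : ∀ i : Fin k, R i.castSucc = (M i.succ + R i.succ) ᵥ* Z - N i.succ := fun i =>
      Fin.reverseInduction_castSucc _
    have hF : kronF k * of (fun i : Fin k => R i.castSucc) = of R := by
      ext a b
      induction a using Fin.lastCases with
      | last => simp [hlast]
      | cast a => simp
    refine ⟨M + of R, of fun i : Fin k => R i.castSucc, fun x y _ => ?_, fun x y hx => ?_⟩
    · rw [hF]
      simp
    · induction x using Fin.cases with
      | zero => simp at hx
      | succ i =>
        have : ((M + of R) * Z) i.succ = (M i.succ + R i.succ) ᵥ* Z := mul_apply_eq_vecMul _ _ _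
        rw [Matrix.sub_apply, kronK_mul_succ, this]
        simp [hR]
  · obtain rfl : S = kronF k * R := by
      ext a b
      simpa [sub_eq_zero] using hP a b id
    have h0 : ∀ a, (kronF k * R) a = 0 := by
      intro a
      induction a using Fin.reverseInduction with
      | last => ext b; simp
      | cast i ih =>
        ext b
        have h₁ := hQ i.succ b (by simp)
        rw [Matrix.sub_apply, mul_apply_eq_vecMul, ih] at h₁
        simpa using h₁
    have hR : R = 0 := by
      ext a b
      simpa using congr_fun (h0 a.castSucc) b
    simp [hR]

theorem isComplement_F_one_right {n : Type*} [Fintype n] [DecidableEq n] (k : ℕ)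
    (Z : Matrix n n ℂ) :
    IsComplement (kronF k) (kronK k) Z 1 (fun x _ => (x : ℕ) = k) (fun _ _ => False) := by
  refine ⟨fun M N => ?_, fun S R hP hQ => ?_⟩
  · let R : Fin (k + 1) → n → ℂ := Fin.induction (motive := fun _ => n → ℂ) 0
      fun i v => (N i.castSucc + v) ᵥ* Z - M i.castSucc
    have hzero : R 0 = 0 := Fin.induction_zero _ _
    have hR : ∀ i : Fin k, R i.succ = (N i.castSucc + R i.castSucc) ᵥ* Z - M i.castSucc := fun i =>
      Fin.induction_succ _ _ _
    have hK : kronK k * of (fun i : Fin k => R i.succ) = of R := by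
      ext a b
      induction a using Fin.cases with
      | zero => simp [hzero]
      | succ a => simp
    refine ⟨N + of R, of fun i : Fin k => R i.succ, fun x y hx => ?_, fun x y _ => ?_⟩
    · induction x using Fin.lastCases with
      | last => simp at hx
      | cast i =>
        have : ((N + of R) * Z) i.castSucc = (N i.castSucc + R i.castSucc) ᵥ* Z :=
          mul_apply_eq_vecMul _ _ _
        rw [Matrix.sub_apply, kronF_mul_castSucc, this]
        simp [hR]
    · rw [hK]
      simp
  · obtain rfl : S = kronK k * R := by
      ext a b
      simpa [sub_eq_zero] using hQ a b id
    have h0 : ∀ a, (kronK k * R) a = 0 := by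
      intro a
      induction a using Fin.induction with
      | zero => ext b; simp
      | succ i ih =>
        ext b
        have h₁ := hP i.castSucc b (by simpa using i.isLt.ne)
        rw [Matrix.sub_apply, mul_apply_eq_vecMul, ih] at h₁
        simpa using h₁
    have hR : R = 0 := by
      ext a b
      simpa using congr_fun (h0 a.succ) b
    simp [hR]

theorem isComplement_FT_one {n : Type*} [Fintype n] [DecidableEq n] (k : ℕ) (Z : Matrix n n ℂ) :
    IsComplement (kronF k)ᵀ (kronK k)ᵀ 1 Z (fun _ _ => False) (fun _ _ => False) := by
  refine .of_surjective fun M N => ?_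
  let R : Fin (k + 1) → n → ℂ := Fin.induction (motive := fun _ => n → ℂ) 0
    fun i v => (M i + v) ᵥ* Z - N i
  have hR : ∀ i : Fin k, R i.succ = (M i + R i.castSucc) ᵥ* Z - N i := fun i =>
    Fin.induction_succ _ _ _
  refine ⟨M + of fun i : Fin k => R i.castSucc, of R, ?_, ?_⟩
  · ext a b
    simp
  · ext a b
    have : ((M + of fun i : Fin k => R i.castSucc) * Z) a = (M a + R a.castSucc) ᵥ* Z :=
      mul_apply_eq_vecMul _ _ _
    rw [Matrix.sub_apply, this]
    simp [hR]

theorem isComplement_FT_one_right {n : Type*} [Fintype n] [DecidableEq n] (k : ℕ)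
    (Z : Matrix n n ℂ) :
    IsComplement (kronF k)ᵀ (kronK k)ᵀ Z 1 (fun _ _ => False) (fun _ _ => False) := by
  refine .of_surjective fun M N => ?_
  let R : Fin (k + 1) → n → ℂ := Fin.reverseInduction (motive := fun _ => n → ℂ) 0
    fun i v => (N i + v) ᵥ* Z - M i
  have hR : ∀ i : Fin k, R i.castSucc = (N i + R i.succ) ᵥ* Z - M i := fun i =>
    Fin.reverseInduction_castSucc _
  refine ⟨N + of fun i : Fin k => R i.succ, of R, ?_, ?_⟩
  · ext a b
    have : ((N + of fun i : Fin k => R i.succ) * Z) a = (N a + R a.succ) ᵥ* Z :=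
      mul_apply_eq_vecMul _ _ _
    rw [Matrix.sub_apply, this]
    simp [hR]
  · ext a b
    simp

theorem isComplement_FT_F (h k : ℕ) :
    IsComplement (kronF h)ᵀ (kronK h)ᵀ (kronF k) (kronK k)
      (fun _ _ => False) (fun _ _ => False) := by
  refine .of_surjective fun M N => ?_
  let T : Fin h → (Fin k → ℂ) → Fin (k + 1) → ℂ := fun i v =>
    Fin.snoc (α := fun _ => ℂ) (M i + v) 0
  let R : Fin (h + 1) → Fin k → ℂ := Fin.induction (motive := fun _ => Fin k → ℂ) 0
    fun i v b => T i v b.succ - N i b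
  have hR : ∀ i : Fin h, R i.succ = fun b => T i (R i.castSucc) b.succ - N i b := fun i =>
    Fin.induction_succ _ _ _
  refine ⟨of fun i => T i (R i.castSucc), of R, ?_, ?_⟩
  · ext a b
    simp [T]
  · ext a b
    simp [hR]

theorem isComplement_F_FT (k h : ℕ) :
    IsComplement (kronF k) (kronK k) (kronF h)ᵀ (kronK h)ᵀ
      (fun _ y => (y : ℕ) = h) (fun x _ => (x : ℕ) = 0) := by
  refine ⟨fun M N => ?_, fun S R hP hQ => ?_⟩
  · let T : Fin h → (Fin k → ℂ) → Fin (k + 1) → ℂ := fun j v a =>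
      M a j.castSucc + Fin.snoc (α := fun _ => ℂ) v 0 a
    let R : Fin (h + 1) → Fin k → ℂ := Fin.induction (motive := fun _ => Fin k → ℂ)
      (fun a => - N a.succ 0) fun j v a => T j v a.succ - N a.succ j.succ
    have hzero : R 0 = fun a => - N a.succ 0 := Fin.induction_zero _ _
    have hR : ∀ j : Fin h, R j.succ = fun a => T j (R j.castSucc) a.succ - N a.succ j.succ :=
      fun j => Fin.induction_succ _ _ _
    refine ⟨of fun a j => T j (R j.castSucc) a, of fun a j => R j a, fun x y hy => ?_,
      fun x y hx => ?_⟩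
    · induction y using Fin.lastCases with
      | last => simp at hy
      | cast j =>
        induction x using Fin.lastCases with
        | last => simp [T]
        | cast i => simp [T]
    · induction x using Fin.cases with
      | zero => simp at hx
      | succ i =>
        induction y using Fin.cases with
        | zero => simp [hzero]
        | succ j => simp [hR]
  · have hS : ∀ a (j : Fin h), S a j = (kronF k * R) a j.castSucc := fun a j => by
      simpa [sub_eq_zero] using hP a j.castSucc (by simpa using j.isLt.ne)
    have h0 : ∀ j i, R i j = 0 := by
      intro j
      induction j using Fin.induction with
      | zero => exact fun i => by simpa using hQ i.succ 0 (by simp)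
      | succ j ih =>
        intro i
        have hcol : ∀ a, (kronF k * R) a j.castSucc = 0 := by
          intro a
          simp [mul_apply, ih]
        simpa [hS, hcol] using hQ i.succ j.succ (by simp)
    obtain rfl : R = 0 := by ext i j; exact h0 j i
    obtain rfl : S = 0 := by ext a j; simp [hS]
    simp

theorem isComplement_F_F (k h : ℕ) :
    IsComplement (kronF k) (kronK k) (kronF h) (kronK h)
      (fun _ _ => False) (fun x y => (x : ℕ) = 0 ∧ (y : ℕ) + k + 1 < h) := by
  refine ⟨fun M N => ?_, fun S R hP hQ => ?_⟩
  · let M' : ℕ → ℕ → ℂ := fun a b => if h : a < k + 1 ∧ b < h then M ⟨a, h.1⟩ ⟨b, h.2⟩ else 0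
    let N' : ℕ → ℕ → ℂ := fun a b => if h : a < k + 1 ∧ b < h then N ⟨a, h.1⟩ ⟨b, h.2⟩ else 0
    have hM : ∀ (a : Fin (k + 1)) (b : Fin h), M' a b = M a b := fun a b => by
      exact dif_pos ⟨a.isLt, b.isLt⟩
    have hN : ∀ (a : Fin (k + 1)) (b : Fin h), N' a b = N a b := fun a b => by
      exact dif_pos ⟨a.isLt, b.isLt⟩
    have hM' : ∀ a, M' a h = 0 := fun a => by simp [M']
    let X : ℕ → ℕ → ℂ := fun a b => N' a b - M' a (b + 1)
    let V : ℕ → ℕ → ℂ := fun a => Nat.rec (motive := fun _ => ℕ → ℂ)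
      (fun b => Nat.casesOn b 0 (X 0))
      (fun a v b => Nat.casesOn b 0 fun b => v b + X (a + 1) b) a
    let W : ℕ → ℕ → ℂ := fun i => Nat.rec (motive := fun _ => ℕ → ℂ)
      (fun _ => 0) (fun i v b => v (b + 1) - X (k - i) b) i
    let T : ℕ → ℕ → ℂ := fun a b => if h + a ≤ b + k then V a b else W (k - a) b
    have hT0 : ∀ b, h ≤ b + 1 + k → T 0 (b + 1) = X 0 b := fun b hb => by
      simp only [T, add_zero, if_pos hb]
      rfl
    have hT : ∀ a b, a < k → T (a + 1) (b + 1) = T a b + X (a + 1) b := by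
      intro a b hak
      by_cases hb : h + a ≤ b + k
      · have hb' : h + (a + 1) ≤ b + 1 + k := by omega
        simp only [T, if_pos hb, if_pos hb']
        rfl
      · have hb' : ¬ h + (a + 1) ≤ b + 1 + k := by omega
        obtain ⟨i, rfl⟩ : ∃ i, k = a + 1 + i := ⟨k - (a + 1), by omega⟩
        have h₁ : a + 1 + i - (a + 1) = i := by omega
        have h₂ : a + 1 + i - a = i + 1 := by omega
        have h₃ : W (i + 1) b = W i (b + 1) - X (a + 1 + i - i) b := rfl
        have h₄ : a + 1 + i - i = a + 1 := by omega
        simp only [T, if_neg hb, if_neg hb', h₁, h₂, h₃, h₄]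
        ring
    have hTk : ∀ b, b < h → T k b = 0 := by
      intro b hb
      have hb' : ¬ h + k ≤ b + k := by omega
      simp only [T, if_neg hb', Nat.sub_self]
      rfl
    refine ⟨of fun a b => M' a b + T a b, of fun a b => T a b, fun x y _ => ?_, fun x y hx => ?_⟩
    · induction x using Fin.lastCases with
      | last =>
        have := hM (Fin.last k) y
        simp_all
      | cast i =>
        have := hM i.castSucc y
        simp_all
    · have hNX : X x y = N x y - M' x (y + 1) := by simp only [X, hN]
      induction x using Fin.cases with
      | zero =>
        have hy := hT0 y (by simp at hx; omega)
        simp only [Fin.val_zero] at hNX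
        simp [hy, hNX]
      | succ i =>
        have hy := hT i y i.isLt
        simp only [Fin.val_succ] at hNX
        simp [hy, hNX]
        ring
  · have hS : ∀ a (b : Fin h), S a b.castSucc = (kronF k * R) a b := fun a b => by
      simpa [sub_eq_zero] using hP a b id
    have hS' : ∀ (a : Fin (k + 1)) (b : Fin h), ¬ ((a : ℕ) = 0 ∧ (b : ℕ) + k + 1 < h) →
        S a b.succ = (kronK k * R) a b := fun a b hab => by
      simpa [sub_eq_zero] using hQ a b hab
    have h0 : ∀ (a : Fin (k + 1)) (b : Fin (h + 1)), (b : ℕ) + k < h + a → S a b = 0 := by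
      intro a
      induction a using Fin.reverseInduction with
      | last =>
        intro b hb
        induction b using Fin.lastCases with
        | last => simp at hb
        | cast b => simp [hS]
      | cast i ih =>
        intro b hb
        induction b using Fin.lastCases with
        | last => simp at hb; omega
        | cast b =>
          have := hS' i.succ b (by simp)
          rw [hS, kronF_mul_castSucc, ← kronK_mul_succ R, ← this]
          exact ih _ (by simp at hb ⊢; omega)
    refine ⟨by ext a b; simpa using hP a b id, ?_⟩
    ext a b
    by_cases hab : (a : ℕ) = 0 ∧ (b : ℕ) + k + 1 < h
    · obtain rfl : a = 0 := Fin.ext hab.1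
      have := h0 0 b.succ (by simp; omega)
      simpa using this
    · exact hQ a b hab

section transposed

variable {n : Type*} [Fintype n] [DecidableEq n] (k : ℕ) (Z : Matrix n n ℂ)

theorem isComplement_one_F :
    IsComplement 1 Z (kronF k) (kronK k) (fun _ _ => False) (fun _ _ => False) := by
  simpa using (isComplement_FT_one k Zᵀ).transpose

theorem isComplement_one_right_F :
    IsComplement Z 1 (kronF k) (kronK k) (fun _ _ => False) (fun _ _ => False) := by
  simpa using (isComplement_FT_one_right k Zᵀ).transpose

theorem isComplement_one_FT :
    IsComplement 1 Z (kronF k)ᵀ (kronK k)ᵀ (fun _ _ => False) (fun _ y => (y : ℕ) = 0) := by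
  simpa using (isComplement_F_one k Zᵀ).transpose

theorem isComplement_one_right_FT :
    IsComplement Z 1 (kronF k)ᵀ (kronK k)ᵀ (fun _ y => (y : ℕ) = k) (fun _ _ => False) := by
  simpa using (isComplement_F_one_right k Zᵀ).transpose

end transposed

section commutator

variable (m n : ℕ)

theorem exists_commutator_jordan_first_column (X : Matrix (Fin m) (Fin (n + 1)) ℂ) :
    ∃ R : Matrix (Fin m) (Fin (n + 1)) ℂ, ∀ (x : Fin m) (y : Fin (n + 1)), (y : ℕ) ≠ 0 →
      (R * jordan 0 (n + 1) - jordan 0 m * R) x y = X x y := by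
  let R : Fin (n + 1) → Fin m → ℂ := Fin.reverseInduction (motive := fun _ => Fin m → ℂ) 0
    fun j v => jordan 0 m *ᵥ v + fun a => X a j.succ
  have hR : ∀ j : Fin n, R j.castSucc = jordan 0 m *ᵥ R j.succ + fun a => X a j.succ := fun j =>
    Fin.reverseInduction_castSucc _
  refine ⟨of fun a j => R j a, fun x y hy => ?_⟩
  induction y using Fin.cases with
  | zero => simp at hy
  | succ j =>
    have : (jordan 0 m * of fun a j => R j a) x j.succ = (jordan 0 m *ᵥ R j.succ) x := rfl
    rw [Matrix.sub_apply, this]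
    simp [hR]

theorem exists_commutator_jordan_last_row (X : Matrix (Fin (m + 1)) (Fin n) ℂ) :
    ∃ R : Matrix (Fin (m + 1)) (Fin n) ℂ, ∀ (x : Fin (m + 1)) (y : Fin n), (x : ℕ) ≠ m →
      (R * jordan 0 n - jordan 0 (m + 1) * R) x y = X x y := by
  let R : Fin (m + 1) → Fin n → ℂ := Fin.induction (motive := fun _ => Fin n → ℂ) 0
    fun i v => v ᵥ* jordan 0 n - X i.castSucc
  have hR : ∀ i : Fin m, R i.succ = R i.castSucc ᵥ* jordan 0 n - X i.castSucc := fun i =>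
    Fin.induction_succ _ _ _
  refine ⟨of R, fun x y hx => ?_⟩
  induction x using Fin.lastCases with
  | last => simp at hx
  | cast i =>
    have : (of R * jordan 0 n) i.castSucc = R i.castSucc ᵥ* jordan 0 n := mul_apply_eq_vecMul _ _ _
    rw [Matrix.sub_apply, this]
    simp [hR]

variable {m n}

theorem commutator_jordan_eq_zero_of_first_column (hmn : m ≤ n)
    (R : Matrix (Fin (m + 1)) (Fin (n + 1)) ℂ)
    (h : ∀ (x : Fin (m + 1)) (y : Fin (n + 1)), (y : ℕ) ≠ 0 → (R * jordan 0 (n + 1) - jordan 0 (m + 1) * R) x y = 0) :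
    R * jordan 0 (n + 1) - jordan 0 (m + 1) * R = 0 := by
  have h0 : ∀ (a : Fin (m + 1)) (b : Fin (n + 1)), (b : ℕ) + m < a + n → R a b = 0 := by
    intro a
    induction a using Fin.reverseInduction with
    | last =>
      intro b hb
      induction b using Fin.lastCases with
      | last => simp [add_comm] at hb
      | cast b => simpa using h (Fin.last m) b.succ (by simp)
    | cast i ih =>
      intro b hb
      induction b using Fin.lastCases with
      | last => simp at hb; omega
      | cast b =>
        have h₁ := h i.castSucc b.succ (by simp)
        rw [Matrix.sub_apply, mul_jordan_succ, jordan_mul_castSucc, sub_eq_zero] at h₁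
        rw [h₁]
        exact ih _ (by simp at hb ⊢; omega)
  ext x y
  induction y using Fin.cases with
  | succ j => exact h x j.succ (by simp)
  | zero =>
    induction x using Fin.lastCases with
    | last => simp
    | cast i => simpa using h0 i.succ 0 (by simp; omega)

theorem commutator_jordan_eq_zero_of_last_row (hmn : n < m)
    (R : Matrix (Fin (m + 1)) (Fin (n + 1)) ℂ)
    (h : ∀ (x : Fin (m + 1)) (y : Fin (n + 1)), (x : ℕ) ≠ m → (R * jordan 0 (n + 1) - jordan 0 (m + 1) * R) x y = 0) :
    R * jordan 0 (n + 1) - jordan 0 (m + 1) * R = 0 := by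
  have h0 : ∀ (b : Fin (n + 1)) (a : Fin (m + 1)), (b : ℕ) < a → R a b = 0 := by
    intro b
    induction b using Fin.induction with
    | zero =>
      intro a ha
      induction a using Fin.cases with
      | zero => simp at ha
      | succ i => simpa using h i.castSucc 0 (by simpa using i.isLt.ne)
    | succ j ih =>
      intro a ha
      induction a using Fin.cases with
      | zero => simp at ha
      | succ i =>
        have h₁ := h i.castSucc j.succ (by simpa using i.isLt.ne)
        rw [Matrix.sub_apply, mul_jordan_succ, jordan_mul_castSucc, sub_eq_zero] at h₁
        rw [← h₁]
        exact ih _ (by simpa using ha)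
  ext x y
  induction x using Fin.lastCases with
  | cast i => exact h i.castSucc y (by simpa using i.isLt.ne)
  | last =>
    induction y using Fin.cases with
    | zero => simp
    | succ j => simpa using h0 j.castSucc (Fin.last m) (by simp; omega)

theorem isComplement_jordan_self (lam : ℂ) {m n : ℕ} (hm : 1 ≤ m) (hn : 1 ≤ n) :
    IsComplement 1 (jordan lam m) 1 (jordan lam n) (fun _ _ => False)
      (fun x y => (m ≤ n ∧ (y : ℕ) = 0) ∨ (n < m ∧ (x : ℕ) = m - 1)) := by
  have hlam : ∀ R : Matrix (Fin m) (Fin n) ℂ, R * jordan lam n - jordan lam m * R =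
      R * jordan 0 n - jordan 0 m * R := fun R => by
    rw [jordan_eq_add lam m, jordan_eq_add lam n]
    simp [Matrix.mul_add, Matrix.add_mul]
  obtain ⟨m, rfl⟩ := Nat.exists_eq_add_of_le' hm
  obtain ⟨n, rfl⟩ := Nat.exists_eq_add_of_le' hn
  refine ⟨fun M N => ?_, fun S R hP hQ => ?_⟩
  · suffices ∃ R : Matrix (Fin (m + 1)) (Fin (n + 1)) ℂ, ∀ (x : Fin (m + 1))
        (y : Fin (n + 1)),
        ¬ ((m + 1 ≤ n + 1 ∧ (y : ℕ) = 0) ∨ (n + 1 < m + 1 ∧ (x : ℕ) = m + 1 - 1)) →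
        (R * jordan 0 (n + 1) - jordan 0 (m + 1) * R) x y = (N - M * jordan lam (n + 1)) x y by
      obtain ⟨R, hR⟩ := this
      refine ⟨M + R, R, fun x y _ => by simp, fun x y hxy => ?_⟩
      rw [Matrix.add_mul, add_sub_assoc, hlam, Matrix.add_apply, hR x y hxy]
      simp
    rcases le_or_gt m n with hmn | hmn
    · obtain ⟨R, hR⟩ := exists_commutator_jordan_first_column (m + 1) n
        (N - M * jordan lam (n + 1))
      exact ⟨R, fun x y hxy => hR x y (by omega)⟩
    · obtain ⟨R, hR⟩ := exists_commutator_jordan_last_row m (n + 1)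
        (N - M * jordan lam (n + 1))
      exact ⟨R, fun x y hxy => hR x y (by omega)⟩
  · obtain rfl : S = R := by
      ext a b
      simpa [sub_eq_zero] using hP a b id
    rw [hlam] at hQ ⊢
    refine ⟨by simp, ?_⟩
    rcases le_or_gt m n with hmn | hmn
    · exact commutator_jordan_eq_zero_of_first_column hmn S fun x y hy => hQ x y (by dsimp only; omega)
    · exact commutator_jordan_eq_zero_of_last_row hmn S fun x y hx => hQ x y (by dsimp only; omega)

end commutator

section blocks

variable (l r : ℕ) (p : Fin l → ℕ) (q : Fin r → ℕ)
variable (s : ℕ) (lamC : Fin s → ℂ) (tC : Fin s → ℕ) (szC : ∀ i : Fin s, Fin (tC i) → ℕ)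
variable (u : ℕ) (dsz : Fin u → ℕ)

/-- Labels of the diagonal blocks of a Kronecker pair. -/
abbrev Block := Fin l ⊕ ((Σ i : Fin s, Fin (tC i)) ⊕ (Fin u ⊕ Fin r))

/-- Number of rows of a diagonal block, for minimal indices `p` and `q`. -/
def rowSize : Block l r s tC u → ℕ
  | Sum.inl i => p i + 1
  | Sum.inr (Sum.inl ij) => szC ij.1 ij.2
  | Sum.inr (Sum.inr (Sum.inl k)) => dsz k
  | Sum.inr (Sum.inr (Sum.inr j)) => q j

/-- Number of columns of a diagonal block, for minimal indices `p` and `q`. -/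
def colSize : Block l r s tC u → ℕ
  | Sum.inl i => p i
  | Sum.inr (Sum.inl ij) => szC ij.1 ij.2
  | Sum.inr (Sum.inr (Sum.inl k)) => dsz k
  | Sum.inr (Sum.inr (Sum.inr j)) => q j + 1

/-- The diagonal blocks of `A`. -/
def blockA : ∀ b : Block l r s tC u, Matrix (Fin (rowSize l r p q s tC szC u dsz b))
    (Fin (colSize l r p q s tC szC u dsz b)) ℂ
  | Sum.inl i => kronF (p i)
  | Sum.inr (Sum.inl ij) => (1 : Matrix (Fin (szC ij.1 ij.2)) (Fin (szC ij.1 ij.2)) ℂ)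
  | Sum.inr (Sum.inr (Sum.inl k)) => jordan 0 (dsz k)
  | Sum.inr (Sum.inr (Sum.inr j)) => (kronF (q j))ᵀ

/-- The diagonal blocks of `B`. -/
def blockB : ∀ b : Block l r s tC u, Matrix (Fin (rowSize l r p q s tC szC u dsz b))
    (Fin (colSize l r p q s tC szC u dsz b)) ℂ
  | Sum.inl i => kronK (p i)
  | Sum.inr (Sum.inl ij) => jordan (lamC ij.1) (szC ij.1 ij.2)
  | Sum.inr (Sum.inr (Sum.inl k)) => (1 : Matrix (Fin (dsz k)) (Fin (dsz k)) ℂ)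
  | Sum.inr (Sum.inr (Sum.inr j)) => (kronK (q j))ᵀ

/-- Row indices of the Kronecker pair as pairs of a block and a row of that block. -/
def rowEquiv : (Σ b : Block l r s tC u, Fin (rowSize l r p q s tC szC u dsz b)) ≃
    Row l r (fun i => p i + 1) (fun j => q j + 1) s tC szC u dsz where
  toFun
    | ⟨Sum.inl i, a⟩ => Sum.inl ⟨i, a⟩
    | ⟨Sum.inr (Sum.inl ij), a⟩ => Sum.inr (Sum.inl ⟨ij.1, ij.2, a⟩)
    | ⟨Sum.inr (Sum.inr (Sum.inl k)), a⟩ => Sum.inr (Sum.inr (Sum.inl ⟨k, a⟩))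
    | ⟨Sum.inr (Sum.inr (Sum.inr j)), a⟩ => Sum.inr (Sum.inr (Sum.inr ⟨j, a⟩))
  invFun
    | Sum.inl ⟨i, a⟩ => ⟨Sum.inl i, a⟩
    | Sum.inr (Sum.inl ⟨i, j, a⟩) => ⟨Sum.inr (Sum.inl ⟨i, j⟩), a⟩
    | Sum.inr (Sum.inr (Sum.inl ⟨k, a⟩)) => ⟨Sum.inr (Sum.inr (Sum.inl k)), a⟩
    | Sum.inr (Sum.inr (Sum.inr ⟨j, a⟩)) => ⟨Sum.inr (Sum.inr (Sum.inr j)), a⟩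
  left_inv := by rintro ⟨_ | _ | _ | _, a⟩ <;> rfl
  right_inv := by rintro (⟨i, a⟩ | ⟨i, j, a⟩ | ⟨k, a⟩ | ⟨j, a⟩) <;> rfl

/-- Column indices of the Kronecker pair as pairs of a block and a column of that block. -/
def colEquiv : (Σ b : Block l r s tC u, Fin (colSize l r p q s tC szC u dsz b)) ≃
    Col l r (fun i => p i + 1) (fun j => q j + 1) s tC szC u dsz where
  toFun
    | ⟨Sum.inl i, a⟩ => Sum.inl ⟨i, a⟩
    | ⟨Sum.inr (Sum.inl ij), a⟩ => Sum.inr (Sum.inl ⟨ij.1, ij.2, a⟩)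
    | ⟨Sum.inr (Sum.inr (Sum.inl k)), a⟩ => Sum.inr (Sum.inr (Sum.inl ⟨k, a⟩))
    | ⟨Sum.inr (Sum.inr (Sum.inr j)), a⟩ => Sum.inr (Sum.inr (Sum.inr ⟨j, a⟩))
  invFun
    | Sum.inl ⟨i, a⟩ => ⟨Sum.inl i, a⟩
    | Sum.inr (Sum.inl ⟨i, j, a⟩) => ⟨Sum.inr (Sum.inl ⟨i, j⟩), a⟩
    | Sum.inr (Sum.inr (Sum.inl ⟨k, a⟩)) => ⟨Sum.inr (Sum.inr (Sum.inl k)), a⟩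
    | Sum.inr (Sum.inr (Sum.inr ⟨j, a⟩)) => ⟨Sum.inr (Sum.inr (Sum.inr j)), a⟩
  left_inv := by rintro ⟨_ | _ | _ | _, a⟩ <;> rfl
  right_inv := by rintro (⟨i, a⟩ | ⟨i, j, a⟩ | ⟨k, a⟩ | ⟨j, a⟩) <;> rfl

theorem A_submatrix :
    (A l r (fun i => p i + 1) (fun j => q j + 1) s tC szC u dsz).submatrix
      (rowEquiv l r p q s tC szC u dsz) (colEquiv l r p q s tC szC u dsz) =
    Matrix.blockDiagonal' (blockA l r p q s tC szC u dsz) := by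
  ext ⟨i, a⟩ ⟨j, b⟩
  by_cases hij : i = j
  · subst hij
    rw [blockDiagonal'_apply_eq]
    rcases i with i | ⟨i, j⟩ | k | j
    · change (if i = i ∧ (a : ℕ) = b then (1 : ℂ) else 0) = if (a : ℕ) = b then 1 else 0
      simp
    · have h : ∀ a b : Fin (szC i j), (if (⟨i, j, a⟩ : CI s tC szC) = ⟨i, j, b⟩ then (1 : ℂ)
          else 0) = (1 : Matrix (Fin (szC i j)) (Fin (szC i j)) ℂ) a b := by
        simp [one_apply]
      exact h a b
    · change (if k = k ∧ (b : ℕ) = a + 1 then (1 : ℂ) else 0) = jordanEntry 0 a b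
      rw [jordanEntry]
      split_ifs <;> simp_all
    · change (if j = j ∧ (a : ℕ) = b then (1 : ℂ) else 0) = if (b : ℕ) = a then 1 else 0
      simp [eq_comm]
  · rw [blockDiagonal'_apply_ne _ _ _ hij]
    match i, j with
    | Sum.inl _, Sum.inl _ => exact if_neg fun h => hij (congrArg _ h.1)
    | Sum.inr (Sum.inl ⟨_, _⟩), Sum.inr (Sum.inl ⟨_, _⟩) =>
      refine if_neg fun h => hij ?_
      cases h
      rfl
    | Sum.inr (Sum.inr (Sum.inl _)), Sum.inr (Sum.inr (Sum.inl _)) =>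
      exact if_neg fun h => hij (congrArg (Sum.inr ∘ Sum.inr ∘ Sum.inl) (And.left h))
    | Sum.inr (Sum.inr (Sum.inr _)), Sum.inr (Sum.inr (Sum.inr _)) =>
      exact if_neg fun h => hij (congrArg (Sum.inr ∘ Sum.inr ∘ Sum.inr) (And.left h))
    | Sum.inl _, Sum.inr (Sum.inl _) => rfl
    | Sum.inl _, Sum.inr (Sum.inr (Sum.inl _)) => rfl
    | Sum.inl _, Sum.inr (Sum.inr (Sum.inr _)) => rfl
    | Sum.inr (Sum.inl _), Sum.inl _ => rfl
    | Sum.inr (Sum.inl _), Sum.inr (Sum.inr (Sum.inl _)) => rfl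
    | Sum.inr (Sum.inl _), Sum.inr (Sum.inr (Sum.inr _)) => rfl
    | Sum.inr (Sum.inr (Sum.inl _)), Sum.inl _ => rfl
    | Sum.inr (Sum.inr (Sum.inl _)), Sum.inr (Sum.inl _) => rfl
    | Sum.inr (Sum.inr (Sum.inl _)), Sum.inr (Sum.inr (Sum.inr _)) => rfl
    | Sum.inr (Sum.inr (Sum.inr _)), Sum.inl _ => rfl
    | Sum.inr (Sum.inr (Sum.inr _)), Sum.inr (Sum.inl _) => rfl
    | Sum.inr (Sum.inr (Sum.inr _)), Sum.inr (Sum.inr (Sum.inl _)) => rfl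

theorem B_submatrix :
    (B l r (fun i => p i + 1) (fun j => q j + 1) s lamC tC szC u dsz).submatrix
      (rowEquiv l r p q s tC szC u dsz) (colEquiv l r p q s tC szC u dsz) =
    Matrix.blockDiagonal' (blockB l r p q s lamC tC szC u dsz) := by
  ext ⟨i, a⟩ ⟨j, b⟩
  by_cases hij : i = j
  · subst hij
    rw [blockDiagonal'_apply_eq]
    rcases i with i | ⟨i, j⟩ | k | j
    · change (if i = i ∧ (a : ℕ) = b + 1 then (1 : ℂ) else 0) = if (a : ℕ) = b + 1 then 1 else 0
      simp
    · change (if i = i ∧ (j : ℕ) = j then jordanEntry (lamC i) a b else 0) =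
        jordanEntry (lamC i) a b
      simp
    · have h : ∀ a b : Fin (dsz k), (if (⟨k, a⟩ : DI u dsz) = ⟨k, b⟩ then (1 : ℂ) else 0) =
          (1 : Matrix (Fin (dsz k)) (Fin (dsz k)) ℂ) a b := by
        simp [one_apply]
      exact h a b
    · change (if j = j ∧ (b : ℕ) = a + 1 then (1 : ℂ) else 0) = if (b : ℕ) = a + 1 then 1 else 0
      simp
  · rw [blockDiagonal'_apply_ne _ _ _ hij]
    match i, j with
    | Sum.inl _, Sum.inl _ => exact if_neg fun h => hij (congrArg _ h.1)
    | Sum.inr (Sum.inl ⟨_, _⟩), Sum.inr (Sum.inl ⟨_, _⟩) =>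
      refine if_neg fun h => hij ?_
      obtain ⟨h₁, h₂⟩ := h
      dsimp only [rowEquiv, colEquiv, Equiv.coe_fn_mk] at h₁ h₂
      subst h₁
      rw [Fin.ext h₂]
    | Sum.inr (Sum.inr (Sum.inl _)), Sum.inr (Sum.inr (Sum.inl _)) =>
      refine if_neg fun h => hij ?_
      cases h
      rfl
    | Sum.inr (Sum.inr (Sum.inr _)), Sum.inr (Sum.inr (Sum.inr _)) =>
      exact if_neg fun h => hij (congrArg (Sum.inr ∘ Sum.inr ∘ Sum.inr) (And.left h))
    | Sum.inl _, Sum.inr (Sum.inl _) => rfl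
    | Sum.inl _, Sum.inr (Sum.inr (Sum.inl _)) => rfl
    | Sum.inl _, Sum.inr (Sum.inr (Sum.inr _)) => rfl
    | Sum.inr (Sum.inl _), Sum.inl _ => rfl
    | Sum.inr (Sum.inl _), Sum.inr (Sum.inr (Sum.inl _)) => rfl
    | Sum.inr (Sum.inl _), Sum.inr (Sum.inr (Sum.inr _)) => rfl
    | Sum.inr (Sum.inr (Sum.inl _)), Sum.inl _ => rfl
    | Sum.inr (Sum.inr (Sum.inl _)), Sum.inr (Sum.inl _) => rfl
    | Sum.inr (Sum.inr (Sum.inl _)), Sum.inr (Sum.inr (Sum.inr _)) => rfl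
    | Sum.inr (Sum.inr (Sum.inr _)), Sum.inl _ => rfl
    | Sum.inr (Sum.inr (Sum.inr _)), Sum.inr (Sum.inl _) => rfl
    | Sum.inr (Sum.inr (Sum.inr _)), Sum.inr (Sum.inr (Sum.inl _)) => rfl

variable {l r p q s lamC tC szC u dsz}

theorem isComplement_block
    (hpmono : ∀ i i' : Fin l, i ≤ i' → p i ≤ p i')
    (hqmono : ∀ j j' : Fin r, j ≤ j' → q j' ≤ q j)
    (hlam : Function.Injective lamC) (hszC1 : ∀ i j, 1 ≤ szC i j) (hd1 : ∀ k, 1 ≤ dsz k)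
    (i j : Block l r s tC u) :
    IsComplement (blockA l r p q s tC szC u dsz i) (blockB l r p q s lamC tC szC u dsz i)
      (blockA l r p q s tC szC u dsz j) (blockB l r p q s lamC tC szC u dsz j)
      (fun x y => PSupp l r (fun i => p i + 1) (fun j => q j + 1) s tC szC u dsz
        (rowEquiv l r p q s tC szC u dsz ⟨i, x⟩) (colEquiv l r p q s tC szC u dsz ⟨j, y⟩))
      (fun x y => QSupp l r (fun i => p i + 1) (fun j => q j + 1) s tC szC u dsz
        (rowEquiv l r p q s tC szC u dsz ⟨i, x⟩) (colEquiv l r p q s tC szC u dsz ⟨j, y⟩)) := by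
  rcases i with i | i | i | i <;> rcases j with j | j | j | j
  · refine (isComplement_F_F (p i) (p j)).congr (fun _ _ => Iff.rfl) fun x y => ?_
    show _ ↔ i < j ∧ (x : ℕ) = 0 ∧ (y : ℕ) < p j + 1 - 1 - (p i + 1)
    have := hpmono j i
    grind
  · exact isComplement_F_one _ _
  · exact isComplement_F_one_right _ _
  · exact isComplement_F_FT _ _
  · exact isComplement_one_F _ _
  · obtain ⟨i, i'⟩ := i
    obtain ⟨j, j'⟩ := j
    by_cases hij : i = j
    · subst hij
      exact (isComplement_jordan_self (lamC i) (hszC1 i i') (hszC1 i j')).congr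
        (fun _ _ => Iff.rfl) fun _ _ => (and_iff_right rfl).symm
    · exact (isComplement_jordan_of_ne (hlam.ne hij) _ _).congr
        (fun _ _ => Iff.rfl) fun _ _ => (iff_false_intro fun h => hij h.1).symm
  · exact isComplement_one_left_nilpotent _ ⟨_, jordan_zero_pow _⟩
  · exact isComplement_one_FT _ _
  · exact isComplement_one_right_F _ _
  · exact isComplement_nilpotent_one_right _ ⟨_, jordan_zero_pow _⟩
  · exact (isComplement_jordan_self 0 (hd1 i) (hd1 j)).swap
  · exact isComplement_one_right_FT _ _
  · exact isComplement_FT_F _ _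
  · exact isComplement_FT_one _ _
  · exact isComplement_FT_one_right _ _
  · refine (isComplement_F_F (q j) (q i)).transpose.congr (fun _ _ => Iff.rfl) fun x y => ?_
    show _ ↔ i < j ∧ (y : ℕ) = 0 ∧ (x : ℕ) < q i + 1 - 1 - (q j + 1)
    have := hqmono j i
    grind

end blocks

/-- Theorem 3.1 of the paper over `ℂ`: the space of pairs is the internal direct sum of
the coordinate subspace `𝒫` (supported on `PSupp`, `QSupp`) and the tangent space
`{(SA − AR, SB − BR)}`: every pair `(M, N)` decomposes, uniquely, as a sum of the two. -/
theorem simplest_miniversal_kronecker_complex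
    (hp1 : ∀ i, 1 ≤ p i) (hpmono : ∀ i i' : Fin l, i ≤ i' → p i ≤ p i')
    (hq1 : ∀ j, 1 ≤ q j) (hqmono : ∀ j j' : Fin r, j ≤ j' → q j' ≤ q j)
    (hlam : Function.Injective lamC)
    (hszC1 : ∀ i j, 1 ≤ szC i j)
    (hszCmono : ∀ (i : Fin s) (j j' : Fin (tC i)), j ≤ j' → szC i j' ≤ szC i j)
    (hd1 : ∀ k, 1 ≤ dsz k) (hdmono : ∀ k k' : Fin u, k ≤ k' → dsz k' ≤ dsz k) :
    (∀ M N : Matrix (Row l r p q s tC szC u dsz) (Col l r p q s tC szC u dsz) ℂ,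
      ∃ (P Q : Matrix (Row l r p q s tC szC u dsz) (Col l r p q s tC szC u dsz) ℂ)
        (S : Matrix (Row l r p q s tC szC u dsz) (Row l r p q s tC szC u dsz) ℂ)
        (R : Matrix (Col l r p q s tC szC u dsz) (Col l r p q s tC szC u dsz) ℂ),
        (∀ x y, ¬ PSupp l r p q s tC szC u dsz x y → P x y = 0) ∧
        (∀ x y, ¬ QSupp l r p q s tC szC u dsz x y → Q x y = 0) ∧
        M = P + (S * A l r p q s tC szC u dsz - A l r p q s tC szC u dsz * R) ∧
        N = Q + (S * B l r p q s lamC tC szC u dsz - B l r p q s lamC tC szC u dsz * R)) ∧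
    (∀ (P Q : Matrix (Row l r p q s tC szC u dsz) (Col l r p q s tC szC u dsz) ℂ)
        (S : Matrix (Row l r p q s tC szC u dsz) (Row l r p q s tC szC u dsz) ℂ)
        (R : Matrix (Col l r p q s tC szC u dsz) (Col l r p q s tC szC u dsz) ℂ),
        (∀ x y, ¬ PSupp l r p q s tC szC u dsz x y → P x y = 0) →
        (∀ x y, ¬ QSupp l r p q s tC szC u dsz x y → Q x y = 0) →
        P + (S * A l r p q s tC szC u dsz - A l r p q s tC szC u dsz * R) = 0 →
        Q + (S * B l r p q s lamC tC szC u dsz - B l r p q s lamC tC szC u dsz * R) = 0 →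
        P = 0 ∧ Q = 0 ∧
          S * A l r p q s tC szC u dsz - A l r p q s tC szC u dsz * R = 0 ∧
          S * B l r p q s lamC tC szC u dsz - B l r p q s lamC tC szC u dsz * R = 0) := by
  obtain ⟨p, rfl⟩ : ∃ p' : Fin l → ℕ, p = fun i => p' i + 1 :=
    ⟨fun i => p i - 1, funext fun i => (Nat.sub_add_cancel (hp1 i)).symm⟩
  obtain ⟨q, rfl⟩ : ∃ q' : Fin r → ℕ, q = fun j => q' j + 1 :=
    ⟨fun j => q j - 1, funext fun j => (Nat.sub_add_cancel (hq1 j)).symm⟩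
  have key : IsComplement (A l r (fun i => p i + 1) (fun j => q j + 1) s tC szC u dsz)
      (B l r (fun i => p i + 1) (fun j => q j + 1) s lamC tC szC u dsz)
      (A l r (fun i => p i + 1) (fun j => q j + 1) s tC szC u dsz)
      (B l r (fun i => p i + 1) (fun j => q j + 1) s lamC tC szC u dsz)
      (PSupp l r (fun i => p i + 1) (fun j => q j + 1) s tC szC u dsz)
      (QSupp l r (fun i => p i + 1) (fun j => q j + 1) s tC szC u dsz) := by
    refine .of_submatrix (rowEquiv l r p q s tC szC u dsz) (colEquiv l r p q s tC szC u dsz)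
      (rowEquiv l r p q s tC szC u dsz) (colEquiv l r p q s tC szC u dsz) ?_
    rw [A_submatrix, B_submatrix]
    exact .blockDiagonal' (isComplement_block (fun i i' h => Nat.le_of_succ_le_succ (hpmono i i' h))
      (fun j j' h => Nat.le_of_succ_le_succ (hqmono j j' h)) hlam hszC1 hd1)
  refine ⟨fun M N => ?_, fun P Q S R hP hQ hM hN => ?_⟩
  · obtain ⟨S, R, hP, hQ⟩ := key.1 M N
    refine ⟨_, _, S, R, fun x y hxy => ?_, fun x y hxy => ?_, (sub_add_cancel M _).symm,
      (sub_add_cancel N _).symm⟩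
    · rw [Matrix.sub_apply, hP x y hxy, sub_self]
    · rw [Matrix.sub_apply, hQ x y hxy, sub_self]
  · obtain ⟨h₁, h₂⟩ := key.2 S R
      (fun x y hxy => by simpa [hP x y hxy] using congr_fun₂ hM x y)
      (fun x y hxy => by simpa [hQ x y hxy] using congr_fun₂ hN x y)
    exact ⟨by simpa [h₁] using hM, by simpa [h₂] using hN, h₁, h₂⟩

end KroneckerComplex
end
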